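/- Let T be a tree chosen uniformly at random from the n^{n−2} labeled trees on vertex set {1,…,n}. For every ε > 0, the probability that both |D(T) · ln ln n / ln n − 1| ≤ ε and |Δ(T) · ln ln n / ln n − 1| ≤ ε (where Δ(T) is the maximum degree of T) tends to 1 as n → ∞; in particular, with high probability D(T) = (1+o(1))Δ(T) = (1+o(1)) ln n / ln ln n. -/

import Mathlib

namespace FODef

/-- First-order formulas in the language of graphs (equality and adjacency), with free
variables among `x_0, …, x_{n-1}`. -/
inductive GForm : ℕ → Type
  | adj {n : ℕ} (i j : Fin n) : GForm n
  | eq {n : ℕ} (i j : Fin n) : GForm n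
  | neg {n : ℕ} : GForm n → GForm n
  | conj {n : ℕ} : GForm n → GForm n → GForm n
  | disj {n : ℕ} : GForm n → GForm n → GForm n
  | ex {n : ℕ} : GForm (n + 1) → GForm n
  | fa {n : ℕ} : GForm (n + 1) → GForm n

/-- Realization of a formula in a graph under a valuation of the free variables. -/
def GForm.Realize {V : Type} (G : SimpleGraph V) : ∀ {n : ℕ}, GForm n → (Fin n → V) → Prop
  | _, .adj i j, f => G.Adj (f i) (f j)
  | _, .eq i j, f => f i = f j
  | _, .neg φ, f => ¬ GForm.Realize G φ f
  | _, .conj φ ψ, f => GForm.Realize G φ f ∧ GForm.Realize G ψ f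
  | _, .disj φ ψ, f => GForm.Realize G φ f ∨ GForm.Realize G ψ f
  | _, .ex φ, f => ∃ v : V, GForm.Realize G φ (Fin.snoc f v)
  | _, .fa φ, f => ∀ v : V, GForm.Realize G φ (Fin.snoc f v)

/-- Quantifier depth: the maximum number of nested quantifiers. -/
def GForm.depth : ∀ {n : ℕ}, GForm n → ℕ
  | _, .adj _ _ => 0
  | _, .eq _ _ => 0
  | _, .neg φ => φ.depth
  | _, .conj φ ψ => max φ.depth ψ.depth
  | _, .disj φ ψ => max φ.depth ψ.depth
  | _, .ex φ => φ.depth + 1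
  | _, .fa φ => φ.depth + 1

/-- A sentence (formula with no free variables) holds in a graph. -/
def Sat {V : Type} (G : SimpleGraph V) (φ : GForm 0) : Prop :=
  φ.Realize G ![]

/-- A sentence defines the graph `G` if `G` satisfies it and every finite graph
satisfying it is isomorphic to `G`. -/
def Defines {V : Type} (G : SimpleGraph V) (φ : GForm 0) : Prop :=
  Sat G φ ∧ ∀ (m : ℕ) (H : SimpleGraph (Fin m)), Sat H φ → Nonempty (G ≃g H)

/-- `D G`: the minimum quantifier depth of a first-order sentence defining `G`. -/
noncomputable def D {V : Type} (G : SimpleGraph V) : ℕ :=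
  sInf {d | ∃ φ : GForm 0, φ.depth = d ∧ Defines G φ}

/-- Degree of a vertex. -/
noncomputable def deg {V : Type} (G : SimpleGraph V) (v : V) : ℕ :=
  Nat.card {w // G.Adj v w}

end FODef

namespace FODef

open Classical in
/-- The probability of the event `E` for a tree chosen uniformly at random among all
labeled trees on the vertex set `Fin n`. -/
noncomputable def treeProb (n : ℕ) (E : Set (SimpleGraph (Fin n))) : ℝ :=
  ((Finset.univ.filter
      (fun T : SimpleGraph (Fin n) => T.Connected ∧ T.IsAcyclic ∧ T ∈ E)).card : ℝ) /
  ((Finset.univ.filter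
      (fun T : SimpleGraph (Fin n) => T.Connected ∧ T.IsAcyclic)).card : ℝ)

/-- Maximum degree of a graph on a finite vertex set. -/
noncomputable def maxDeg {V : Type} [Fintype V] (G : SimpleGraph V) : ℕ :=
  Finset.univ.sup fun v => deg G v

end FODef

namespace FODef

section Games

variable {V W U : Type}

/-- The `k`-round back-and-forth relation between two graphs, started from a set of pairs of
already selected vertices. -/
def BF (G : SimpleGraph V) (H : SimpleGraph W) : ℕ → Set (V × W) → Prop
  | 0, s => ∀ p ∈ s, ∀ q ∈ s, (p.1 = q.1 ↔ p.2 = q.2) ∧ (G.Adj p.1 q.1 ↔ H.Adj p.2 q.2)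
  | k + 1, s => (∀ x, ∃ y, BF G H k (insert (x, y) s)) ∧ (∀ y, ∃ x, BF G H k (insert (x, y) s))

variable {G : SimpleGraph V} {H : SimpleGraph W} {K : SimpleGraph U}

theorem BF.anti : ∀ {k : ℕ} {s t : Set (V × W)}, BF G H k s → t ⊆ s → BF G H k t
  | 0, _, _, h, hts => fun p hp q hq => h p (hts hp) q (hts hq)
  | _ + 1, _, _, h, hts =>
    ⟨fun x => let ⟨y, hy⟩ := h.1 x; ⟨y, hy.anti (Set.insert_subset_insert hts)⟩,
     fun y => let ⟨x, hx⟩ := h.2 y; ⟨x, hx.anti (Set.insert_subset_insert hts)⟩⟩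

theorem BF.pred : ∀ {k : ℕ} {s : Set (V × W)}, BF G H (k + 1) s → BF G H k s
  | 0, s, h => fun p hp => by
      obtain ⟨y, hy⟩ := h.1 p.1
      exact (hy.anti (Set.subset_insert _ _)) p hp
  | _ + 1, _, h =>
    ⟨fun x => let ⟨y, hy⟩ := h.1 x; ⟨y, hy.pred⟩, fun y => let ⟨x, hx⟩ := h.2 y; ⟨x, hx.pred⟩⟩

theorem BF.mono {k j : ℕ} {s : Set (V × W)} (h : BF G H k s) (hjk : j ≤ k) : BF G H j s := by
  induction hjk using Nat.decreasingInduction with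
  | self => exact h
  | of_succ _ _ ih => exact ih.pred

theorem BF.atom {k : ℕ} {s : Set (V × W)} (h : BF G H k s) : BF G H 0 s := h.mono (Nat.zero_le _)

theorem BF.eq_iff {k : ℕ} {s : Set (V × W)} (h : BF G H k s) {x y : V} {x' y' : W}
    (hx : (x, x') ∈ s) (hy : (y, y') ∈ s) : x = y ↔ x' = y' := (h.atom _ hx _ hy).1

theorem BF.adj_iff {k : ℕ} {s : Set (V × W)} (h : BF G H k s) {x y : V} {x' y' : W}
    (hx : (x, x') ∈ s) (hy : (y, y') ∈ s) : G.Adj x y ↔ H.Adj x' y' := (h.atom _ hx _ hy).2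

theorem BF.symm : ∀ {k : ℕ} {s : Set (V × W)}, BF G H k s → BF H G k (Prod.swap ⁻¹' s)
  | 0, _, h => fun p hp q hq => ⟨(h _ hp _ hq).1.symm, (h _ hp _ hq).2.symm⟩
  | _ + 1, s, h => by
    have key : ∀ x y, Prod.swap ⁻¹' (insert (x, y) s) = insert (y, x) (Prod.swap ⁻¹' s) := by
      rintro x y
      ext ⟨a, b⟩
      simp [Prod.ext_iff, and_comm]
    exact ⟨fun x => let ⟨y, hy⟩ := h.2 x; ⟨y, key _ _ ▸ hy.symm⟩,
      fun y => let ⟨x, hx⟩ := h.1 y; ⟨x, key _ _ ▸ hx.symm⟩⟩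

theorem BF.trans : ∀ {k : ℕ} {s : Set (V × W)} {t : Set (W × U)} {r : Set (V × U)},
    BF G H k s → BF H K k t → (∀ p ∈ r, ∃ b, (p.1, b) ∈ s ∧ (b, p.2) ∈ t) → BF G K k r
  | 0, s, t, r, h₁, h₂, hr => by
    intro p hp q hq
    obtain ⟨b, hb, hb'⟩ := hr p hp
    obtain ⟨c, hc, hc'⟩ := hr q hq
    exact ⟨(h₁ _ hb _ hc).1.trans (h₂ _ hb' _ hc').1, (h₁ _ hb _ hc).2.trans (h₂ _ hb' _ hc').2⟩
  | k + 1, s, t, r, h₁, h₂, hr => by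
    have key : ∀ x y z, ∀ p ∈ insert (x, z) r,
        ∃ b, (p.1, b) ∈ insert (x, y) s ∧ (b, p.2) ∈ insert (y, z) t := by
      rintro x y z p (rfl | hp)
      · exact ⟨y, Set.mem_insert _ _, Set.mem_insert _ _⟩
      · obtain ⟨b, hb, hb'⟩ := hr p hp
        exact ⟨b, Set.mem_insert_of_mem _ hb, Set.mem_insert_of_mem _ hb'⟩
    refine ⟨fun x => ?_, fun z => ?_⟩
    · obtain ⟨y, hy⟩ := h₁.1 x
      obtain ⟨z, hz⟩ := h₂.1 y
      exact ⟨z, hy.trans hz (key x y z)⟩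
    · obtain ⟨y, hy⟩ := h₂.2 z
      obtain ⟨x, hx⟩ := h₁.2 y
      exact ⟨x, hx.trans hy (key x y z)⟩

theorem range_snoc {n : ℕ} (a : Fin n → V) (b : Fin n → W) (x : V) (y : W) :
    Set.range (fun i : Fin (n + 1) =>
      ((Fin.snoc a x : Fin (n + 1) → V) i, (Fin.snoc b y : Fin (n + 1) → W) i)) =
      insert (x, y) (Set.range fun i => (a i, b i)) := by
  ext p
  simp only [Set.mem_range, Set.mem_insert_iff]
  constructor
  · rintro ⟨i, rfl⟩
    induction i using Fin.lastCases with
    | last => left; simp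
    | cast i => right; exact ⟨i, by simp⟩
  · rintro (rfl | ⟨i, rfl⟩)
    · exact ⟨Fin.last n, by simp⟩
    · exact ⟨i.castSucc, by simp⟩

theorem BF.realize_iff {n : ℕ} (φ : GForm n) : ∀ {k : ℕ} {a : Fin n → V} {b : Fin n → W},
    φ.depth ≤ k → BF G H k (Set.range fun i => (a i, b i)) → (φ.Realize G a ↔ φ.Realize H b) := by
  induction φ with
  | adj i j => intro k a b _ h; exact h.adj_iff ⟨i, rfl⟩ ⟨j, rfl⟩
  | eq i j => intro k a b _ h; exact h.eq_iff ⟨i, rfl⟩ ⟨j, rfl⟩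
  | neg φ ih => intro k a b hk h; exact not_congr (ih hk h)
  | conj φ ψ ih₁ ih₂ =>
    intro k a b hk h
    exact and_congr (ih₁ ((le_max_left _ _).trans hk) h) (ih₂ ((le_max_right _ _).trans hk) h)
  | disj φ ψ ih₁ ih₂ =>
    intro k a b hk h
    exact or_congr (ih₁ ((le_max_left _ _).trans hk) h) (ih₂ ((le_max_right _ _).trans hk) h)
  | ex φ ih =>
    intro k a b hk h
    obtain _ | k := k
    · simp [GForm.depth] at hk
    have hk : φ.depth ≤ k := by simpa [GForm.depth] using hk
    constructor
    · rintro ⟨x, hx⟩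
      obtain ⟨y, hy⟩ := h.1 x
      exact ⟨y, (ih hk (by rwa [range_snoc])).1 hx⟩
    · rintro ⟨y, hy⟩
      obtain ⟨x, hx⟩ := h.2 y
      exact ⟨x, (ih hk (by rwa [range_snoc])).2 hy⟩
  | fa φ ih =>
    intro k a b hk h
    obtain _ | k := k
    · simp [GForm.depth] at hk
    have hk : φ.depth ≤ k := by simpa [GForm.depth] using hk
    constructor
    · intro hx y
      obtain ⟨x, hy⟩ := h.2 y
      exact (ih hk (by rwa [range_snoc])).1 (hx x)
    · intro hy x
      obtain ⟨y, hx⟩ := h.1 x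
      exact (ih hk (by rwa [range_snoc])).2 (hy y)

theorem exists_conj_form {n d : ℕ} {ι : Type} (s : Finset ι) (hs : s.Nonempty) (φ : ι → GForm n)
    (hd : ∀ i ∈ s, (φ i).depth = d) : ∃ ψ : GForm n, ψ.depth = d ∧
      ∀ (W : Type) (H : SimpleGraph W) b, ψ.Realize H b ↔ ∀ i ∈ s, (φ i).Realize H b := by
  induction hs using Finset.Nonempty.cons_induction with
  | singleton i => exact ⟨φ i, hd i (by simp), by simp⟩
  | cons i s hi _ ih =>
    obtain ⟨ψ, h₁, h₂⟩ := ih fun j hj => hd j (by simp [hj])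
    refine ⟨.conj (φ i) ψ, by simp [GForm.depth, h₁, hd i], fun W H b => ?_⟩
    simp [GForm.Realize, h₂]

theorem exists_disj_form {n d : ℕ} {ι : Type} (s : Finset ι) (hs : s.Nonempty) (φ : ι → GForm n)
    (hd : ∀ i ∈ s, (φ i).depth = d) : ∃ ψ : GForm n, ψ.depth = d ∧
      ∀ (W : Type) (H : SimpleGraph W) b, ψ.Realize H b ↔ ∃ i ∈ s, (φ i).Realize H b := by
  induction hs using Finset.Nonempty.cons_induction with
  | singleton i => exact ⟨φ i, hd i (by simp), by simp⟩
  | cons i s hi _ ih =>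
    obtain ⟨ψ, h₁, h₂⟩ := ih fun j hj => hd j (by simp [hj])
    refine ⟨.disj (φ i) ψ, by simp [GForm.depth, h₁, hd i], fun W H b => ?_⟩
    simp [GForm.Realize, h₂]

/-- Hintikka formulas: for a finite nonempty graph the back-and-forth relation is definable. -/
theorem exists_hintikka [Finite V] [Nonempty V] (G : SimpleGraph V) : ∀ (k n : ℕ) (a : Fin n → V),
    0 < k + n → ∃ φ : GForm n, φ.depth = k ∧ ∀ (W : Type) (H : SimpleGraph W) (b : Fin n → W),
      φ.Realize H b ↔ BF G H k (Set.range fun i => (a i, b i)) := by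
  classical
  have := Fintype.ofFinite V
  intro k
  induction k with
  | zero =>
    intro n a hn
    have : NeZero n := ⟨by omega⟩
    obtain ⟨ψ, h₁, h₂⟩ := exists_conj_form (d := 0) (Finset.univ : Finset (Fin n × Fin n))
      Finset.univ_nonempty
      (fun p => .conj (if a p.1 = a p.2 then .eq p.1 p.2 else .neg (.eq p.1 p.2))
        (if G.Adj (a p.1) (a p.2) then .adj p.1 p.2 else .neg (.adj p.1 p.2)))
      (by intro p _; split_ifs <;> rfl)
    refine ⟨ψ, h₁, fun W H b => ?_⟩
    rw [h₂]
    have key : ∀ p : Fin n × Fin n, (GForm.conj (if a p.1 = a p.2 then .eq p.1 p.2 else .neg (.eq p.1 p.2))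
        (if G.Adj (a p.1) (a p.2) then .adj p.1 p.2 else .neg (.adj p.1 p.2))).Realize H b ↔
        (a p.1 = a p.2 ↔ b p.1 = b p.2) ∧
        (G.Adj (a p.1) (a p.2) ↔ H.Adj (b p.1) (b p.2)) := by
      intro p
      by_cases h₁ : a p.1 = a p.2
      · have h₂ : ¬ G.Adj (a p.1) (a p.2) := fun h => G.ne_of_adj h h₁
        simp [GForm.Realize, h₁]
      · by_cases h₂ : G.Adj (a p.1) (a p.2) <;> simp [GForm.Realize, h₁, h₂]
    simp only [key, BF, Finset.mem_univ, true_imp_iff, Set.forall_mem_range, Prod.forall]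
  | succ k ih =>
    intro n a _
    choose φ hφ₁ hφ₂ using fun x : V => ih (n + 1) (Fin.snoc a x) (by omega)
    obtain ⟨ψ₁, h₁, h₁'⟩ := exists_conj_form (d := k + 1) (Finset.univ : Finset V)
      Finset.univ_nonempty (fun x => .ex (φ x)) (by intro x _; simp [GForm.depth, hφ₁])
    obtain ⟨ψ₂, h₂, h₂'⟩ := exists_disj_form (d := k) (Finset.univ : Finset V)
      Finset.univ_nonempty φ (by intro x _; simp [hφ₁])
    refine ⟨.conj ψ₁ (.fa ψ₂), by simp [GForm.depth, h₁, h₂], fun W H b => ?_⟩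
    simp [GForm.Realize, h₁', h₂', hφ₂, range_snoc, BF]

theorem range_elim_zero (a : Fin 0 → V) (b : Fin 0 → W) :
    (Set.range fun i => (a i, b i)) = ∅ := Set.range_eq_empty _

theorem exists_defines [Finite V] [Nonempty V] (G : SimpleGraph V) {k : ℕ} (hk : 0 < k)
    (h : ∀ (m : ℕ) (H : SimpleGraph (Fin m)), BF G H k ∅ → Nonempty (G ≃g H)) :
    ∃ φ : GForm 0, φ.depth = k ∧ Defines G φ := by
  obtain ⟨φ, h₁, h₂⟩ := exists_hintikka G k 0 ![] (by omega)
  refine ⟨φ, h₁, ?_, fun m H hH => h m H ?_⟩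
  · refine (h₂ V G _).2 ?_
    rw [range_elim_zero]
    clear h h₁ h₂ hk
    have key : ∀ (k : ℕ) (s : Set (V × V)), (∀ p ∈ s, p.1 = p.2) → BF G G k s := by
      intro k
      induction k with
      | zero =>
        rintro s hs ⟨p, p'⟩ hp ⟨q, q'⟩ hq
        have h1 := hs _ hp
        have h2 := hs _ hq
        simp only at h1 h2
        subst h1 h2
        simp
      | succ k ih =>
        intro s hs
        exact ⟨fun x => ⟨x, ih _ (by rintro p (rfl | hp); exacts [rfl, hs _ hp])⟩,
          fun x => ⟨x, ih _ (by rintro p (rfl | hp); exacts [rfl, hs _ hp])⟩⟩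
    exact key _ _ (by simp)
  · have := (h₂ (Fin m) H ![]).1 hH
    rwa [range_elim_zero] at this

theorem D_le_of_BF [Finite V] [Nonempty V] (G : SimpleGraph V) {k : ℕ} (hk : 0 < k)
    (h : ∀ (m : ℕ) (H : SimpleGraph (Fin m)), BF G H k ∅ → Nonempty (G ≃g H)) : D G ≤ k :=
  Nat.sInf_le (exists_defines G hk h)

/-- The graph obtained from `G` by adding a pendant vertex at `v`. -/
def addLeaf (G : SimpleGraph V) (v : V) : SimpleGraph (Option V) where
  Adj
    | some x, some y => G.Adj x y
    | some x, none => x = v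
    | none, some y => y = v
    | none, none => False
  symm := ⟨by rintro (_ | x) (_ | y) h <;> simp_all [G.adj_comm]⟩
  loopless := ⟨by rintro (_ | x) h <;> simp_all⟩

theorem BF_addLeaf (G : SimpleGraph V) (v : V) (S : Finset V) (hS : ∀ u ∈ S, ∀ w, G.Adj u w ↔ w = v)
    (hv : v ∉ S) : ∀ (k : ℕ) (s : Set (V × Option V)) (P : Finset V) (e : V → Option V),
    (∀ x y, e x = e y → x = y) → (∀ x y, (addLeaf G v).Adj (e x) (e y) ↔ G.Adj x y) →
    (∀ p ∈ s, p.2 = e p.1) → (∀ y, (∃ x, e x = y) ∨ y = none ∨ ∃ u ∈ S, y = some u) →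
    (∀ x, x ∉ S → e x = some x) → (∀ x ∈ S, e x = none ∨ ∃ u ∈ S, e x = some u) →
    (∀ p ∈ s, p.1 ∉ P) → P ⊆ S → k ≤ P.card → BF G (addLeaf G v) k s := by
  classical
  intro k
  induction k with
  | zero =>
    intro s P e hinj hadj hs _ _ _ _ _ _ p hp q hq
    rw [hs p hp, hs q hq, hadj]
    exact ⟨⟨fun h => by rw [h], hinj _ _⟩, Iff.rfl⟩
  | succ k ih =>
    intro s P e hinj hadj hs hsurj hout hin hP hPS hk
    have forth : ∀ x, BF G (addLeaf G v) k (insert (x, e x) s) := by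
      intro x
      refine ih _ (P.erase x) e hinj hadj ?_ hsurj hout hin ?_ ((Finset.erase_subset _ _).trans hPS) ?_
      · rintro p (rfl | hp); exacts [rfl, hs p hp]
      · rintro p (rfl | hp)
        · simp
        · exact fun h => hP p hp (Finset.mem_of_mem_erase h)
      · have := Finset.pred_card_le_card_erase (s := P) (a := x); omega
    refine ⟨fun x => ⟨_, forth x⟩, fun y => ?_⟩
    by_cases hy : ∃ x, e x = y
    · obtain ⟨x, rfl⟩ := hy; exact ⟨x, forth x⟩
    have hyS : y = none ∨ ∃ u ∈ S, y = some u := (hsurj y).resolve_left hy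
    have hyadj : ∀ x ∉ S, (addLeaf G v).Adj y (some x) ↔ x = v := by
      intro x _
      rcases hyS with rfl | ⟨u, hu, rfl⟩
      · rfl
      · exact hS u hu x
    have hleaf : ∀ z z' : Option V, (z = none ∨ ∃ u ∈ S, z = some u) →
        (z' = none ∨ ∃ u ∈ S, z' = some u) → ¬ (addLeaf G v).Adj z z' := by
      rintro z z' (rfl | ⟨u, hu, rfl⟩) (rfl | ⟨u', hu', rfl⟩) h
      · exact h
      · exact hv ((show u' = v from h) ▸ hu')
      · exact hv ((show u = v from h) ▸ hu)
      · exact hv ((hS u hu u').1 h ▸ hu')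
    obtain ⟨w, hw⟩ : P.Nonempty := Finset.card_pos.1 (by omega)
    have hwS := hPS hw
    have hSS : ∀ a ∈ S, ∀ b ∈ S, ¬ G.Adj a b := fun a ha b hb h => hv ((hS a ha b).1 h ▸ hb)
    set e' : V → Option V := Function.update e w y with he'
    have hew : e' w = y := by simp [he']
    have hne_e : ∀ x, x ≠ w → e' x = e x := fun x hx => by simp [he', hx]
    have hadjw : ∀ x, x ≠ w → ((addLeaf G v).Adj y (e x) ↔ G.Adj w x) := by
      intro x hx
      by_cases hxS : x ∈ S
      · exact iff_of_false (hleaf _ _ hyS (hin x hxS)) (hSS w hwS x hxS)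
      · rw [hout x hxS, hyadj x hxS, hS w hwS]
    refine ⟨w, ih _ (P.erase w) e' ?_ ?_ ?_ ?_ ?_ ?_ ?_ ((Finset.erase_subset _ _).trans hPS) ?_⟩
    · intro a b hab
      by_cases ha : a = w <;> by_cases hb : b = w
      · rw [ha, hb]
      · subst ha; rw [hew, hne_e b hb] at hab; exact (hy ⟨b, hab.symm⟩).elim
      · subst hb; rw [hew, hne_e a ha] at hab; exact (hy ⟨a, hab⟩).elim
      · rw [hne_e a ha, hne_e b hb] at hab; exact hinj _ _ hab
    · intro a b
      by_cases ha : a = w <;> by_cases hb : b = w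
      · subst ha hb; simp
      · subst ha; rw [hew, hne_e b hb, hadjw b hb]
      · subst hb; rw [hew, hne_e a ha, SimpleGraph.adj_comm, hadjw a ha, SimpleGraph.adj_comm]
      · rw [hne_e a ha, hne_e b hb, hadj]
    · rintro p (rfl | hp)
      · exact hew.symm
      · rw [hne_e, hs p hp]
        rintro rfl; exact hP p hp hw
    · intro z
      by_cases hz : z = none ∨ ∃ u ∈ S, z = some u
      · exact Or.inr hz
      · left
        obtain ⟨x, rfl⟩ := (hsurj z).resolve_right hz
        refine ⟨x, hne_e x ?_⟩
        rintro rfl; exact hz (hin x hwS)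
    · intro x hx
      rw [hne_e x (by rintro rfl; exact hx hwS), hout x hx]
    · intro x hx
      by_cases hxw : x = w
      · subst hxw; rw [hew]; exact hyS
      · rw [hne_e x hxw]; exact hin x hx
    · rintro p (rfl | hp)
      · simp
      · exact fun h => hP p hp (Finset.mem_of_mem_erase h)
    · have := Finset.pred_card_le_card_erase (s := P) (a := w); omega

/-- A graph with a vertex having `k` leaf neighbours needs depth more than `k`. -/
theorem le_D_of_leaves [Finite V] (G : SimpleGraph V) (v : V) (S : Finset V)
    (hS : ∀ u ∈ S, ∀ w, G.Adj u w ↔ w = v) (hv : v ∉ S)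
    (hne : ∃ φ : GForm 0, Defines G φ) : S.card ≤ D G := by
  refine le_csInf ⟨_, hne.choose, rfl, hne.choose_spec⟩ ?_
  rintro d ⟨φ, rfl, hφ₁, hφ₂⟩
  by_contra! hlt
  have hbf : BF G (addLeaf G v) φ.depth ∅ :=
    BF_addLeaf G v S hS hv _ _ S some (by simp) (fun _ _ => Iff.rfl) (by simp)
      (by rintro (_ | y) <;> simp) (by simp) (by intro x hx; exact Or.inr ⟨x, hx, rfl⟩) (by simp)
      subset_rfl hlt.le
  have hcard := Fintype.ofFinite V
  let eqv : Option V ≃ Fin (Fintype.card (Option V)) := Fintype.equivFin _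
  let H : SimpleGraph (Fin (Fintype.card (Option V))) := (addLeaf G v).map eqv.toEmbedding
  let i : addLeaf G v ≃g H := SimpleGraph.Iso.map eqv _
  have hBF : BF G H φ.depth ∅ := by
    have key : ∀ (k : ℕ) (s : Set (Option V × Fin (Fintype.card (Option V)))),
        (∀ p ∈ s, p.2 = i p.1) → BF (addLeaf G v) H k s := by
      intro k
      induction k with
      | zero =>
        intro s hs p hp q hq
        rw [hs p hp, hs q hq]
        exact ⟨i.injective.eq_iff.symm, i.map_adj_iff.symm⟩
      | succ k ih =>
        intro s hs
        refine ⟨fun x => ⟨i x, ih _ ?_⟩, fun y => ⟨i.symm y, ih _ ?_⟩⟩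
        · rintro p (rfl | hp); exacts [rfl, hs _ hp]
        · rintro p (rfl | hp); exacts [by simp, hs _ hp]
    exact hbf.trans (key _ ∅ (by simp)) (by simp)
  have hsat : Sat H φ := by
    refine (BF.realize_iff φ (a := ![]) (b := ![]) le_rfl ?_).1 hφ₁
    rwa [range_elim_zero]
  obtain ⟨j⟩ := hφ₂ _ H hsat
  have := Fintype.card_congr j.toEquiv
  simp at this

end Games

end FODef

namespace FODef

section Iterates

variable {V W : Type}

/-- The exact `p`-fold iterate of a relation. -/
def Iter (ρ : V → V → Prop) : ℕ → V → V → Prop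
  | 0, x, y => x = y
  | p + 1, x, y => ∃ z, ρ x z ∧ Iter ρ p z y

theorem iter_add (ρ : V → V → Prop) (p q : ℕ) (x y : V) :
    Iter ρ (p + q) x y ↔ ∃ z, Iter ρ p x z ∧ Iter ρ q z y := by
  induction p generalizing x with
  | zero => simp [Iter]
  | succ p ih =>
    rw [Nat.succ_add]
    simp only [Iter, ih]
    constructor
    · rintro ⟨z, hz, w, h₁, h₂⟩; exact ⟨w, ⟨z, hz, h₁⟩, h₂⟩
    · rintro ⟨w, ⟨z, hz, h₁⟩, h₂⟩; exact ⟨z, hz, w, h₁, h₂⟩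

theorem iter_one (ρ : V → V → Prop) (x y : V) : Iter ρ 1 x y ↔ ρ x y := by simp [Iter]

theorem iter_succ' (ρ : V → V → Prop) (p : ℕ) (x y : V) :
    Iter ρ (p + 1) x y ↔ ∃ z, Iter ρ p x z ∧ ρ z y := by
  rw [iter_add]; simp [Iter]

theorem Iter.mono {ρ τ : V → V → Prop} (h : ∀ x y, ρ x y → τ x y) {p : ℕ} {x y : V}
    (hp : Iter ρ p x y) : Iter τ p x y := by
  induction p generalizing x with
  | zero => exact hp
  | succ p ih => obtain ⟨z, hz, hzy⟩ := hp; exact ⟨z, h _ _ hz, ih hzy⟩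

theorem Iter.functional {ρ : V → V → Prop} (hρ : ∀ x y z, ρ x y → ρ x z → y = z) {p : ℕ}
    {x y z : V} (hy : Iter ρ p x y) (hz : Iter ρ p x z) : y = z := by
  induction p generalizing x with
  | zero => exact hy.symm.trans hz
  | succ p ih =>
    obtain ⟨a, ha, hay⟩ := hy
    obtain ⟨b, hb, hbz⟩ := hz
    obtain rfl := hρ _ _ _ ha hb
    exact ih hay hbz

theorem Iter.of_le {ρ : V → V → Prop} (hρ : ∀ x y z, ρ x y → ρ x z → y = z) {p q : ℕ}
    {x y z : V} (hy : Iter ρ p x y) (hz : Iter ρ q x z) (hpq : p ≤ q) : Iter ρ (q - p) y z := by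
  obtain ⟨d, rfl⟩ := Nat.exists_eq_add_of_le hpq
  rw [iter_add] at hz
  obtain ⟨w, hw, hwz⟩ := hz
  rw [hy.functional hρ hw]
  simpa using hwz

/-- `ρ` and `ρ'` correspond to each other under the back-and-forth relation with `b` rounds. -/
def Pres (G : SimpleGraph V) (H : SimpleGraph W) (b : ℕ) (ρ : V → V → Prop) (ρ' : W → W → Prop) :
    Prop := ∀ k s x x' y y', b ≤ k → BF G H k s → (x, x') ∈ s → (y, y') ∈ s → (ρ x y ↔ ρ' x' y')

variable {G : SimpleGraph V} {H : SimpleGraph W}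

theorem Pres.mono {b c : ℕ} {ρ : V → V → Prop} {ρ' : W → W → Prop} (h : Pres G H b ρ ρ')
    (hbc : b ≤ c) : Pres G H c ρ ρ' := fun k s x x' y y' hk => h k s x x' y y' (hbc.trans hk)

theorem pres_eq (b : ℕ) : Pres G H b Eq Eq := fun _ _ _ _ _ _ _ h hx hy => h.eq_iff hx hy

theorem pres_adj (b : ℕ) : Pres G H b G.Adj H.Adj := fun _ _ _ _ _ _ _ h hx hy => h.adj_iff hx hy

theorem Pres.not {b : ℕ} {ρ : V → V → Prop} {ρ' : W → W → Prop} (h : Pres G H b ρ ρ') :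
    Pres G H b (fun x y => ¬ ρ x y) (fun x y => ¬ ρ' x y) :=
  fun k s x x' y y' hk hs hx hy => not_congr (h k s x x' y y' hk hs hx hy)

theorem Pres.swap {b : ℕ} {ρ : V → V → Prop} {ρ' : W → W → Prop} (h : Pres G H b ρ ρ') :
    Pres G H b (fun x y => ρ y x) (fun x y => ρ' y x) :=
  fun k s x x' y y' hk hs hx hy => h k s y y' x x' hk hs hy hx

theorem Pres.and {b : ℕ} {ρ τ : V → V → Prop} {ρ' τ' : W → W → Prop} (h : Pres G H b ρ ρ')
    (h' : Pres G H b τ τ') : Pres G H b (fun x y => ρ x y ∧ τ x y) (fun x y => ρ' x y ∧ τ' x y) :=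
  fun k s x x' y y' hk hs hx hy =>
    and_congr (h k s x x' y y' hk hs hx hy) (h' k s x x' y y' hk hs hx hy)

theorem Pres.or {b : ℕ} {ρ τ : V → V → Prop} {ρ' τ' : W → W → Prop} (h : Pres G H b ρ ρ')
    (h' : Pres G H b τ τ') : Pres G H b (fun x y => ρ x y ∨ τ x y) (fun x y => ρ' x y ∨ τ' x y) :=
  fun k s x x' y y' hk hs hx hy =>
    or_congr (h k s x x' y y' hk hs hx hy) (h' k s x x' y y' hk hs hx hy)

/-- One existential quantifier over a relation of three vertices costs one round. -/
theorem pres_exists {b : ℕ} {ρ : V → V → V → Prop} {ρ' : W → W → W → Prop}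
    (h : ∀ k s x x' y y' z z', b ≤ k → BF G H k s → (x, x') ∈ s → (y, y') ∈ s → (z, z') ∈ s →
      (ρ x y z ↔ ρ' x' y' z')) :
    Pres G H (b + 1) (fun x y => ∃ z, ρ x y z) (fun x y => ∃ z, ρ' x y z) := by
  intro k s x x' y y' hk hs hx hy
  obtain ⟨k, rfl⟩ : ∃ j, k = j + 1 := ⟨k - 1, by omega⟩
  have hk : b ≤ k := by omega
  constructor
  · rintro ⟨z, hz⟩
    obtain ⟨z', hs'⟩ := hs.1 z
    exact ⟨z', (h k _ _ _ _ _ _ _ hk hs' (Set.mem_insert_of_mem _ hx) (Set.mem_insert_of_mem _ hy)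
      (Set.mem_insert _ _)).1 hz⟩
  · rintro ⟨z', hz⟩
    obtain ⟨z, hs'⟩ := hs.2 z'
    exact ⟨z, (h k _ _ _ _ _ _ _ hk hs' (Set.mem_insert_of_mem _ hx) (Set.mem_insert_of_mem _ hy)
      (Set.mem_insert _ _)).2 hz⟩

theorem Pres.comp {b : ℕ} {ρ τ : V → V → Prop} {ρ' τ' : W → W → Prop} (h : Pres G H b ρ ρ')
    (h' : Pres G H b τ τ') :
    Pres G H (b + 1) (fun x y => ∃ z, ρ x z ∧ τ z y) (fun x y => ∃ z, ρ' x z ∧ τ' z y) :=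
  pres_exists fun k s _ _ _ _ _ _ hk hs hx hy hz =>
    and_congr (h k s _ _ _ _ hk hs hx hz) (h' k s _ _ _ _ hk hs hz hy)

theorem Pres.iter {b : ℕ} {ρ : V → V → Prop} {ρ' : W → W → Prop} (h : Pres G H b ρ ρ') (j : ℕ) :
    ∀ p ≤ 2 ^ j, Pres G H (b + j) (Iter ρ p) (Iter ρ' p) := by
  induction j with
  | zero =>
    intro p hp
    obtain rfl | rfl : p = 0 ∨ p = 1 := by simp at hp; omega
    · exact pres_eq _
    · intro k s x x' y y' hk hs hx hy
      rw [iter_one, iter_one]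
      exact h k s x x' y y' (by omega) hs hx hy
  | succ j ih =>
    intro p hp
    have h2 : 2 ^ (j + 1) = 2 ^ j + 2 ^ j := by ring
    obtain ⟨a, c, rfl, ha, hc⟩ : ∃ a c, p = a + c ∧ a ≤ 2 ^ j ∧ c ≤ 2 ^ j :=
      ⟨p / 2, p - p / 2, by omega, by omega, by omega⟩
    intro k s x x' y y' hk hs hx hy
    rw [iter_add, iter_add]
    exact ((ih a ha).comp (ih c hc)) k s x x' y y' hk hs hx hy

/-- `DL G p x y` says that the distance of `x` and `y` is at most `p`. -/
def DL (G : SimpleGraph V) (p : ℕ) : V → V → Prop := Iter (fun x y => x = y ∨ G.Adj x y) p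

theorem pres_DL {j p : ℕ} (hp : p ≤ 2 ^ j) : Pres G H j (DL G p) (DL H p) := by
  have := (((pres_eq 0).or (pres_adj 0)) : Pres G H 0 _ _).iter j p hp
  rwa [Nat.zero_add] at this

theorem DL_iff (hG : G.Connected) (p : ℕ) (x y : V) : DL G p x y ↔ G.dist x y ≤ p := by
  induction p generalizing x with
  | zero => simp [DL, Iter, hG.dist_eq_zero_iff]
  | succ p ih =>
    change (∃ z, (x = z ∨ G.Adj x z) ∧ DL G p z y) ↔ _
    constructor
    · rintro ⟨z, hz, hzy⟩
      rw [ih] at hzy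
      have : G.dist x z ≤ 1 := by
        rcases hz with rfl | hz
        · simp
        · exact (SimpleGraph.dist_eq_one_iff_adj.2 hz).le
      have := hG.dist_triangle (u := x) (v := z) (w := y)
      omega
    · intro h
      obtain ⟨w, hw⟩ := hG.exists_walk_length_eq_dist x y
      cases w with
      | nil => exact ⟨_, Or.inl rfl, by rw [ih]; simp⟩
      | cons hadj w =>
        refine ⟨_, Or.inr hadj, ?_⟩
        rw [ih]
        have := SimpleGraph.dist_le w
        simp at hw
        omega

end Iterates

section Trees

variable {V : Type} {T : SimpleGraph V}

theorem exists_closer (hT : T.Connected) {x y : V} {d : ℕ} (h : T.dist x y = d + 1) :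
    ∃ z, T.Adj x z ∧ T.dist z y = d := by
  obtain ⟨w, hw⟩ := hT.exists_walk_length_eq_dist x y
  cases w with
  | nil => simp at h
  | @cons _ z _ hadj w =>
    refine ⟨z, hadj, ?_⟩
    have h1 := SimpleGraph.dist_le w
    have h2 := hT.dist_triangle (u := x) (v := z) (w := y)
    rw [SimpleGraph.dist_eq_one_iff_adj.2 hadj] at h2
    simp at hw
    omega

theorem exists_between (hT : T.Connected) {x y : V} {p q : ℕ} (h : T.dist x y = p + q) :
    ∃ z, T.dist x z = p ∧ T.dist z y = q := by
  induction q generalizing y with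
  | zero => exact ⟨y, by simpa using h, by simp⟩
  | succ q ih =>
    obtain ⟨y', hy, hd⟩ := exists_closer hT (x := y) (y := x) (d := p + q)
      (by rw [T.dist_comm, h]; ring)
    obtain ⟨z, hz, hz'⟩ := ih (y := y') (by rw [T.dist_comm, hd])
    refine ⟨z, hz, ?_⟩
    have h1 := hT.dist_triangle (u := z) (v := y') (w := y)
    have h2 := hT.dist_triangle (u := x) (v := z) (w := y)
    rw [T.dist_comm (u := y'), SimpleGraph.dist_eq_one_iff_adj.2 hy] at h1
    omega

theorem closer_unique (hT : T.IsTree) {a b c z : V} (hb : T.Adj a b) (hc : T.Adj a c)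
    (hbz : T.dist b z < T.dist a z) (hcz : T.dist c z < T.dist a z) : b = c := by
  have key : ∀ b, T.Adj a b → T.dist b z < T.dist a z →
      ∃ p : T.Walk a z, p.IsPath ∧ p.snd = b := by
    intro b hb hbz
    obtain ⟨w, hw⟩ := hT.connected.exists_walk_length_eq_dist b z
    refine ⟨.cons hb w, ?_, by simp⟩
    apply SimpleGraph.Walk.isPath_of_length_eq_dist
    have h2 := T.dist_le (.cons hb w)
    simp at h2 ⊢
    omega
  obtain ⟨p, hp, rfl⟩ := key b hb hbz
  obtain ⟨q, hq, rfl⟩ := key c hc hcz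
  rw [(hT.existsUnique_path a z).unique hp hq]

theorem dist_adj_cases (hT : T.IsTree) {a b : V} (hab : T.Adj a b) (z : V) :
    T.dist a z = T.dist b z + 1 ∨ T.dist b z = T.dist a z + 1 := by
  have := hT.dist_eq_dist_add_one_of_adj z hab
  rwa [T.dist_comm (u := z), T.dist_comm (u := z)] at this

/-- A path that starts by moving away from `z` keeps moving away from `z`. -/
theorem dist_of_moving_away (hT : T.IsTree) {z y : V} (n : ℕ) : ∀ {u q : V}, T.Adj u q →
    T.dist q z = T.dist u z + 1 → T.dist q y = n → T.dist u y = n + 1 →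
    T.dist y z = T.dist u z + n + 1 := by
  induction n with
  | zero =>
    intro u q _ h hq _
    rw [hT.connected.dist_eq_zero_iff] at hq
    subst hq; exact h
  | succ n ih =>
    intro u q huq h hq hu
    obtain ⟨q', hq', hd⟩ := exists_closer hT.connected hq
    have hne : q' ≠ u := by rintro rfl; omega
    have h' : T.dist q' z = T.dist q z + 1 := by
      rcases dist_adj_cases hT hq' z with h1 | h1
      · exact (hne (closer_unique hT (z := z) hq' huq.symm (by omega) (by omega))).elim
      · exact h1
    rw [ih hq' h' hd hq]; omega

theorem dist_of_nonbacktracking (hT : T.IsTree) {x : ℕ → V} {n : ℕ}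
    (h₁ : ∀ i < n, T.Adj (x i) (x (i + 1))) (h₂ : ∀ i, i + 1 < n → x (i + 2) ≠ x i) :
    ∀ i ≤ n, T.dist (x i) (x 0) = i := by
  intro i
  induction i using Nat.strong_induction_on with
  | _ i ih =>
    intro hi
    match i with
    | 0 => simp
    | 1 => rw [T.dist_comm]; exact SimpleGraph.dist_eq_one_iff_adj.2 (h₁ 0 (by omega))
    | i + 2 =>
      have e1 := ih (i + 1) (by omega) (by omega)
      have e0 := ih i (by omega) (by omega)
      have hadj : T.Adj (x (i + 1)) (x (i + 2)) := h₁ (i + 1) (by omega)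
      rcases dist_adj_cases hT hadj (x 0) with h | h
      · exact (h₂ i (by omega) (closer_unique hT (z := x 0) hadj
          (h₁ i (by omega)).symm (by omega) (by omega))).elim
      · omega

theorem between_unique (hT : T.IsTree) {z y : V} {q : ℕ} (p : ℕ) : ∀ {x y' : V},
    T.dist x z = p + q → T.dist x y = p → T.dist y z = q → T.dist x y' = p → T.dist y' z = q →
    y = y' := by
  induction p with
  | zero =>
    intro x y' _ h1 _ h2 _
    rw [hT.connected.dist_eq_zero_iff] at h1 h2
    exact h1.symm.trans h2
  | succ p ih =>
    intro x y' h h1 h1' h2 h2'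
    obtain ⟨a, ha, had⟩ := exists_closer hT.connected h1
    obtain ⟨b, hb, hbd⟩ := exists_closer hT.connected h2
    have t1 := hT.connected.dist_triangle (u := a) (v := y) (w := z)
    have t2 := hT.connected.dist_triangle (u := b) (v := y') (w := z)
    obtain rfl : a = b := closer_unique hT (z := z) ha hb (by omega) (by omega)
    have t3 := hT.connected.dist_triangle (u := x) (v := a) (w := z)
    rw [SimpleGraph.dist_eq_one_iff_adj.2 ha] at t3
    exact ih (by omega) had h1' hbd h2'

theorem dist_of_between (hT : T.IsTree) {a b x y : V} {N i j : ℕ} (hij : i ≤ j)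
    (hab : T.dist a b = N) (hjN : j ≤ N) (hx : T.dist a x = i) (hx' : T.dist x b = N - i)
    (hy : T.dist a y = j) (hy' : T.dist y b = N - j) : T.dist x y = j - i := by
  obtain ⟨c, hc, hc'⟩ := exists_between hT.connected (x := x) (y := b) (p := j - i) (q := N - j)
    (by omega)
  have t1 := hT.connected.dist_triangle (u := a) (v := x) (w := c)
  have t2 := hT.connected.dist_triangle (u := a) (v := c) (w := b)
  obtain rfl : y = c := between_unique hT (x := a) (z := b) (q := N - j) j (by omega) hy hy'
    (by omega) hc'
  exact hc

end Trees

end FODef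

namespace FODef

section Core

variable {V W : Type} {G : SimpleGraph V} {H : SimpleGraph W} {T : SimpleGraph V}

/-- The edge `u w` starts a path of length `R` at `u`. -/
def Heavy (G : SimpleGraph V) (R : ℕ) (u w : V) : Prop :=
  G.Adj u w ∧ ∃ z, ¬ DL G (R - 1) u z ∧ DL G (R - 1) w z

/-- A vertex from which two paths of length `R` start along different edges. -/
def Core (G : SimpleGraph V) (R : ℕ) (u : V) : Prop :=
  ∃ w₁ w₂, w₁ ≠ w₂ ∧ Heavy G R u w₁ ∧ Heavy G R u w₂

/-- Outside the core, the unique heavy neighbour is the parent. -/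
def Par (G : SimpleGraph V) (R : ℕ) (u p : V) : Prop := ¬ Core G R u ∧ Heavy G R u p

theorem Par.functional {R : ℕ} (x y z : V) (hy : Par G R x y) (hz : Par G R x z) : y = z := by
  by_contra h
  exact hy.1 ⟨y, z, h, hy.2, hz.2⟩

theorem Par.adj {R : ℕ} {x y : V} (h : Par G R x y) : G.Adj x y := h.2.1

theorem pres_heavy {j R : ℕ} (hR : R ≤ 2 ^ j) : Pres G H (j + 1) (Heavy G R) (Heavy H R) := by
  have h1 : Pres G H j (DL G (R - 1)) (DL H (R - 1)) := pres_DL (by omega)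
  have h2 := h1.not.comp h1.swap
  refine (pres_adj _).and ?_
  exact h2

theorem pres_core {j R k : ℕ} {s : Set (V × W)} {x : V} {x' : W} (hR : R ≤ 2 ^ j) (hk : j + 3 ≤ k)
    (h : BF G H k s) (hx : (x, x') ∈ s) : Core G R x ↔ Core H R x' := by
  have hH := pres_heavy (G := G) (H := H) hR
  have h1 : Pres G H (j + 2) (fun x w₁ => ∃ w₂, w₁ ≠ w₂ ∧ Heavy G R x w₁ ∧ Heavy G R x w₂)
      (fun x w₁ => ∃ w₂, w₁ ≠ w₂ ∧ Heavy H R x w₁ ∧ Heavy H R x w₂) := by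
    refine pres_exists (b := j + 1) ?_
    intro k s x x' y y' z z' hk hs hx hy hz
    exact and_congr (not_congr (hs.eq_iff hy hz))
      (and_congr (hH k s _ _ _ _ hk hs hx hy) (hH k s _ _ _ _ hk hs hx hz))
  have h2 : Pres G H (j + 3)
      (fun x _ => ∃ w₁, ∃ w₂, w₁ ≠ w₂ ∧ Heavy G R x w₁ ∧ Heavy G R x w₂)
      (fun x _ => ∃ w₁, ∃ w₂, w₁ ≠ w₂ ∧ Heavy H R x w₁ ∧ Heavy H R x w₂) := by
    refine pres_exists (b := j + 2) ?_
    intro k s x x' y y' z z' hk hs hx hy hz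
    exact h1 k s _ _ _ _ hk hs hx hz
  exact h2 k s x x' x x' hk h hx hx

theorem pres_par {j R : ℕ} (hR : R ≤ 2 ^ j) : Pres G H (j + 3) (Par G R) (Par H R) := by
  intro k s x x' y y' hk hs hx hy
  exact and_congr (not_congr (pres_core hR hk hs hx))
    (pres_heavy hR k s _ _ _ _ (by omega) hs hx hy)

theorem pres_iter_par {j R p : ℕ} (hR : R ≤ 2 ^ j) (hp : p ≤ R) :
    Pres G H (2 * j + 3) (Iter (Par G R) p) (Iter (Par H R) p) :=
  ((pres_par hR).iter j p (hp.trans hR)).mono (by omega)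

theorem heavy_iff (hT : T.Connected) {R : ℕ} (hR : 1 ≤ R) (u w : V) :
    Heavy T R u w ↔ T.Adj u w ∧ ∃ z, T.dist u z = R ∧ T.dist w z + 1 = R := by
  simp only [Heavy, DL_iff hT]
  refine and_congr_right fun hadj => exists_congr fun z => ?_
  have t3 := hT.dist_triangle (u := u) (v := w) (w := z)
  rw [SimpleGraph.dist_eq_one_iff_adj.2 hadj] at t3
  omega

theorem exists_heavy (hT : T.Connected) {R : ℕ} (hR : 1 ≤ R) {u y : V} (h : R ≤ T.dist u y) :
    ∃ p, Heavy T R u p ∧ T.dist p y < T.dist u y := by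
  obtain ⟨z, hz, hz'⟩ := exists_between hT (x := u) (y := y) (p := R) (q := T.dist u y - R)
    (by omega)
  obtain ⟨p, hp, hp'⟩ := exists_closer hT (x := u) (y := z) (d := R - 1) (by omega)
  refine ⟨p, (heavy_iff hT hR _ _).2 ⟨hp, z, hz, by omega⟩, ?_⟩
  have := hT.dist_triangle (u := p) (v := z) (w := y)
  omega

/-- If `p` is a heavy neighbour of `u`, then `u` is a heavy neighbour of all its other
neighbours. -/
theorem Heavy.reverse (hT : T.IsTree) {R : ℕ} (hR : 1 ≤ R) {u p w : V} (h : Heavy T R u p)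
    (hw : T.Adj u w) (hne : w ≠ p) : Heavy T R w u := by
  obtain ⟨hup, z, hz, hz'⟩ := (heavy_iff hT.connected hR _ _).1 h
  refine (heavy_iff hT.connected hR _ _).2 ⟨hw.symm, ?_⟩
  obtain ⟨z', h1, h2⟩ := exists_between hT.connected (x := u) (y := z) (p := R - 1) (q := 1)
    (by omega)
  have hwz : T.dist w z = T.dist u z + 1 := by
    rcases dist_adj_cases hT hw z with h | h
    · exact (hne (closer_unique hT (z := z) hw hup (by omega) (by omega))).elim
    · exact h
  have t1 := hT.connected.dist_triangle (u := w) (v := z') (w := z)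
  have t2 := hT.connected.dist_triangle (u := w) (v := u) (w := z')
  rw [SimpleGraph.dist_eq_one_iff_adj.2 hw.symm] at t2
  exact ⟨z', by omega, by omega⟩

theorem par_total_of_adj (hT : T.IsTree) {R : ℕ} (hR : 1 ≤ R)
    (hd : ∃ y z, T.dist y z = 2 * R) {u w : V} (h : T.Adj u w) :
    (Core T R u ∧ Core T R w) ∨ Par T R u w ∨ Par T R w u := by
  obtain ⟨y, z, hyz⟩ := hd
  have hex : ∀ u, ∃ p, Heavy T R u p := by
    intro u
    have t := hT.connected.dist_triangle (u := y) (v := u) (w := z)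
    rw [T.dist_comm (u := y) (v := u)] at t
    rcases le_or_gt R (T.dist u y) with h | h
    · obtain ⟨p, hp, _⟩ := exists_heavy hT.connected hR h; exact ⟨p, hp⟩
    · obtain ⟨p, hp, _⟩ := exists_heavy hT.connected hR (u := u) (y := z) (by omega)
      exact ⟨p, hp⟩
  have key : ∀ {u w : V}, T.Adj u w → ¬ Core T R u → Par T R u w ∨ Par T R w u := by
    intro u w h hu
    obtain ⟨p, hp⟩ := hex u
    by_cases hpw : w = p
    · left; subst hpw; exact ⟨hu, hp⟩
    have hwu := hp.reverse hT hR h hpw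
    by_cases hw : Core T R w
    · obtain ⟨q, hq, hqu⟩ : ∃ q, Heavy T R w q ∧ u ≠ q := by
        obtain ⟨q₁, q₂, hne, h₁, h₂⟩ := hw
        by_cases h1 : u = q₁
        · exact ⟨q₂, h₂, h1 ▸ hne⟩
        · exact ⟨q₁, h₁, h1⟩
      exact Or.inl ⟨hu, hq.reverse hT hR h.symm hqu⟩
    · exact Or.inr ⟨hw, hwu⟩
  by_cases hu : Core T R u
  · by_cases hw : Core T R w
    · exact Or.inl ⟨hu, hw⟩
    · exact Or.inr (key h.symm hw).symm
  · exact Or.inr (key h hu)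

theorem not_par_par (hT : T.IsTree) {R : ℕ} (hR : 1 ≤ R)
    (hd : ∃ y z, T.dist y z = 2 * R) {u w : V} (h : Par T R u w) (h' : Par T R w u) : False := by
  obtain ⟨y, z, hyz⟩ := hd
  have hadj := h.adj
  have key : ∀ {u w : V}, Par T R u w → ∀ y, T.dist w y = T.dist u y + 1 → T.dist u y < R := by
    intro u w h y hy
    by_contra! hle
    obtain ⟨p, hp, hp'⟩ := exists_heavy hT.connected hR hle
    refine h.1 ⟨p, w, ?_, hp, h.2⟩
    rintro rfl; omega
  have t1 := hT.connected.dist_triangle (u := y) (v := u) (w := z)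
  have t2 := hT.connected.dist_triangle (u := y) (v := w) (w := z)
  rw [T.dist_comm (u := y) (v := u)] at t1
  rw [T.dist_comm (u := y) (v := w)] at t2
  rcases dist_adj_cases hT hadj y with h1 | h1 <;> rcases dist_adj_cases hT hadj z with h2 | h2
  · have := key h' _ h1; have := key h' _ h2; omega
  · have := key h' _ h1; have := key h _ h2; omega
  · have := key h _ h1; have := key h' _ h2; omega
  · have := key h _ h1; have := key h _ h2; omega

theorem exists_par (hT : T.IsTree) {R : ℕ} (hR : 1 ≤ R)
    (hd : ∃ y z, T.dist y z = 2 * R) {u : V} (hu : ¬ Core T R u) : ∃ p, Par T R u p := by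
  obtain ⟨y, z, hyz⟩ := hd
  have t := hT.connected.dist_triangle (u := y) (v := u) (w := z)
  rw [T.dist_comm (u := y) (v := u)] at t
  rcases le_or_gt R (T.dist u y) with h | h
  · obtain ⟨p, hp, _⟩ := exists_heavy hT.connected hR h; exact ⟨p, hu, hp⟩
  · obtain ⟨p, hp, _⟩ := exists_heavy hT.connected hR (u := u) (y := z) (by omega)
    exact ⟨p, hu, hp⟩

theorem exists_iter_par_core (hT : T.IsTree) {R : ℕ} (hR : 1 ≤ R)
    (hd : ∃ y z, T.dist y z = 2 * R) (u : V) :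
    ∃ p ≤ R, ∃ v, Core T R v ∧ Iter (Par T R) p u v := by
  classical
  choose! f hf using fun u (hu : ¬ Core T R u) => exists_par hT hR hd hu
  by_contra! hcon
  have hK : ∀ i ≤ R, ¬ Core T R (f^[i] u) ∧ Iter (Par T R) i u (f^[i] u) := by
    intro i
    induction i with
    | zero => intro _; exact ⟨fun h => hcon 0 (by omega) u h rfl, rfl⟩
    | succ i ih =>
      intro hi
      obtain ⟨h1, h2⟩ := ih (by omega)
      have h3 : Iter (Par T R) (i + 1) u (f^[i + 1] u) := by
        rw [iter_succ']
        refine ⟨_, h2, ?_⟩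
        rw [Function.iterate_succ_apply']
        exact hf _ h1
      exact ⟨fun h => hcon _ hi _ h h3, h3⟩
  have hpar : ∀ i ≤ R, Par T R (f^[i] u) (f^[i + 1] u) := by
    intro i hi
    rw [Function.iterate_succ_apply']
    exact hf _ (hK i hi).1
  have hdist := dist_of_nonbacktracking hT (x := fun i => f^[i] u) (n := R)
    (fun i hi => (hpar i hi.le).adj) (fun i hi h => by
      have h2 := hpar (i + 1) (by omega)
      have h3 : f^[i + 2] u = f^[i] u := h
      rw [show i + 1 + 1 = i + 2 from rfl, h3] at h2
      exact not_par_par hT hR hd (hpar i (by omega)) h2)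
  have h1 : Par T R (f^[R - 1] u) (f^[R] u) := by
    have := hpar (R - 1) (by omega)
    rwa [Nat.sub_add_cancel hR] at this
  refine not_par_par hT hR hd h1 ⟨(hK R le_rfl).1, ?_⟩
  refine (heavy_iff hT.connected hR _ _).2 ⟨h1.adj.symm, u, ?_, ?_⟩
  · exact hdist R le_rfl
  · have := hdist (R - 1) (by omega)
    simp only [Function.iterate_zero, id] at this
    omega

end Core

section Bijections

variable {V W : Type} {G : SimpleGraph V} {H : SimpleGraph W}

/-- The second player answers a finite set of moves by a bijection onto a corresponding set. -/
theorem BF.exists_bijOn {k b : ℕ} {s : Set (V × W)} (h : BF G H k s) (C : Finset V) (C' : Set W)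
    (hC : ∀ k' t y y', b ≤ k' → s ⊆ t → BF G H k' t → (y, y') ∈ t → (y ∈ C ↔ y' ∈ C'))
    (hk : C.card + b + 1 ≤ k) :
    ∃ f : V → W, Set.BijOn f C C' ∧ ∀ c ∈ C, BF G H (k - C.card) (insert (c, f c) s) := by
  classical
  have key : ∀ D ⊆ C, ∃ f : V → W, BF G H (k - D.card) (s ∪ {p | p.1 ∈ D ∧ p.2 = f p.1}) := by
    intro D
    induction D using Finset.induction_on with
    | empty =>
      intro _
      obtain ⟨k, rfl⟩ : ∃ j, k = j + 1 := ⟨k - 1, by omega⟩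
      by_cases hV : Nonempty V
      · obtain ⟨v⟩ := hV
        obtain ⟨w, _⟩ := h.1 v
        exact ⟨fun _ => w, by simpa using h⟩
      · exact ⟨fun v => (hV ⟨v⟩).elim, by simpa using h⟩
    | insert a D ha ih =>
      intro hD
      obtain ⟨f, hf⟩ := ih ((Finset.subset_insert _ _).trans hD)
      have hlt := Finset.card_le_card hD
      rw [Finset.card_insert_of_notMem ha] at hlt ⊢
      obtain ⟨m, hm⟩ : ∃ m, k - D.card = m + 1 := ⟨k - D.card - 1, by omega⟩
      rw [hm] at hf
      obtain ⟨y, hy⟩ := hf.1 a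
      refine ⟨Function.update f a y, ?_⟩
      rw [show k - (D.card + 1) = m by omega]
      refine hy.anti ?_
      rintro ⟨p, q⟩ (hp | ⟨hp, hq⟩)
      · exact Or.inr (Or.inl hp)
      · simp only at hp hq
        rcases Finset.mem_insert.1 hp with rfl | hpD
        · left; simp [hq]
        · right; right
          have : p ≠ a := fun h => ha (h ▸ hpD)
          exact ⟨hpD, by simp [hq, this]⟩
  obtain ⟨f, hf⟩ := key C subset_rfl
  have hmem : ∀ c ∈ C, (c, f c) ∈ s ∪ {p | p.1 ∈ C ∧ p.2 = f p.1} := fun c hc => Or.inr ⟨hc, rfl⟩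
  refine ⟨f, ⟨?_, ?_, ?_⟩, ?_⟩
  · intro c hc
    exact (hC _ _ _ _ (by omega) Set.subset_union_left hf (hmem c hc)).1 hc
  · intro c hc d hd hcd
    exact (hf.eq_iff (hmem c hc) (hmem d hd)).2 hcd
  · intro y' hy'
    obtain ⟨m, hm⟩ : ∃ m, k - C.card = m + 1 := ⟨k - C.card - 1, by omega⟩
    rw [hm] at hf
    obtain ⟨y, hy⟩ := hf.2 y'
    have hyC : y ∈ C := (hC m _ y y' (by omega)
      (Set.subset_union_left.trans (Set.subset_insert _ _)) hy (Set.mem_insert _ _)).2 hy'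
    exact ⟨y, hyC,
      (hy.eq_iff (Set.mem_insert_of_mem _ (hmem y hyC)) (Set.mem_insert _ _)).1 rfl⟩
  · intro c hc
    refine hf.anti ?_
    rintro p (rfl | hp)
    · exact hmem c hc
    · exact Or.inl hp

theorem BF.deg_eq [Finite V] {k : ℕ} {s : Set (V × W)} (h : BF G H k s) {x : V} {x' : W}
    (hx : (x, x') ∈ s) (hk : deg G x + 1 ≤ k) : deg G x = deg H x' := by
  classical
  have := Fintype.ofFinite V
  have hcard : ({y | G.Adj x y} : Finset V).card = deg G x := by
    rw [deg, Nat.card_eq_fintype_card, Fintype.card_subtype]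
  obtain ⟨f, hf, _⟩ := h.exists_bijOn (b := 0) ({y | G.Adj x y} : Finset V) {y' | H.Adj x' y'}
    (fun k' t y y' _ hst ht hy => by simpa using ht.adj_iff (hst hx) hy) (by omega)
  rw [deg, deg]
  exact Nat.card_congr (Equiv.trans (Equiv.subtypeEquivRight (by simp)) (hf.equiv f))

end Bijections

end FODef

namespace FODef

section Branches

variable {V W : Type}

/-- Isomorphism of the branches of descendants of two vertices, where `ρ c x` means that `c` is a
child of `x`. -/
inductive BrIso (ρ : V → V → Prop) (ρ' : W → W → Prop) : V → W → Prop
  | mk (x : V) (x' : W) (f : V → W) (hf : Set.BijOn f {c | ρ c x} {c | ρ' c x'})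
      (h : ∀ c, ρ c x → BrIso ρ ρ' c (f c)) : BrIso ρ ρ' x x'

open Classical in
/-- The descendants of a vertex. -/
noncomputable def desc [Fintype V] (ρ : V → V → Prop) (x : V) : Finset V :=
  Finset.univ.filter fun y => ∃ p, Iter ρ p y x

variable [Fintype V] {ρ : V → V → Prop}

theorem mem_desc {x y : V} : y ∈ desc ρ x ↔ ∃ p, Iter ρ p y x := by simp [desc]

theorem self_mem_desc (x : V) : x ∈ desc ρ x := mem_desc.2 ⟨0, rfl⟩

theorem desc_subset {x y : V} (h : y ∈ desc ρ x) : desc ρ y ⊆ desc ρ x := by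
  obtain ⟨p, hp⟩ := mem_desc.1 h
  intro z hz
  obtain ⟨q, hq⟩ := mem_desc.1 hz
  exact mem_desc.2 ⟨q + p, (iter_add _ _ _ _ _).2 ⟨y, hq, hp⟩⟩

theorem mem_desc_of_rel {x y : V} (h : ρ y x) : y ∈ desc ρ x := mem_desc.2 ⟨1, (iter_one _ _ _).2 h⟩

omit [Fintype V] in
theorem no_cycle {N : ℕ} (hN : ∀ x y p, Iter ρ p x y → p ≤ N) {q : ℕ} {y : V} (hq : 1 ≤ q)
    (h : Iter ρ q y y) : False := by
  have key : ∀ m, Iter ρ (m * q) y y := by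
    intro m
    induction m with
    | zero => simp [Iter]
    | succ m ih => rw [Nat.succ_mul, iter_add]; exact ⟨y, ih, h⟩
  have := hN _ _ _ (key (N + 1))
  have : (N + 1) * 1 ≤ (N + 1) * q := Nat.mul_le_mul_left _ hq
  omega

theorem disjoint_desc (hρ : ∀ x y z, ρ x y → ρ x z → y = z) {N : ℕ}
    (hN : ∀ x y p, Iter ρ p x y → p ≤ N) {c d y : V} (hc : ρ c y) (hd : ρ d y) (hcd : c ≠ d) :
    Disjoint (desc ρ c) (desc ρ d) := by
  have key : ∀ {c d : V}, ρ c y → ρ d y → c ≠ d → ∀ {p q z}, p ≤ q → Iter ρ p z c → Iter ρ q z d →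
      False := by
    intro c d hc hd hcd p q z hpq hp hq
    have h := hp.of_le hρ hq hpq
    obtain h0 | ⟨m, hm⟩ : q - p = 0 ∨ ∃ m, q - p = m + 1 := by
      rcases Nat.eq_zero_or_eq_succ_pred (q - p) with h | h
      · exact Or.inl h
      · exact Or.inr ⟨_, h⟩
    · rw [h0] at h; exact hcd h
    · rw [hm] at h
      obtain ⟨w, hw, hwd⟩ := h
      obtain rfl := hρ _ _ _ hc hw
      exact no_cycle hN (q := m + 1) (by omega) ((iter_succ' _ _ _ _).2 ⟨d, hwd, hd⟩)
  rw [Finset.disjoint_left]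
  intro z hz hz'
  obtain ⟨p, hp⟩ := mem_desc.1 hz
  obtain ⟨q, hq⟩ := mem_desc.1 hz'
  rcases le_total p q with h | h
  · exact key hc hd hcd h hp hq
  · exact key hd hc hcd.symm h hq hp

theorem not_mem_desc_child {N : ℕ} (hN : ∀ x y p, Iter ρ p x y → p ≤ N) {c y : V} (hc : ρ c y) :
    y ∉ desc ρ c := by
  intro h
  obtain ⟨p, hp⟩ := mem_desc.1 h
  exact no_cycle hN (q := p + 1) (by omega) ((iter_succ' _ _ _ _).2 ⟨c, hp, hc⟩)

/-- The child relation restricted to children with the largest number of descendants. -/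
def HeavyChild (ρ : V → V → Prop) (c y : V) : Prop :=
  ρ c y ∧ ∀ d, ρ d y → (desc ρ d).card ≤ (desc ρ c).card

theorem exists_heavy_path {N : ℕ} (hN : ∀ x y p, Iter ρ p x y → p ≤ N) (x : V) :
    ∃ h e, Iter (HeavyChild ρ) h e x ∧ ∀ c, ¬ ρ c e := by
  classical
  induction hm : (desc ρ x).card using Nat.strong_induction_on generalizing x with
  | _ m ih =>
    by_cases hx : ∃ c, ρ c x
    · obtain ⟨c, hc, hmax⟩ := Finset.exists_max_image (Finset.univ.filter fun c => ρ c x)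
        (fun c => (desc ρ c).card) (by obtain ⟨c, hc⟩ := hx; exact ⟨c, by simpa using hc⟩)
      simp only [Finset.mem_filter, Finset.mem_univ, true_and] at hc hmax
      have hlt : (desc ρ c).card < m := by
        rw [← hm]
        refine Finset.card_lt_card (Finset.ssubset_iff_subset_ne.2
          ⟨desc_subset (mem_desc_of_rel hc), fun h => ?_⟩)
        exact not_mem_desc_child hN hc (h ▸ self_mem_desc x)
      obtain ⟨h, e, h1, h2⟩ := ih _ hlt c rfl
      exact ⟨h + 1, e, (iter_succ' _ _ _ _).2 ⟨c, h1, hc, hmax⟩, h2⟩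
    · exact ⟨0, x, rfl, fun c hc => hx ⟨c, hc⟩⟩

variable {G : SimpleGraph V} {H : SimpleGraph W}

theorem brIso_of_BF {ρ' : W → W → Prop} (hρ : ∀ x y z, ρ x y → ρ x z → y = z)
    (hρ' : ∀ x y z, ρ' x y → ρ' x z → y = z) (hadj : ∀ x y, ρ x y → G.Adj x y) {R : ℕ}
    (hN : ∀ x y p, Iter ρ p x y → p ≤ R) {b : ℕ}
    (hpres : ∀ p ≤ R, Pres G H b (Iter ρ p) (Iter ρ' p)) (hpres' : Pres G H b ρ ρ') {v : V}
    {B s : ℕ} (hB : ∀ Z ⊆ desc ρ v, Z.card ≤ s → ∑ z ∈ Z, deg G z ≤ B) :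
    ∀ r x x' Z k, x ∈ desc ρ v → Z ⊆ desc ρ v → Disjoint Z (desc ρ x) → Z.card + r ≤ s →
      (desc ρ x).card < 2 ^ r → b + 4 * r + B + 4 ≤ k + ∑ z ∈ Z, deg G z →
      BF G H k {(x, x')} → BrIso ρ ρ' x x' := by
  classical
  intro r
  induction r with
  | zero =>
    intro x _ _ _ _ _ _ _ hcard
    have := Finset.card_pos.2 ⟨x, self_mem_desc (ρ := ρ) x⟩
    simp at hcard
    simp [hcard] at this
  | succ r ih =>
    intro x x' Z k hxv hZv hZx hZs hcard hk hBF
    have hsumZ : ∀ y ∈ desc ρ x, ∑ z ∈ insert y Z, deg G z = deg G y + ∑ z ∈ Z, deg G z := by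
      intro y hy
      exact Finset.sum_insert fun h => Finset.disjoint_left.1 hZx h hy
    have hsubZ : ∀ y ∈ desc ρ x, insert y Z ⊆ desc ρ v := by
      intro y hy
      exact Finset.insert_subset (desc_subset hxv hy) hZv
    have hdegB : ∀ y ∈ desc ρ x, deg G y + ∑ z ∈ Z, deg G z ≤ B := by
      intro y hy
      rw [← hsumZ y hy]
      refine hB _ (hsubZ y hy) ((Finset.card_insert_le _ _).trans (by omega))
    have hdeg0 := hdegB x (self_mem_desc x)
    obtain ⟨h, e, hpath, he⟩ := exists_heavy_path hN x
    obtain ⟨k₁, rfl⟩ : ∃ k₁, k = k₁ + 1 := ⟨k - 1, by omega⟩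
    obtain ⟨e', he'⟩ := hBF.1 e
    have hex : Iter ρ h e x := hpath.mono fun _ _ h => h.1
    have hhR : h ≤ R := hN _ _ _ hex
    have hchild : ∀ c', ¬ ρ' c' e' := by
      intro c' hc'
      obtain ⟨k₂, rfl⟩ : ∃ k₂, k₁ = k₂ + 1 := ⟨k₁ - 1, by omega⟩
      obtain ⟨c, hc⟩ := he'.2 c'
      exact he c ((hpres' k₂ _ c c' e e' (by omega) hc (by simp) (by simp)).2 hc')
    have hex' : Iter ρ' h e' x' := (hpres h hhR _ _ e e' x x' (by omega) he' (by simp) (by simp)).1 hex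
    have key : ∀ i ≤ h, ∀ y y', Iter (HeavyChild ρ) i e y → Iter ρ' i e' y' → y ∈ desc ρ x →
        BrIso ρ ρ' y y' := by
      intro i
      induction i with
      | zero =>
        rintro _ y y' rfl rfl _
        refine ⟨e, e', fun _ => e', ?_, fun c hc => (he c hc).elim⟩
        rw [show {c | ρ c e} = ∅ by ext c; simpa using he c,
          show {c | ρ' c e'} = ∅ by ext c; simpa using hchild c]
        exact Set.bijOn_empty _
      | succ i ihi =>
        intro hi y y' hy hy' hyx
        obtain ⟨y₁, hy₁, hy₁y, hmax⟩ := (iter_succ' _ _ _ _).1 hy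
        obtain ⟨y₁', hy₁', hy₁y'⟩ := (iter_succ' _ _ _ _).1 hy'
        have hey : Iter ρ (i + 1) e y := hy.mono fun _ _ h => h.1
        have hey₁ : Iter ρ i e y₁ := hy₁.mono fun _ _ h => h.1
        have hy₁x : y₁ ∈ desc ρ x := desc_subset hyx (mem_desc_of_rel hy₁y)
        have hB1 := ihi (by omega) y₁ y₁' hy₁ hy₁' hy₁x
        have hdy := hdegB y hyx
        obtain ⟨k₂, rfl⟩ : ∃ k₂, k₁ = k₂ + 2 := ⟨k₁ - 2, by omega⟩
        obtain ⟨y'', hB2⟩ := he'.1 y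
        obtain rfl : y'' = y' :=
          ((hpres (i + 1) (by omega) _ _ e e' y y'' (by omega) hB2 (by simp) (by simp)).1
            hey).functional hρ' hy'
        obtain ⟨y₁'', hB3⟩ := hB2.1 y₁
        obtain rfl : y₁'' = y₁' :=
          ((hpres i (by omega) _ _ e e' y₁ y₁'' (by omega) hB3 (by simp) (by simp)).1
            hey₁).functional hρ' hy₁'
        have hC : (Finset.univ.filter fun c => ρ c y ∧ c ≠ y₁).card ≤ deg G y := by
          rw [deg, Nat.card_eq_fintype_card, Fintype.card_subtype]
          refine Finset.card_le_card fun c hc => ?_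
          simp only [Finset.mem_filter, Finset.mem_univ, true_and] at hc ⊢
          exact (hadj _ _ hc.1).symm
        obtain ⟨f, hf, hfB⟩ := hB3.exists_bijOn (b := b)
          (Finset.univ.filter fun c => ρ c y ∧ c ≠ y₁) {c' | ρ' c' y'' ∧ c' ≠ y₁''} (by
            intro k' t c c' hk' hst ht hc
            simp only [Finset.mem_filter, Finset.mem_univ, true_and, Set.mem_ofPred_eq]
            exact and_congr (hpres' k' t c c' y y'' hk' ht hc (hst (by simp)))
              (not_congr (ht.eq_iff hc (hst (by simp))))) (by omega)
        refine ⟨y, y'', Function.update f y₁ y₁'', ?_, ?_⟩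
        · have h1 : {c | ρ c y} = insert y₁ {c | ρ c y ∧ c ≠ y₁} := by
            ext c
            by_cases hc : c = y₁
            · simp [hc, hy₁y]
            · simp [hc]
          have h2 : {c | ρ' c y''} = insert y₁'' {c | ρ' c y'' ∧ c ≠ y₁''} := by
            ext c
            by_cases hc : c = y₁''
            · simp [hc, hy₁y']
            · simp [hc]
          rw [h1, h2]
          have h3 : Set.BijOn (Function.update f y₁ y₁'') {c | ρ c y ∧ c ≠ y₁}
              {c' | ρ' c' y'' ∧ c' ≠ y₁''} := by
            refine Set.BijOn.congr (by simpa using hf) ?_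
            intro c hc
            simp [hc.2]
          have h4 := h3.insert (a := y₁) (by simp)
          simpa using h4
        · intro c hc
          by_cases hcy : c = y₁
          · subst hcy; simpa using hB1
          · have hcC : c ∈ Finset.univ.filter fun c => ρ c y ∧ c ≠ y₁ := by simp [hc, hcy]
            have hfc := hfB c hcC
            simp only [Function.update_of_ne hcy]
            have hdis := disjoint_desc hρ hN hc hy₁y hcy
            have hcx : c ∈ desc ρ x := desc_subset hyx (mem_desc_of_rel hc)
            refine ih c (f c) (insert y Z) _ (desc_subset hxv hcx) (hsubZ y hyx) ?_ ?_ ?_ ?_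
              (hfc.anti (by simp))
            · rw [Finset.disjoint_insert_left]
              exact ⟨not_mem_desc_child hN hc, hZx.mono_right (desc_subset hcx)⟩
            · have := Finset.card_insert_le y Z; omega
            · have h5 : (desc ρ c).card + (desc ρ y₁).card ≤ (desc ρ x).card := by
                rw [← Finset.card_union_of_disjoint hdis]
                exact Finset.card_le_card (Finset.union_subset (desc_subset hcx) (desc_subset hy₁x))
              have h6 := hmax c hc
              rw [pow_succ] at hcard
              omega
            · rw [hsumZ y hyx]; omega
    exact key h le_rfl x x' hpath hex' (self_mem_desc x)

end Branches

section Assembly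

variable {V W : Type} {G : SimpleGraph V} {H : SimpleGraph W}

/-- The relation obtained by extending `κ` from the core to descendants by means of `σ`. -/
inductive BrRel (K : V → Prop) (ρ : V → V → Prop) (κ : V → W) (σ : V → W → V → W) : V → W → Prop
  | base (v : V) (h : K v) : BrRel K ρ κ σ v (κ v)
  | step (x : V) (x' : W) (c : V) (h : BrRel K ρ κ σ x x') (hc : ρ c x) :
      BrRel K ρ κ σ c (σ x x' c)

/-- An isomorphism of cores which extends to the branches gives an isomorphism. -/
theorem nonempty_iso_of_core (K : V → Prop) (K' : W → Prop) (ρ : V → V → Prop) (ρ' : W → W → Prop)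
    (hρ : ∀ x y z, ρ x y → ρ x z → y = z) (hρ' : ∀ x y z, ρ' x y → ρ' x z → y = z)
    (hK : ∀ x y, ρ x y → ¬ K x) (hK' : ∀ x y, ρ' x y → ¬ K' x)
    (hG : ∀ x y, G.Adj x y ↔ (K x ∧ K y ∧ G.Adj x y) ∨ ρ x y ∨ ρ y x)
    (hH : ∀ x y, H.Adj x y ↔ (K' x ∧ K' y ∧ H.Adj x y) ∨ ρ' x y ∨ ρ' y x)
    (hreach : ∀ x, ∃ p v, K v ∧ Iter ρ p x v) (hreach' : ∀ x, ∃ p v, K' v ∧ Iter ρ' p x v)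
    (κ : V → W) (hκ : Set.BijOn κ {v | K v} {w | K' w})
    (hκadj : ∀ x y, K x → K y → (G.Adj x y ↔ H.Adj (κ x) (κ y)))
    (hbr : ∀ v, K v → BrIso ρ ρ' v (κ v)) : Nonempty (G ≃g H) := by
  classical
  have hstep : ∀ x x', BrIso ρ ρ' x x' → ∃ f : V → W, Set.BijOn f {c | ρ c x} {c | ρ' c x'} ∧
      ∀ c, ρ c x → BrIso ρ ρ' c (f c) := by
    rintro x x' ⟨_, _, f, hf, h⟩; exact ⟨f, hf, h⟩
  choose! σ hσ hσ' using hstep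
  let Rel := BrRel K ρ κ σ
  have hRelBr : ∀ {x x'}, Rel x x' → BrIso ρ ρ' x x' := by
    intro x x' h
    induction h with
    | base v h => exact hbr v h
    | step x x' c _ hc ih => exact hσ' x x' ih c hc
  have hfun : ∀ {x x'}, Rel x x' → ∀ {x''}, Rel x x'' → x' = x'' := by
    intro x x' h
    induction h with
    | base v h =>
      rintro _ (⟨_, _⟩ | ⟨x, x', _, _, hc⟩)
      · rfl
      · exact (hK _ _ hc h).elim
    | step x x' c _ hc ih =>
      rintro _ (⟨_, hv⟩ | ⟨y, y', _, hy, hcy⟩)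
      · exact (hK _ _ hc hv).elim
      · obtain rfl := hρ _ _ _ hc hcy
        rw [ih hy]
  have hK'Rel : ∀ {x x'}, Rel x x' → (K x ↔ K' x') := by
    rintro _ _ (⟨v, hv⟩ | ⟨x, x', c, h, hc⟩)
    · exact iff_of_true hv (hκ.mapsTo hv)
    · exact iff_of_false (hK _ _ hc) (hK' _ x' ((hσ x x' (hRelBr h)).mapsTo hc))
  have hinj : ∀ {x x'}, Rel x x' → ∀ {y}, Rel y x' → x = y := by
    intro x x' h
    induction h with
    | base v h =>
      intro y hy
      have hKy : K y := (hK'Rel hy).2 (hκ.mapsTo h)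
      have := hfun hy (BrRel.base y hKy)
      exact hκ.injOn h hKy this
    | step x x' c h hc ih =>
      intro y hy
      have h1 : ρ' (σ x x' c) x' := (hσ x x' (hRelBr h)).mapsTo hc
      generalize hz : σ x x' c = z at hy h1
      rcases hy with ⟨_, hv⟩ | ⟨y, y', d, hy, hd⟩
      · exact (hK' _ _ h1 (hκ.mapsTo hv)).elim
      · have h2 : ρ' (σ y y' _) y' := (hσ y y' (hRelBr hy)).mapsTo hd
        obtain rfl : x' = y' := hρ' _ _ _ h1 h2
        obtain rfl := ih hy
        exact (hσ x x' (hRelBr h)).injOn hc hd hz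
  have htot : ∀ x, ∃ x', Rel x x' := by
    intro x
    obtain ⟨p, v, hv, hp⟩ := hreach x
    induction p generalizing x with
    | zero => obtain rfl := hp; exact ⟨_, .base _ hv⟩
    | succ p ih =>
      obtain ⟨y, hy, hyp⟩ := hp
      obtain ⟨y', hy'⟩ := ih y hyp
      exact ⟨_, .step y y' x hy' hy⟩
  have hsurj : ∀ x', ∃ x, Rel x x' := by
    intro x
    obtain ⟨p, v, hv, hp⟩ := hreach' x
    induction p generalizing x with
    | zero =>
      obtain rfl := hp
      obtain ⟨u, hu, rfl⟩ := hκ.surjOn hv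
      exact ⟨u, .base _ hu⟩
    | succ p ih =>
      obtain ⟨y', hy', hyp⟩ := hp
      obtain ⟨y, hy⟩ := ih y' hyp
      obtain ⟨c, hc, rfl⟩ := (hσ y y' (hRelBr hy)).surjOn hy'
      exact ⟨c, .step y y' c hy hc⟩
  have hρRel : ∀ {x x' y y'}, Rel x x' → Rel y y' → (ρ x y ↔ ρ' x' y') := by
    intro x x' y y' hx hy
    constructor
    · intro h
      obtain rfl := hfun hx (.step y y' x hy h)
      exact (hσ y y' (hRelBr hy)).mapsTo h
    · intro h
      obtain ⟨c, hc, rfl⟩ := (hσ y y' (hRelBr hy)).surjOn h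
      obtain rfl := hinj hx (.step y y' c hy hc)
      exact hc
  choose e he using htot
  have hbij : Function.Bijective e := by
    refine ⟨fun x y hxy => hinj (he x) (hxy ▸ he y), fun x' => ?_⟩
    obtain ⟨x, hx⟩ := hsurj x'
    exact ⟨x, hfun (he x) hx⟩
  refine ⟨⟨Equiv.ofBijective e hbij, ?_⟩⟩
  intro x y
  simp only [Equiv.ofBijective_apply]
  rw [hG, hH, hρRel (he x) (he y), hρRel (he y) (he x), hK'Rel (he x), hK'Rel (he y)]
  have : K' (e x) → K' (e y) → (H.Adj (e x) (e y) ↔ G.Adj x y) := by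
    intro hx hy
    have hx := (hK'Rel (he x)).2 hx
    have hy := (hK'Rel (he y)).2 hy
    rw [hκadj x y hx hy, hfun (he x) (.base x hx), hfun (he y) (.base y hy)]
  tauto

end Assembly

end FODef

namespace FODef

section Deterministic

variable {V W : Type} [Fintype V] {T : SimpleGraph V} {H : SimpleGraph W}

/-- `x 0, …, x R` is a geodesic. -/
def IsGeod (T : SimpleGraph V) (R : ℕ) (x : ℕ → V) : Prop :=
  ∀ i l, i ≤ l → l ≤ R → T.dist (x i) (x l) = l - i

/-- Two geodesics of length `R` on which the degrees agree meet at the same time. -/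
def GeodRigid (T : SimpleGraph V) (R : ℕ) : Prop :=
  ∀ x y : ℕ → V, IsGeod T R x → IsGeod T R y → ∃ i ≤ R, x i = y i ∨ deg T (x i) ≠ deg T (y i)

omit [Fintype V] in
theorem pres_dist_eq (hT : T.Connected) {j p k : ℕ} (hp : p ≤ 2 ^ j) (hk : j ≤ k)
    {s : Set (V × V)} (h : BF T T k s) {x y x' y' : V} (hx : (x, x') ∈ s) (hy : (y, y') ∈ s)
    (hd : T.dist x y = p) : T.dist x' y' = p := by
  have h1 := pres_DL (G := T) (H := T) hp k s x x' y y' hk h hx hy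
  rw [DL_iff hT, DL_iff hT] at h1
  obtain rfl | hp0 := Nat.eq_zero_or_pos p
  · omega
  · have h2 := pres_DL (G := T) (H := T) (p := p - 1) (j := j) (by omega) k s x x' y y' hk h hx hy
    rw [DL_iff hT, DL_iff hT] at h2
    omega

theorem core_unique (hT : T.IsTree) {R j B k : ℕ} (hR : 1 ≤ R) (hRj : R ≤ 2 ^ j)
    (hdeg : ∀ v, deg T v ≤ B) (h3 : GeodRigid T R) (hk : B + j + 5 ≤ k) {v u : V}
    (hv : Core T R v) (h : BF T T k {(v, u)}) : v = u := by
  by_contra hvu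
  obtain ⟨p₁, p₂, hne, hp₁, hp₂⟩ := hv
  obtain ⟨hvp₁, a, ha, hap⟩ := (heavy_iff hT.connected hR _ _).1 hp₁
  obtain ⟨hvp₂, b, hb, hbp⟩ := (heavy_iff hT.connected hR _ _).1 hp₂
  have hab : T.dist a b = R + R := by
    have h1 : T.dist p₂ a = T.dist v a + 1 := by
      rcases dist_adj_cases hT hvp₂ a with h | h
      · exact (hne (closer_unique hT (z := a) hvp₁ hvp₂ (by omega) (by omega))).elim
      · exact h
    have := dist_of_moving_away hT (z := a) (R - 1) hvp₂ h1 (y := b) (by omega) (by omega)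
    rw [T.dist_comm]; omega
  obtain ⟨k, rfl⟩ : ∃ m, k = m + 3 := ⟨k - 3, by omega⟩
  obtain ⟨a', ha'⟩ := h.1 a
  obtain ⟨b', hb'⟩ := ha'.1 b
  have h2R : R + R ≤ 2 ^ (j + 1) := by rw [pow_succ]; omega
  have hav : T.dist a' u = R := pres_dist_eq (x := a) (y := v) hT.connected hRj (by omega) hb'
    (by simp) (by simp) (by rw [T.dist_comm]; exact ha)
  have hbv : T.dist u b' = R := pres_dist_eq (x := v) (y := b) hT.connected hRj (by omega) hb'
    (by simp) (by simp) hb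
  have hab' : T.dist a' b' = R + R := pres_dist_eq (x := a) (y := b) hT.connected h2R (by omega) hb'
    (by simp) (by simp) hab
  have hpt : ∀ i, ∃ x x' : V, i ≤ R + R → (T.dist a x = i ∧ T.dist x b = R + R - i) ∧
      (T.dist a' x' = i ∧ T.dist x' b' = R + R - i) ∧ deg T x = deg T x' := by
    intro i
    by_cases hi : i ≤ R + R
    · obtain ⟨x, hx, hx'⟩ := exists_between hT.connected (x := a) (y := b) (p := i) (q := R + R - i)
        (by omega)
      obtain ⟨x', hB⟩ := hb'.1 x
      refine ⟨x, x', fun _ => ⟨⟨hx, hx'⟩, ⟨?_, ?_⟩, ?_⟩⟩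
      · exact pres_dist_eq (x := a) (y := x) (j := j + 1) hT.connected (by omega) (by omega) hB
          (by simp) (by simp) hx
      · exact pres_dist_eq (x := x) (y := b) (j := j + 1) hT.connected (by omega) (by omega) hB
          (by simp) (by simp) hx'
      · exact hB.deg_eq (Set.mem_insert _ _) (by have := hdeg x; omega)
    · exact ⟨v, v, fun h => (hi h).elim⟩
  choose x x' hx using hpt
  have hg : ∀ i l, i ≤ l → l ≤ R + R → T.dist (x i) (x l) = l - i := by
    intro i l hil hl
    obtain ⟨⟨h1, h2⟩, _⟩ := hx i (by omega)
    obtain ⟨⟨h3, h4⟩, _⟩ := hx l hl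
    exact dist_of_between hT hil hab hl h1 h2 h3 h4
  have hg' : ∀ i l, i ≤ l → l ≤ R + R → T.dist (x' i) (x' l) = l - i := by
    intro i l hil hl
    obtain ⟨_, ⟨h1, h2⟩, _⟩ := hx i (by omega)
    obtain ⟨_, ⟨h3, h4⟩, _⟩ := hx l hl
    exact dist_of_between hT hil hab' hl h1 h2 h3 h4
  have hxR : x R = v := by
    obtain ⟨⟨h1, h2⟩, _⟩ := hx R (by omega)
    exact between_unique hT (x := a) (z := b) (q := R) R hab h1 (by omega)
      (by rw [T.dist_comm]; exact ha) hb
  have hxR' : x' R = u := by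
    obtain ⟨_, ⟨h1, h2⟩, _⟩ := hx R (by omega)
    exact between_unique hT (x := a') (z := b') (q := R) R hab' h1 (by omega) hav hbv
  obtain ⟨i, hi, hi'⟩ := h3 x x' (fun i l hil hl => hg i l hil (by omega))
    (fun i l hil hl => hg' i l hil (by omega))
  obtain ⟨l, hl, hl'⟩ := h3 (fun i => x (R + i)) (fun i => x' (R + i))
    (fun i l hil hl => by rw [hg _ _ (by omega) (by omega)]; omega)
    (fun i l hil hl => by rw [hg' _ _ (by omega) (by omega)]; omega)
  replace hi' : x i = x' i := hi'.resolve_right (fun h => h (hx i (by omega)).2.2)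
  replace hl' : x (R + l) = x' (R + l) := hl'.resolve_right (fun h => h (hx (R + l) (by omega)).2.2)
  apply hvu
  rw [← hxR, ← hxR']
  have e1 := hg i (R + l) (by omega) (by omega)
  have e2 := hg i R (by omega) (by omega)
  have e3 := hg R (R + l) (by omega) (by omega)
  have e4 := hg' i R (by omega) (by omega)
  have e5 := hg' R (R + l) (by omega) (by omega)
  rw [← hi'] at e4
  rw [← hl'] at e5
  exact between_unique hT (x := x i) (z := x (R + l)) (q := l) (R - i) (by omega) e2 (by omega) e4
    (by omega)

theorem iso_of_BF (hT : T.IsTree) {R j s B k : ℕ} (hR : 1 ≤ R) (hRj : R ≤ 2 ^ j)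
    (h₁ : ∀ v, {u | T.dist v u ≤ R}.ncard < 2 ^ s)
    (h₂ : ∀ v, ∀ Z : Finset V, (∀ z ∈ Z, T.dist v z ≤ R) → Z.card ≤ s → ∑ z ∈ Z, deg T z ≤ B)
    (h₃ : GeodRigid T R) (h₄ : ∃ y z, T.dist y z = 2 * R)
    (hk : B + 4 * s + 2 * j + 12 ≤ k) (h : BF T H k ∅) : Nonempty (T ≃g H) := by
  classical
  have hs : 1 ≤ s := by
    by_contra! hs
    obtain ⟨v⟩ := hT.connected.nonempty
    have h := h₁ v
    obtain rfl : s = 0 := by omega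
    simp only [pow_zero, Nat.lt_one_iff] at h
    rw [Set.ncard_eq_zero] at h
    have : v ∈ ({u | T.dist v u ≤ R} : Set V) := by simp
    rw [h] at this; exact this
  have hdeg : ∀ v, deg T v ≤ B := fun v => by
    simpa using h₂ v {v} (by simp) (by simpa using hs)
  set ρ := Par T R with hρdef
  set ρ' := Par H R with hρ'def
  have hreach : ∀ u, ∃ p ≤ R, ∃ v, Core T R v ∧ Iter ρ p u v := exists_iter_par_core hT hR h₄
  have hN : ∀ x y p, Iter ρ p x y → p ≤ R := by
    intro x y p hp
    obtain ⟨q, hq, v, hv, hqv⟩ := hreach x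
    by_contra! hlt
    have h1 := hqv.of_le Par.functional hp (by omega)
    obtain ⟨m, hm⟩ : ∃ m, p - q = m + 1 := ⟨p - q - 1, by omega⟩
    rw [hm] at h1
    obtain ⟨z, hz, _⟩ := h1
    exact hz.1 hv
  obtain ⟨k, rfl⟩ : ∃ m, k = m + 3 := ⟨k - 3, by omega⟩
  choose κ hκ using h.1
  replace hκ : ∀ v, BF T H (k + 2) {(v, κ v)} := fun v => by simpa using hκ v
  have huniq : ∀ {v u : V}, Core T R v → BF T T k {(v, u)} → v = u := fun hv hB =>
    core_unique hT hR hRj hdeg h₃ (by omega) hv hB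
  have htrans : ∀ {v u : V} {w : W}, BF T H k {(v, w)} → BF T H k {(u, w)} → BF T T k {(v, u)} :=
    fun h1 h2 => h1.trans h2.symm (by rintro _ rfl; exact ⟨_, rfl, rfl⟩)
  have hcore : ∀ {v : V} {w : W}, BF T H k {(v, w)} → (Core T R v ↔ Core H R w) := fun hB =>
    pres_core hRj (by omega) hB rfl
  have huniq' : ∀ {v : V} {w w' : W}, Core T R v → BF T H (k + 1) {(v, w)} →
      BF T H k {(v, w')} → w = w' := by
    intro v w w' hv h1 h2
    obtain ⟨u, hu⟩ := h1.2 w'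
    have h3 : v = u := huniq hv (htrans h2 (hu.anti (by simp)))
    exact (hu.eq_iff (x := v) (x' := w) (y := u) (y' := w') (by simp) (by simp)).1 h3
  have hρK : ∀ x y, ρ x y → ¬ Core T R x := fun x y h => h.1
  refine nonempty_iso_of_core (Core T R) (Core H R) ρ ρ' Par.functional Par.functional
    (fun x y h => h.1) (fun x y h => h.1) ?_ ?_ ?_ ?_ κ ⟨?_, ?_, ?_⟩ ?_ ?_
  · intro x y
    constructor
    · intro hxy
      rcases par_total_of_adj hT hR h₄ hxy with ⟨h1, h2⟩ | h1
      · exact Or.inl ⟨h1, h2, hxy⟩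
      · exact Or.inr h1
    · rintro (⟨_, _, h⟩ | h | h)
      exacts [h, h.adj, h.adj.symm]
  · intro x' y'
    constructor
    · intro hxy
      obtain ⟨x, hx⟩ := h.2 x'
      obtain ⟨y, hy⟩ := hx.2 y'
      have hx1 : (x, x') ∈ insert (y, y') (insert (x, x') (∅ : Set (V × W))) := by simp
      have hy1 : (y, y') ∈ insert (y, y') (insert (x, x') (∅ : Set (V × W))) := by simp
      have hadj := (hy.adj_iff hx1 hy1).2 hxy
      have e1 := pres_par (G := T) (H := H) hRj (k + 1) _ x x' y y' (by omega) hy hx1 hy1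
      have e2 := pres_par (G := T) (H := H) hRj (k + 1) _ y y' x x' (by omega) hy hy1 hx1
      have e3 := pres_core (G := T) (H := H) hRj (by omega) hy hx1
      have e4 := pres_core (G := T) (H := H) hRj (by omega) hy hy1
      rcases par_total_of_adj hT hR h₄ hadj with ⟨h1, h2⟩ | h1 | h1
      · exact Or.inl ⟨e3.1 h1, e4.1 h2, hxy⟩
      · exact Or.inr (Or.inl (e1.1 h1))
      · exact Or.inr (Or.inr (e2.1 h1))
    · rintro (⟨_, _, h⟩ | h | h)
      exacts [h, h.adj, h.adj.symm]
  · intro x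
    obtain ⟨p, _, v, hv, hp⟩ := hreach x
    exact ⟨p, v, hv, hp⟩
  · intro x'
    obtain ⟨x, hx⟩ := h.2 x'
    obtain ⟨p, hpR, v, hv, hp⟩ := hreach x
    obtain ⟨v', hv'⟩ := hx.1 v
    exact ⟨p, v', (hcore (v := v) (hv'.pred.anti (by simp))).1 hv,
      (pres_iter_par hRj hpR (k + 1) _ x x' v v' (by omega) hv' (by simp) (by simp)).1 hp⟩
  · intro v hv
    exact (hcore (hκ v).pred.pred).1 hv
  · intro v hv u hu hvu
    have h1 := (hκ v).pred.pred
    rw [hvu] at h1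
    exact huniq hv (htrans h1 (hκ u).pred.pred)
  · intro w hw
    obtain ⟨v, hv⟩ := h.2 w
    replace hv : BF T H (k + 2) {(v, w)} := by simpa using hv
    have hvK := (hcore hv.pred.pred).2 hw
    exact ⟨v, hvK, huniq' hvK (hκ v).pred hv.pred.pred⟩
  · intro x y hx hy
    obtain ⟨y', hy'⟩ := (hκ x).1 y
    obtain rfl : κ y = y' := huniq' hy (hκ y).pred (hy'.pred.anti (by simp))
    exact hy'.adj_iff (by simp) (by simp)
  · intro v hv
    have hdesc : ∀ y ∈ desc ρ v, T.dist v y ≤ R := by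
      intro y hy
      obtain ⟨p, hp⟩ := mem_desc.1 hy
      have hpR := hN _ _ _ hp
      rw [T.dist_comm]
      refine le_trans ?_ hpR
      rw [← DL_iff hT.connected]
      exact hp.mono fun _ _ h => Or.inr h.adj
    refine brIso_of_BF (b := 2 * j + 3) Par.functional Par.functional (fun _ _ h => h.adj) hN
      (fun p hp => pres_iter_par hRj hp) ((pres_par hRj).mono (by omega)) (v := v) (B := B) (s := s)
      (fun Z hZ hs => h₂ v Z (fun z hz => hdesc z (hZ hz)) hs) s v (κ v) ∅ (k + 2)
      (self_mem_desc v) (by simp) (by simp) (by simp) ?_ (by simp; omega) (hκ v)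
    refine lt_of_le_of_lt ?_ (h₁ v)
    rw [← Set.ncard_coe_finset]
    exact Set.ncard_le_ncard (fun y hy => hdesc y hy) (Set.toFinite _)

end Deterministic

end FODef

namespace FODef

section Forests

open scoped Classical

variable {V : Type}

/-- A self-map all of whose cycles are fixed points. -/
def Forest (g : V → V) : Prop := ∀ v j, 1 ≤ j → g^[j] v = v → g v = v

theorem iterate_eq_of_agree {f g : V → V} {v : V} {m : ℕ} (h : ∀ i < m, f (g^[i] v) = g (g^[i] v)) :
    f^[m] v = g^[m] v := by
  induction m with
  | zero => rfl
  | succ m ih =>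
    rw [Function.iterate_succ_apply', Function.iterate_succ_apply',
      ih fun i hi => h i (by omega), h m (by omega)]

theorem iterate_fixed {g : V → V} {v : V} {i j : ℕ} (h : g (g^[i] v) = g^[i] v) (hij : i ≤ j) :
    g^[j] v = g^[i] v := by
  obtain ⟨d, rfl⟩ := Nat.exists_eq_add_of_le hij
  rw [Nat.add_comm, Function.iterate_add_apply]
  exact Function.iterate_fixed h d

theorem fixed_unique {g : V → V} {v a b : V} (ha : g a = a) (hb : g b = b)
    (hva : ∃ i, g^[i] v = a) (hvb : ∃ i, g^[i] v = b) : a = b := by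
  obtain ⟨i, rfl⟩ := hva
  obtain ⟨j, rfl⟩ := hvb
  rw [← iterate_fixed ha (le_max_left i j), iterate_fixed hb (le_max_right i j)]

theorem Forest.exists_fixed [Finite V] {g : V → V} (hg : Forest g) (v : V) :
    ∃ i, g (g^[i] v) = g^[i] v := by
  obtain ⟨i, j, hij, h⟩ := Finite.exists_ne_map_eq_of_infinite fun i : ℕ => g^[i] v
  wlog hlt : i < j generalizing i j
  · exact this j i hij.symm h.symm (by omega)
  refine ⟨i, hg _ (j - i) (by omega) ?_⟩
  rw [← Function.iterate_add_apply, Nat.sub_add_cancel hlt.le]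
  exact h.symm

/-- `f` extends the partial map given by the non-fixed points of `g`. -/
def Extends (g f : V → V) : Prop := ∀ v, g v ≠ v → f v = g v

theorem Extends.reach {g f : V → V} (h : Extends g f) {v : V} {i : ℕ} :
    ∃ j, f^[j] v = g^[i] v := by
  induction i with
  | zero => exact ⟨0, rfl⟩
  | succ i ih =>
    obtain ⟨j, hj⟩ := ih
    by_cases hfix : g (g^[i] v) = g^[i] v
    · exact ⟨j, by rw [Function.iterate_succ_apply', hfix, hj]⟩
    · exact ⟨j + 1, by rw [Function.iterate_succ_apply', Function.iterate_succ_apply', hj, h _ hfix]⟩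

theorem Extends.not_reach {g f : V → V} (h : Extends g f) (hf : Forest f) {u : V}
    (hu : f u ≠ u) : ¬ ∃ i, g^[i] (f u) = u := by
  rintro ⟨i, hi⟩
  obtain ⟨j, hj⟩ := h.reach (v := f u) (i := i)
  rw [hi, ← Function.iterate_succ_apply] at hj
  exact hu (hf u _ (by omega) hj)

theorem forest_update {g : V → V} (hg : Forest g) {u v : V}
    (hv : ¬ ∃ i, g^[i] v = u) : Forest (Function.update g u v) := by
  intro x j hj hx
  have hne : ∀ i, (Function.update g u v)^[i] x ≠ u := by
    rintro i hi
    set f := Function.update g u v with hf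
    have hfu : f u = v := by simp [hf]
    have hper : f^[j] u = u := by
      rw [← hi, ← Function.iterate_add_apply, Nat.add_comm, Function.iterate_add_apply, hx]
    have hex : ∃ i, f^[i] v = u := ⟨j - 1, by
      rw [← hfu, ← Function.iterate_succ_apply, Nat.succ_eq_add_one, Nat.sub_add_cancel hj, hper]⟩
    have hmin := Nat.find_spec hex
    refine hv ⟨Nat.find hex, ?_⟩
    refine (iterate_eq_of_agree fun i hi => ?_).trans hmin
    have := Nat.find_min hex hi
    rw [hf] at this ⊢
    rw [Function.update_of_ne this]
  have hagree : g^[j] x = (Function.update g u v)^[j] x :=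
    iterate_eq_of_agree fun i _ => by rw [Function.update_of_ne (hne i)]
  rw [hx] at hagree
  have h0 : x ≠ u := hne 0
  rw [Function.update_of_ne h0]
  exact hg x j hj hagree

theorem forest_id : Forest (id : V → V) := fun _ _ _ _ => rfl

variable [Fintype V]

/-- Fixed points. -/
noncomputable def fixs (g : V → V) : Finset V := Finset.univ.filter fun v => g v = v

theorem mem_fixs {g : V → V} {v : V} : v ∈ fixs g ↔ g v = v := by simp [fixs]

/-- Rooted trees, encoded by their parent maps, containing the forest `g`. -/
noncomputable def Ext (g : V → V) : Finset (V → V) :=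
  Finset.univ.filter fun f => Forest f ∧ (fixs f).card = 1 ∧ Extends g f

theorem mem_Ext {g f : V → V} : f ∈ Ext g ↔ Forest f ∧ (fixs f).card = 1 ∧ Extends g f := by
  simp [Ext]

theorem Extends.fixs_subset {g f : V → V} (h : Extends g f) : fixs f ⊆ fixs g := by
  intro v hv
  rw [mem_fixs] at hv ⊢
  by_contra hg
  exact hg ((h v hg).symm.trans hv)

theorem fixs_nonempty [Nonempty V] {g : V → V} (hg : Forest g) : (fixs g).Nonempty := by
  obtain ⟨v⟩ := ‹Nonempty V›
  obtain ⟨i, hi⟩ := hg.exists_fixed v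
  exact ⟨_, mem_fixs.2 hi⟩

theorem fixs_update {g : V → V} {u v : V} (huv : v ≠ u) :
    fixs (Function.update g u v) = (fixs g).erase u := by
  ext x
  rw [Finset.mem_erase, mem_fixs, mem_fixs]
  by_cases hx : x = u
  · subst hx; simp [huv]
  · simp [hx]

theorem Ext_update {g : V → V} {u v : V} (hu : g u = u) (huv : v ≠ u) :
    Ext (Function.update g u v) = (Ext g).filter fun f => f u = v := by
  ext f
  rw [Finset.mem_filter, mem_Ext, mem_Ext]
  constructor
  · rintro ⟨h1, h2, h3⟩
    refine ⟨⟨h1, h2, fun x hx => ?_⟩, ?_⟩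
    · have hxu : x ≠ u := by rintro rfl; exact hx hu
      have := h3 x
      rw [Function.update_of_ne hxu] at this
      exact this hx
    · have := h3 u
      rw [Function.update_self] at this
      exact this huv
  · rintro ⟨⟨h1, h2, h3⟩, h4⟩
    refine ⟨h1, h2, fun x hx => ?_⟩
    by_cases hxu : x = u
    · subst hxu; simpa using h4
    · rw [Function.update_of_ne hxu] at hx ⊢
      exact h3 x hx

theorem card_not_reach {g : V → V} (hg : Forest g) (v : V) :
    ((fixs g).filter fun u => ¬ ∃ i, g^[i] v = u).card + 1 = (fixs g).card := by
  obtain ⟨i, hi⟩ := hg.exists_fixed v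
  have : ((fixs g).filter fun u => ¬ ∃ i, g^[i] v = u) = (fixs g).erase (g^[i] v) := by
    ext u
    simp only [Finset.mem_filter, Finset.mem_erase, mem_fixs]
    constructor
    · rintro ⟨h1, h2⟩
      exact ⟨fun h => h2 ⟨i, h.symm⟩, h1⟩
    · rintro ⟨h1, h2⟩
      exact ⟨h2, fun h3 => h1 (fixed_unique h2 hi h3 ⟨i, rfl⟩)⟩
  rw [this]
  exact Finset.card_erase_add_one (mem_fixs.2 hi)

/-- Enumeration of the rooted trees containing a given forest by in-degree weights. -/
theorem sum_Ext_prod [Nonempty V] (z : V → ℝ) {g : V → V} (hg : Forest g) :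
    ∑ f ∈ Ext g, ∏ u ∈ fixs g \ fixs f, z (f u) = (∑ v, z v) ^ ((fixs g).card - 1) := by
  induction hk : (fixs g).card using Nat.strong_induction_on generalizing g with
  | _ k ih =>
    subst hk
    have hpos := Finset.card_pos.2 (fixs_nonempty hg)
    obtain h1 | ⟨k, hk⟩ : (fixs g).card = 1 ∨ ∃ k, (fixs g).card = k + 2 := by
      rcases Nat.lt_or_ge (fixs g).card 2 with h | h
      · left; omega
      · exact Or.inr ⟨_, (Nat.sub_add_cancel h).symm⟩
    · have hE : Ext g = {g} := by
        ext f
        rw [mem_Ext, Finset.mem_singleton]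
        constructor
        · rintro ⟨_, h2, h3⟩
          have := Finset.eq_of_subset_of_card_le h3.fixs_subset (by omega)
          funext x
          by_cases hx : g x = x
          · rw [hx, ← mem_fixs, this, mem_fixs, hx]
          · exact h3 x hx
        · rintro rfl
          exact ⟨hg, h1, fun _ _ => rfl⟩
      simp [hE, h1]
    · have hstep : ∀ u ∈ fixs g, ∑ f ∈ (Ext g).filter (fun f => f u ≠ u),
          ∏ w ∈ fixs g \ fixs f, z (f w) =
          ∑ v ∈ Finset.univ.filter (fun v => ¬ ∃ i, g^[i] v = u), z v * (∑ v, z v) ^ k := by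
        intro u hu
        have hu' := mem_fixs.1 hu
        rw [← Finset.sum_fiberwise_of_maps_to (s := (Ext g).filter fun f => f u ≠ u)
          (t := Finset.univ.filter (fun v => ¬ ∃ i, g^[i] v = u)) (g := fun f => f u)]
        · refine Finset.sum_congr rfl fun v hv => ?_
          have hv' : ¬ ∃ i, g^[i] v = u := by simpa using hv
          have huv : v ≠ u := fun h => hv' ⟨0, h⟩
          have hcard : (fixs (Function.update g u v)).card = k + 1 := by
            rw [fixs_update huv, Finset.card_erase_of_mem hu, hk]; rfl
          have hih := ih _ (by omega) (forest_update hg hv') rfl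
          rw [hcard, Ext_update hu' huv] at hih
          rw [← show k + 1 - 1 = k from rfl, ← hih, Finset.mul_sum, Finset.filter_filter]
          refine Finset.sum_congr ?_ fun f hf => ?_
          · ext f
            simp only [Finset.mem_filter]
            constructor
            · rintro ⟨h1, _, h2⟩; exact ⟨h1, h2⟩
            · rintro ⟨h1, h2⟩; exact ⟨h1, by rw [h2]; exact huv, h2⟩
          · have hfu : f u = v := (Finset.mem_filter.1 hf).2
            have hmem : u ∈ fixs g \ fixs f := by
              rw [Finset.mem_sdiff, mem_fixs, mem_fixs, hfu]; exact ⟨hu', huv⟩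
            rw [fixs_update huv, ← Finset.mul_prod_erase _ _ hmem, hfu, Finset.erase_sdiff_comm]
        · intro f hf
          rw [Finset.mem_filter, mem_Ext] at hf
          simpa using hf.1.2.2.not_reach hf.1.1 hf.2
      have hcount : ((k : ℝ) + 1) * ∑ f ∈ Ext g, ∏ u ∈ fixs g \ fixs f, z (f u) =
          ((k : ℝ) + 1) * (∑ v, z v) ^ (k + 1) := by
        calc ((k : ℝ) + 1) * ∑ f ∈ Ext g, ∏ u ∈ fixs g \ fixs f, z (f u)
            = ∑ f ∈ Ext g, ∑ w ∈ fixs g \ fixs f, ∏ u ∈ fixs g \ fixs f, z (f u) := by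
              rw [Finset.mul_sum]
              refine Finset.sum_congr rfl fun f hf => ?_
              obtain ⟨_, h2, h3⟩ := mem_Ext.1 hf
              rw [Finset.sum_const, Finset.card_sdiff_of_subset h3.fixs_subset, hk, h2]
              simp
          _ = ∑ u ∈ fixs g, ∑ f ∈ (Ext g).filter (fun f => f u ≠ u),
                ∏ w ∈ fixs g \ fixs f, z (f w) := by
              refine Finset.sum_comm' fun f u => ?_
              simp only [Finset.mem_sdiff, Finset.mem_filter, mem_fixs]
              tauto
          _ = ∑ u ∈ fixs g, ∑ v ∈ Finset.univ.filter (fun v => ¬ ∃ i, g^[i] v = u),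
                z v * (∑ v, z v) ^ k := Finset.sum_congr rfl hstep
          _ = ∑ v, ∑ u ∈ (fixs g).filter (fun u => ¬ ∃ i, g^[i] v = u), z v * (∑ v, z v) ^ k := by
              refine Finset.sum_comm' fun f u => ?_
              simp only [Finset.mem_filter]
              tauto
          _ = ((k : ℝ) + 1) * (∑ v, z v) ^ (k + 1) := by
              have : ∀ v, (((fixs g).filter (fun u => ¬ ∃ i, g^[i] v = u)).card : ℝ) = k + 1 := by
                intro v
                have := card_not_reach hg v
                rw [hk] at this
                have h : ((fixs g).filter (fun u => ¬ ∃ i, g^[i] v = u)).card = k + 1 := by omega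
                rw [h]; push_cast; ring
              simp only [Finset.sum_const, nsmul_eq_mul, this]
              rw [← Finset.mul_sum, ← Finset.sum_mul]
              ring
      rw [hk]
      have hk0 : ((k : ℝ) + 1) ≠ 0 := by positivity
      exact mul_left_cancel₀ hk0 hcount

theorem card_Ext [Nonempty V] {g : V → V} (hg : Forest g) :
    (Ext g).card = Fintype.card V ^ ((fixs g).card - 1) := by
  have := sum_Ext_prod (fun _ => 1) hg
  simp at this
  exact_mod_cast this

end Forests

end FODef

namespace FODef

section Moments

open scoped Classical

variable {V : Type} [Fintype V]

/-- Number of children of `w` under the parent map `g`. -/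
noncomputable def indeg (g : V → V) (w : V) : ℕ := (Finset.univ.filter fun x => x ≠ w ∧ g x = w).card

/-- Vertices reaching `v` in at most `R` steps. -/
noncomputable def rch (R : ℕ) (f : V → V) (v : V) : Finset V :=
  Finset.univ.filter fun u => ∃ i ≤ R, f^[i] u = v

theorem mem_rch {R : ℕ} {f : V → V} {v u : V} : u ∈ rch R f v ↔ ∃ i ≤ R, f^[i] u = v := by
  simp [rch]

/-- All edges of the forest `g` lie inside `A`. -/
def Inside (g : V → V) (A : Finset V) : Prop := ∀ x, g x ≠ x → x ∈ A ∧ g x ∈ A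

omit [Fintype V] in
theorem Inside.iterate_mem {g : V → V} {A : Finset V} (h : Inside g A) {w : V} (hw : w ∈ A) (i : ℕ) :
    g^[i] w ∈ A := by
  induction i with
  | zero => exact hw
  | succ i ih =>
    rw [Function.iterate_succ_apply']
    by_cases hx : g (g^[i] w) = g^[i] w
    · rwa [hx]
    · exact (h _ hx).2

theorem indeg_update_le {g : V → V} {c w : V} (x : V) :
    indeg (Function.update g c w) x ≤ indeg g x + if x = w then 1 else 0 := by
  split_ifs with hx
  · subst hx
    refine (Finset.card_le_card (t := insert c (Finset.univ.filter fun y => y ≠ x ∧ g y = x)) ?_).trans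
      (Finset.card_insert_le _ _)
    intro y hy
    rw [Finset.mem_filter] at hy
    rw [Finset.mem_insert, Finset.mem_filter]
    by_cases hyc : y = c
    · exact Or.inl hyc
    · rw [Function.update_of_ne hyc] at hy; exact Or.inr hy
  · rw [Nat.add_zero]
    refine Finset.card_le_card fun y hy => ?_
    rw [Finset.mem_filter] at hy ⊢
    by_cases hyc : y = c
    · subst hyc; rw [Function.update_self] at hy; exact absurd hy.2.2.symm hx
    · rwa [Function.update_of_ne hyc] at hy

theorem indeg_eq_zero {g : V → V} {A : Finset V} (h : Inside g A) {c : V} (hc : c ∉ A) :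
    indeg g c = 0 := by
  refine Finset.card_eq_zero.2 (Finset.filter_eq_empty_iff.2 fun x _ hx => ?_)
  have := (h x fun h => hx.1 (h.symm.trans hx.2)).2
  rw [hx.2] at this
  exact hc this

variable [Nonempty V]

theorem sum_first_hit_le {Ψ : (V → V) → V → ℝ} {C : ℝ} (hC : 0 ≤ C) (t : ℕ) (l : ℕ)
    {g : V → V} {A : Finset V} {w : V} (hg : Forest g) (hA : Inside g A)
    (ht : ∀ x, indeg g x ≤ t + 1) (hw : indeg g w ≤ t) (hwA : w ∈ A)
    (hΨ : ∀ (g' : V → V) (A' : Finset V) (u : V), Forest g' → Inside g' A' →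
      (∀ x, indeg g' x ≤ t + 1) → u ∈ A' → A ⊆ A' → A'.card ≤ A.card + l →
      ∑ f ∈ Ext g', Ψ f u ≤ C * (Fintype.card V : ℝ) ^ ((fixs g').card - 1)) :
    ∑ f ∈ Ext g, ∑ u ∈ Finset.univ.filter (fun u => f^[l] u = w ∧ ∀ i < l, f^[i] u ∉ A), Ψ f u ≤
      C * (Fintype.card V : ℝ) ^ ((fixs g).card - 1) := by
  induction l generalizing g A w with
  | zero =>
    have := hΨ g A w hg hA ht hwA subset_rfl (by omega)
    refine (Finset.sum_congr rfl fun f _ => ?_).trans_le this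
    convert Finset.sum_singleton (Ψ f) w using 2
    ext; simp
  | succ l ih =>
    have h1 : ∑ f ∈ Ext g, ∑ u ∈ Finset.univ.filter
          (fun u => f^[l + 1] u = w ∧ ∀ i < l + 1, f^[i] u ∉ A), Ψ f u =
        ∑ c ∈ Aᶜ, ∑ f ∈ Ext (Function.update g c w), ∑ u ∈ Finset.univ.filter
          (fun u => f^[l] u = c ∧ ∀ i < l, f^[i] u ∉ insert c A), Ψ f u := by
      have h2 : ∀ c ∈ Aᶜ, g c = c ∧ w ≠ c := by
        intro c hc
        rw [Finset.mem_compl] at hc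
        refine ⟨?_, ?_⟩
        · by_contra h; exact hc (hA _ h).1
        · rintro rfl; exact hc hwA
      rw [Finset.sum_comm' (s' := fun f => Aᶜ.filter fun c => f c = w) (t' := Ext g)
          (by
            intro c f
            simp only [Finset.mem_filter]
            constructor
            · rintro ⟨h3, h4⟩
              rw [Ext_update (h2 c h3).1 (h2 c h3).2, Finset.mem_filter] at h4
              exact ⟨⟨h3, h4.2⟩, h4.1⟩
            · rintro ⟨⟨h3, h4⟩, h5⟩
              rw [Ext_update (h2 c h3).1 (h2 c h3).2, Finset.mem_filter]
              exact ⟨h3, h5, h4⟩)]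
      refine Finset.sum_congr rfl fun f hf => ?_
      have hfF := (mem_Ext.1 hf).1
      rw [← Finset.sum_fiberwise_of_maps_to (g := fun u => f^[l] u)
        (t := Aᶜ.filter fun c => f c = w)]
      · refine Finset.sum_congr rfl fun c hc => ?_
        rw [Finset.mem_filter] at hc
        refine Finset.sum_congr ?_ fun _ _ => rfl
        ext u
        simp only [Finset.mem_filter, Finset.mem_univ, true_and, Finset.mem_insert, not_or]
        constructor
        · rintro ⟨⟨h3, h4⟩, h5⟩
          refine ⟨h5, fun i hi => ⟨fun h6 => ?_, h4 i (by omega)⟩⟩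
          have : f^[l - i] c = c := by
            conv_lhs => rw [← h6]
            rw [← Function.iterate_add_apply, Nat.sub_add_cancel hi.le, h5]
          have := hfF c _ (by omega) this
          rw [hc.2] at this
          exact (h2 c hc.1).2 this
        · rintro ⟨h3, h4⟩
          refine ⟨⟨?_, fun i hi => ?_⟩, h3⟩
          · rw [Function.iterate_succ_apply', h3, hc.2]
          · rcases Nat.lt_succ_iff_lt_or_eq.1 hi with h | h
            · exact (h4 i h).2
            · rw [h, h3]; exact Finset.mem_compl.1 hc.1
      · intro u hu
        simp only [Finset.mem_filter, Finset.mem_univ, true_and] at hu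
        rw [Finset.mem_filter, Finset.mem_compl, ← Function.iterate_succ_apply' f l u]
        exact ⟨hu.2 l (by omega), hu.1⟩
    rw [h1]
    have h3 : ∀ c ∈ Aᶜ, ∑ f ∈ Ext (Function.update g c w), ∑ u ∈ Finset.univ.filter
          (fun u => f^[l] u = c ∧ ∀ i < l, f^[i] u ∉ insert c A), Ψ f u ≤
        C * (Fintype.card V : ℝ) ^ ((fixs g).card - 1) / Fintype.card V := by
      intro c hc
      rw [Finset.mem_compl] at hc
      have hgc : g c = c := by by_contra h; exact hc (hA _ h).1
      have hwc : w ≠ c := by rintro rfl; exact hc hwA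
      have hF : Forest (Function.update g c w) := forest_update hg (by
        rintro ⟨i, hi⟩
        exact hc (hi ▸ hA.iterate_mem hwA i))
      have hcard : (fixs g).card = (fixs (Function.update g c w)).card + 1 := by
        rw [fixs_update hwc, Finset.card_erase_add_one (mem_fixs.2 hgc)]
      have hpos := Finset.card_pos.2 (fixs_nonempty hF)
      have := ih (g := Function.update g c w) (A := insert c A) (w := c) hF ?_ ?_ ?_ ?_ ?_
      · refine this.trans (le_of_eq ?_)
        rw [hcard, Nat.add_sub_cancel]
        obtain ⟨m, hm⟩ := Nat.exists_eq_add_of_le' hpos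
        rw [hm, Nat.add_sub_cancel, pow_succ]
        have : (Fintype.card V : ℝ) ≠ 0 := by exact_mod_cast Fintype.card_ne_zero
        field_simp
      · intro x hx
        by_cases hxc : x = c
        · subst hxc
          rw [Function.update_self]
          exact ⟨Finset.mem_insert_self _ _, Finset.mem_insert_of_mem hwA⟩
        · rw [Function.update_of_ne hxc] at hx ⊢
          exact ⟨Finset.mem_insert_of_mem (hA x hx).1, Finset.mem_insert_of_mem (hA x hx).2⟩
      · intro x
        refine (indeg_update_le x).trans ?_
        split_ifs with hx
        · subst hx; omega
        · exact ht x
      · refine (indeg_update_le c).trans ?_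
        rw [indeg_eq_zero hA hc, if_neg (Ne.symm hwc)]
        omega
      · exact Finset.mem_insert_self _ _
      · intro g' A' u h1 h2 h3 h4 h5 h6
        refine hΨ g' A' u h1 h2 h3 h4 ((Finset.subset_insert _ _).trans h5) ?_
        rw [Finset.card_insert_of_notMem hc] at h6
        omega
    refine (Finset.sum_le_card_nsmul _ _ _ h3).trans ?_
    rw [nsmul_eq_mul]
    have hn : (0 : ℝ) < Fintype.card V := by exact_mod_cast Fintype.card_pos
    rw [mul_div_assoc', div_le_iff₀ hn, mul_comm]
    refine mul_le_mul_of_nonneg_left ?_ (by positivity)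
    exact_mod_cast Finset.card_le_univ _

omit [Fintype V] [Nonempty V] in
theorem sum_biUnion_le_sum {ι : Type} {F : V → ℝ} (hF : ∀ u, 0 ≤ F u) (s : Finset ι)
    (t : ι → Finset V) : ∑ u ∈ s.biUnion t, F u ≤ ∑ i ∈ s, ∑ u ∈ t i, F u := by
  induction s using Finset.induction_on with
  | empty => simp
  | insert a s ha ih =>
    rw [Finset.biUnion_insert, Finset.sum_insert ha]
    have := Finset.sum_union_inter (s₁ := t a) (s₂ := s.biUnion t) (f := F)
    have h0 : 0 ≤ ∑ u ∈ t a ∩ s.biUnion t, F u := Finset.sum_nonneg fun u _ => hF u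
    linarith

theorem sum_rch_le {Ψ : (V → V) → V → ℝ} (hΨ0 : ∀ f u, 0 ≤ Ψ f u) {C : ℝ} (hC : 0 ≤ C) (t R : ℕ)
    {g : V → V} {A : Finset V} {v : V} (hg : Forest g) (hA : Inside g A)
    (ht : ∀ x, indeg g x ≤ t) (hv : v ∈ A)
    (hΨ : ∀ (g' : V → V) (A' : Finset V) (u : V), Forest g' → Inside g' A' →
      (∀ x, indeg g' x ≤ t + 1) → u ∈ A' → A ⊆ A' → A'.card ≤ A.card + R →
      ∑ f ∈ Ext g', Ψ f u ≤ C * (Fintype.card V : ℝ) ^ ((fixs g').card - 1)) :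
    ∑ f ∈ Ext g, ∑ u ∈ rch R f v, Ψ f u ≤
      ((R + 1) * A.card : ℝ) * (C * (Fintype.card V : ℝ) ^ ((fixs g).card - 1)) := by
  calc ∑ f ∈ Ext g, ∑ u ∈ rch R f v, Ψ f u
      ≤ ∑ f ∈ Ext g, ∑ l ∈ Finset.range (R + 1), ∑ w ∈ A,
          ∑ u ∈ Finset.univ.filter (fun u => f^[l] u = w ∧ ∀ i < l, f^[i] u ∉ A), Ψ f u := by
        refine Finset.sum_le_sum fun f _ => ?_
        have hsub : rch R f v ⊆ (Finset.range (R + 1) ×ˢ A).biUnion fun p =>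
            Finset.univ.filter (fun u => f^[p.1] u = p.2 ∧ ∀ i < p.1, f^[i] u ∉ A) := by
          intro u hu
          obtain ⟨i, hi, hiv⟩ := mem_rch.1 hu
          have hex : ∃ i, f^[i] u ∈ A := ⟨i, hiv ▸ hv⟩
          have hle : Nat.find hex ≤ i := Nat.find_min' hex (hiv ▸ hv)
          rw [Finset.mem_biUnion]
          refine ⟨(Nat.find hex, f^[Nat.find hex] u), ?_, ?_⟩
          · rw [Finset.mem_product, Finset.mem_range]
            exact ⟨by simp only; omega, Nat.find_spec hex⟩
          · simp only [Finset.mem_filter, Finset.mem_univ, true_and]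
            exact fun j hj => Nat.find_min hex hj
        rw [← Finset.sum_product']
        refine (Finset.sum_le_sum_of_subset_of_nonneg hsub fun u _ _ => hΨ0 f u).trans ?_
        exact sum_biUnion_le_sum (hΨ0 f) _ _
    _ = ∑ l ∈ Finset.range (R + 1), ∑ w ∈ A, ∑ f ∈ Ext g,
          ∑ u ∈ Finset.univ.filter (fun u => f^[l] u = w ∧ ∀ i < l, f^[i] u ∉ A), Ψ f u := by
        rw [Finset.sum_comm]
        exact Finset.sum_congr rfl fun l _ => Finset.sum_comm
    _ ≤ ∑ l ∈ Finset.range (R + 1), ∑ w ∈ A, C * (Fintype.card V : ℝ) ^ ((fixs g).card - 1) := by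
        refine Finset.sum_le_sum fun l hl => Finset.sum_le_sum fun w hw => ?_
        rw [Finset.mem_range] at hl
        exact sum_first_hit_le hC t l hg hA (fun x => (ht x).trans (by omega)) (ht w) hw
          fun g' A' u h1 h2 h3 h4 h5 h6 => hΨ g' A' u h1 h2 h3 h4 h5 (by omega)
    _ = _ := by
        simp only [Finset.sum_const, nsmul_eq_mul, Finset.card_range]
        push_cast
        ring

/-- Sum of `Φ f {u₁, …, u_s} ∪ Z` over all tuples of vertices reaching `v` in `R` steps. -/
noncomputable def tupleSum (Φ : (V → V) → Finset V → ℝ) (R : ℕ) (f : V → V) (v : V) :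
    ℕ → Finset V → ℝ
  | 0, Z => Φ f Z
  | s + 1, Z => ∑ u ∈ rch R f v, tupleSum Φ R f v s (insert u Z)

omit [Nonempty V] in
theorem tupleSum_nonneg {Φ : (V → V) → Finset V → ℝ} (hΦ : ∀ f Z, 0 ≤ Φ f Z) (R : ℕ) (f : V → V)
    (v : V) (s : ℕ) (Z : Finset V) : 0 ≤ tupleSum Φ R f v s Z := by
  induction s generalizing Z with
  | zero => exact hΦ f Z
  | succ s ih => exact Finset.sum_nonneg fun u _ => ih _

omit [Nonempty V] in
theorem le_tupleSum {Φ : (V → V) → Finset V → ℝ} (hΦ : ∀ f Z, 0 ≤ Φ f Z)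
    (hmono : ∀ f Z Z', Z ⊆ Z' → Φ f Z ≤ Φ f Z') (R : ℕ) (f : V → V)
    (v : V) (s : ℕ) (Z Y : Finset V) (hY : Y ⊆ rch R f v) (hs : Y.card ≤ s) :
    Φ f (Z ∪ Y) ≤ tupleSum Φ R f v s Z := by
  induction s generalizing Z Y with
  | zero =>
    obtain rfl := Finset.card_eq_zero.1 (Nat.le_zero.1 hs)
    simp [tupleSum]
  | succ s ih =>
    obtain ⟨u, Y', hu, hY', hs', hsub⟩ : ∃ u Y', u ∈ rch R f v ∧ Y' ⊆ rch R f v ∧ Y'.card ≤ s ∧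
        Z ∪ Y ⊆ insert u Z ∪ Y' := by
      rcases Y.eq_empty_or_nonempty with rfl | ⟨y, hy⟩
      · refine ⟨v, ∅, mem_rch.2 ⟨0, by omega, rfl⟩, by simp, by simp, ?_⟩
        intro x hx
        simp at hx ⊢
        tauto
      · refine ⟨y, Y.erase y, hY hy, (Finset.erase_subset _ _).trans hY, ?_, ?_⟩
        · rw [Finset.card_erase_of_mem hy]; omega
        · intro x hx
          simp at hx ⊢
          tauto
    calc Φ f (Z ∪ Y) ≤ Φ f (insert u Z ∪ Y') := hmono _ _ _ hsub
      _ ≤ tupleSum Φ R f v s (insert u Z) := ih _ _ hY' hs'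
      _ ≤ _ := Finset.single_le_sum (f := fun u => tupleSum Φ R f v s (insert u Z))
          (fun u _ => tupleSum_nonneg hΦ R f v s _) hu

omit [Nonempty V] in
theorem tupleSum_one (R : ℕ) (f : V → V) (v : V) (s : ℕ) (Z : Finset V) :
    tupleSum (fun _ _ => 1) R f v s Z = ((rch R f v).card : ℝ) ^ s := by
  induction s generalizing Z with
  | zero => simp [tupleSum]
  | succ s ih => simp [tupleSum, ih, pow_succ, mul_comm]

theorem sum_tupleSum_le {Φ : (V → V) → Finset V → ℝ} (hΦ : ∀ f Z, 0 ≤ Φ f Z) (R S : ℕ) {c : ℝ}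
    (hc : 0 ≤ c)
    (hend : ∀ (g : V → V) (A Z : Finset V), Forest g → Inside g A → (∀ x, indeg g x ≤ S) →
      Z ⊆ A → Z.card ≤ S → ∑ f ∈ Ext g, Φ f Z ≤ c * (Fintype.card V : ℝ) ^ ((fixs g).card - 1))
    (v : V) :
    ∑ f ∈ Ext (id : V → V), tupleSum Φ R f v S ∅ ≤
      ((R + 1 : ℝ) * (1 + S * R)) ^ S * c * (Fintype.card V : ℝ) ^ (Fintype.card V - 1) := by
  have key : ∀ s t : ℕ, s + t = S → ∀ (g : V → V) (A Z : Finset V), Forest g → Inside g A →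
      (∀ x, indeg g x ≤ t) → v ∈ A → A.card ≤ 1 + t * R → Z ⊆ A → Z.card ≤ t →
      ∑ f ∈ Ext g, tupleSum Φ R f v s Z ≤
        ((R + 1 : ℝ) * (1 + S * R)) ^ s * c * (Fintype.card V : ℝ) ^ ((fixs g).card - 1) := by
    intro s
    induction s with
    | zero =>
      intro t ht g A Z h1 h2 h3 h4 h5 h6 h7
      obtain rfl : t = S := by omega
      simpa [tupleSum] using hend g A Z h1 h2 h3 h6 h7
    | succ s ih =>
      intro t ht g A Z h1 h2 h3 h4 h5 h6 h7
      refine (sum_rch_le (Ψ := fun f u => tupleSum Φ R f v s (insert u Z))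
        (fun f u => tupleSum_nonneg hΦ R f v s _)
        (C := ((R + 1 : ℝ) * (1 + S * R)) ^ s * c) (by positivity) t R h1 h2 h3 h4 ?_).trans ?_
      · intro g' A' u k1 k2 k3 k4 k5 k6
        refine ih (t + 1) (by omega) g' A' _ k1 k2 k3 (k5 h4) ?_ ?_ ?_
        · rw [Nat.succ_mul]; omega
        · exact Finset.insert_subset k4 (h6.trans k5)
        · exact (Finset.card_insert_le _ _).trans (by omega)
      · have hA : (A.card : ℝ) ≤ 1 + S * R := by
          have : A.card ≤ 1 + S * R := h5.trans (by gcongr; omega)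
          exact_mod_cast this
        calc ((R + 1) * A.card : ℝ) * (((R + 1 : ℝ) * (1 + S * R)) ^ s * c *
              (Fintype.card V : ℝ) ^ ((fixs g).card - 1))
            ≤ ((R + 1) * (1 + S * R) : ℝ) * (((R + 1 : ℝ) * (1 + S * R)) ^ s * c *
              (Fintype.card V : ℝ) ^ ((fixs g).card - 1)) := by gcongr
          _ = _ := by rw [pow_succ]; ring
  have := key S 0 (by omega) id {v} ∅ forest_id (fun x hx => absurd rfl hx) ?_ (by simp) (by simp)
    (by simp) (by simp)
  · have hfix : (fixs (id : V → V)) = Finset.univ := by ext; simp [mem_fixs]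
    rwa [hfix, Finset.card_univ] at this
  · intro x
    simp [indeg]

/-- Few trees have a large ball. -/
theorem card_large_rch_le (R S : ℕ) (v : V) :
    (((Ext (id : V → V)).filter fun f => 4 * ((R + 1) * (1 + S * R)) ≤ (rch R f v).card).card : ℝ) ≤
      (Fintype.card V : ℝ) ^ (Fintype.card V - 1) / 4 ^ S := by
  have h := sum_tupleSum_le (Φ := fun _ _ => 1) (fun _ _ => zero_le_one) R S (c := 1) zero_le_one
    (fun g A Z hg _ _ _ _ => by
      have : Nonempty V := inferInstance
      simp only [Finset.sum_const, nsmul_eq_mul, mul_one, one_mul, card_Ext hg]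
      push_cast
      exact le_rfl) v
  simp only [tupleSum_one, mul_one] at h
  have hM : (0 : ℝ) < ((R + 1 : ℝ) * (1 + S * R)) ^ S := by positivity
  rw [le_div_iff₀ (by positivity)]
  refine le_of_mul_le_mul_left ?_ hM
  refine le_trans ?_ h
  refine le_trans ?_ (Finset.sum_le_sum_of_subset_of_nonneg (Finset.filter_subset
    (fun f => 4 * ((R + 1) * (1 + S * R)) ≤ (rch R f v).card) _) fun _ _ _ => by positivity)
  refine le_trans ?_ (Finset.card_nsmul_le_sum _ _ ((4 * ((R + 1 : ℝ) * (1 + S * R))) ^ S) ?_)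
  · rw [nsmul_eq_mul, mul_pow 4]
    apply le_of_eq
    generalize ((R : ℝ) + 1) * (1 + S * R) = m
    ring
  · intro f hf
    have := (Finset.mem_filter.1 hf).2
    gcongr
    exact_mod_cast this

theorem sum_indeg_pow_le {x : ℝ} (hx : 1 ≤ x) (S : ℕ) {g : V → V} (hg : Forest g)
    (hS : ∀ w, indeg g w ≤ S) {Z : Finset V} (hZ : Z.card ≤ S) :
    ∑ f ∈ Ext g, x ^ (∑ w ∈ Z, indeg f w) ≤
      x ^ (S * S) * Real.exp (S * x) * (Fintype.card V : ℝ) ^ ((fixs g).card - 1) := by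
  have hx0 : (0 : ℝ) < x := by linarith
  have hterm : ∀ f ∈ Ext g, x ^ (∑ w ∈ Z, indeg f w) ≤
      x ^ (S * S) * ∏ u ∈ fixs g \ fixs f, (fun v => if v ∈ Z then x else 1) (f u) := by
    intro f hf
    obtain ⟨_, _, hfg⟩ := mem_Ext.1 hf
    rw [Finset.prod_ite, Finset.prod_const_one, mul_one, Finset.prod_const, ← pow_add]
    refine pow_le_pow_right₀ hx ?_
    have h1 : ∀ w ∈ Z, indeg f w ≤ indeg g w +
        (((fixs g \ fixs f).filter fun u => f u ∈ Z).filter fun u => f u = w).card := by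
      intro w hw
      refine (Finset.card_le_card ?_).trans (Finset.card_union_le _ _)
      intro y hy
      simp only [Finset.mem_filter, Finset.mem_union, Finset.mem_sdiff, mem_fixs, Finset.mem_univ,
        true_and] at hy ⊢
      by_cases hgy : g y = y
      · right
        refine ⟨⟨⟨hgy, fun h => hy.1 (h.symm.trans hy.2)⟩, by rw [hy.2]; exact hw⟩, hy.2⟩
      · left
        exact ⟨hy.1, (hfg y hgy).symm.trans hy.2⟩
    refine (Finset.sum_le_sum h1).trans ?_
    rw [Finset.sum_add_distrib]
    refine Nat.add_le_add ?_ (le_of_eq ?_)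
    · refine (Finset.sum_le_card_nsmul _ _ S fun w _ => hS w).trans ?_
      rw [smul_eq_mul]
      exact Nat.mul_le_mul_right _ hZ
    · exact (Finset.card_eq_sum_card_fiberwise fun u hu => by
        simpa using (Finset.mem_filter.1 hu).2).symm
  refine (Finset.sum_le_sum hterm).trans ?_
  rw [← Finset.mul_sum, sum_Ext_prod (fun v => if v ∈ Z then x else 1) hg, mul_assoc]
  refine mul_le_mul_of_nonneg_left ?_ (by positivity)
  have hn : (0 : ℝ) < Fintype.card V := by exact_mod_cast Fintype.card_pos
  have hsum : ∑ v : V, (if v ∈ Z then x else 1) ≤ Fintype.card V * (1 + S * x / Fintype.card V) := by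
    have : ∀ v : V, (if v ∈ Z then x else 1) ≤ 1 + if v ∈ Z then x else 0 := by
      intro v; split_ifs <;> linarith
    refine (Finset.sum_le_sum fun v _ => this v).trans ?_
    rw [Finset.sum_add_distrib, Finset.sum_ite_mem, Finset.univ_inter, mul_add, mul_div_cancel₀ _ hn.ne']
    simp only [Finset.sum_const, nsmul_eq_mul, Finset.card_univ, mul_one]
    have : (Z.card : ℝ) ≤ S := by exact_mod_cast hZ
    nlinarith
  have hsum0 : 0 ≤ ∑ v : V, (if v ∈ Z then x else 1) := Finset.sum_nonneg fun v _ => by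
    split_ifs <;> linarith
  refine (pow_le_pow_left₀ hsum0 hsum _).trans ?_
  rw [mul_pow, mul_comm]
  refine mul_le_mul_of_nonneg_right ?_ (by positivity)
  have h1 : 1 + S * x / Fintype.card V ≤ Real.exp (S * x / Fintype.card V) := by
    rw [add_comm]; exact Real.add_one_le_exp _
  refine (pow_le_pow_left₀ (by positivity) h1 _).trans ?_
  rw [← Real.exp_nat_mul]
  refine Real.exp_le_exp.2 ?_
  have h2 : (((fixs g).card - 1 : ℕ) : ℝ) ≤ Fintype.card V := by
    exact_mod_cast (Nat.sub_le _ _).trans (Finset.card_le_univ _)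
  calc (((fixs g).card - 1 : ℕ) : ℝ) * (S * x / Fintype.card V)
      ≤ Fintype.card V * (S * x / Fintype.card V) := by gcongr
    _ = S * x := by field_simp

/-- Few trees have a small set of vertices in a ball with a large number of children. -/
theorem card_large_indeg_le {x : ℝ} (hx : 1 ≤ x) (R S d : ℕ) (v : V) :
    (((Ext (id : V → V)).filter fun f => ∃ Y ⊆ rch R f v, Y.card ≤ S ∧
        d ≤ ∑ w ∈ Y, indeg f w).card : ℝ) ≤
      ((R + 1 : ℝ) * (1 + S * R)) ^ S * (x ^ (S * S) * Real.exp (S * x)) / x ^ d *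
        (Fintype.card V : ℝ) ^ (Fintype.card V - 1) := by
  have hx0 : (0 : ℝ) < x := by linarith
  have hΦ : ∀ (f : V → V) (Z : Finset V), 0 ≤ x ^ (∑ w ∈ Z, indeg f w) := fun _ _ => by positivity
  have h := sum_tupleSum_le (Φ := fun f Z => x ^ (∑ w ∈ Z, indeg f w)) hΦ R S
    (c := x ^ (S * S) * Real.exp (S * x)) (by positivity)
    (fun g A Z hg _ hS _ hZ => sum_indeg_pow_le hx S hg hS hZ) v
  rw [div_mul_eq_mul_div, le_div_iff₀ (by positivity)]
  refine le_trans ?_ h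
  refine le_trans ?_ (Finset.sum_le_sum_of_subset_of_nonneg (Finset.filter_subset
    (fun f => ∃ Y ⊆ rch R f v, Y.card ≤ S ∧ d ≤ ∑ w ∈ Y, indeg f w) _)
    fun f _ _ => tupleSum_nonneg hΦ R f v S ∅)
  refine le_trans (le_of_eq ?_) (Finset.card_nsmul_le_sum _ _ (x ^ d) ?_)
  · rw [nsmul_eq_mul]
  · intro f hf
    obtain ⟨Y, hY, hYS, hd⟩ := (Finset.mem_filter.1 hf).2
    have := le_tupleSum hΦ (fun f Z Z' hZ => pow_le_pow_right₀ hx (Finset.sum_le_sum_of_subset hZ))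
      R f v S ∅ Y hY hYS
    rw [Finset.empty_union] at this
    exact (pow_le_pow_right₀ hx hd).trans this

end Moments

end FODef

namespace FODef

theorem exists_independent {r : ℕ → ℕ → Prop} (hr : ∀ i j, r i j → r j i) (I : Finset ℕ)
    (h : ∀ i ∈ I, ∃ p q, ∀ j ∈ I, j ≠ i → r i j → j = p ∨ j = q) :
    ∃ J ⊆ I, I.card ≤ 3 * J.card ∧ ∀ i ∈ J, ∀ j ∈ J, j ≠ i → ¬ r i j := by
  induction hn : I.card using Nat.strong_induction_on generalizing I with
  | _ n ih =>
    rcases I.eq_empty_or_nonempty with rfl | ⟨i, hi⟩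
    · exact ⟨∅, by simp, by simp [← hn], by simp⟩
    · obtain ⟨p, q, hpq⟩ := h i hi
      have hsub : I \ {i, p, q} ⊆ I := Finset.sdiff_subset
      have hcard : I.card ≤ (I \ {i, p, q}).card + 3 := by
        have := Finset.le_card_sdiff ({i, p, q} : Finset ℕ) I
        have := Finset.card_le_three (a := i) (b := p) (c := q)
        omega
      have hlt : (I \ {i, p, q}).card < n := by
        rw [← hn]
        exact Finset.card_lt_card ⟨hsub, fun h => by simpa using h hi⟩
      obtain ⟨J, hJ, hJc, hJr⟩ := ih _ hlt (I \ {i, p, q}) (fun j hj => by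
        obtain ⟨p', q', h'⟩ := h j (hsub hj)
        exact ⟨p', q', fun l hl => h' l (hsub hl)⟩) rfl
      have hiJ : i ∉ J := fun h => by simpa using hJ h
      have hnot : ∀ j ∈ J, ¬ r i j := by
        intro j hj hij
        have hj' := hJ hj
        simp only [Finset.mem_sdiff, Finset.mem_insert, Finset.mem_singleton, not_or] at hj'
        rcases hpq j hj'.1 hj'.2.1 hij with h | h
        · exact hj'.2.2.1 h
        · exact hj'.2.2.2 h
      refine ⟨insert i J, Finset.insert_subset hi (hJ.trans hsub), ?_, ?_⟩
      · rw [Finset.card_insert_of_notMem hiJ]; omega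
      · intro x hx y hy hxy hrxy
        rw [Finset.mem_insert] at hx hy
        rcases hx with rfl | hx
        · rcases hy with rfl | hy
          · exact hxy rfl
          · exact hnot y hy hrxy
        · rcases hy with rfl | hy
          · exact hnot x hx (hr _ _ hrxy)
          · exact hJr x hx y hy hxy hrxy

section Chains

open scoped Classical

variable {V : Type} [Fintype V]

theorem indeg_eq_add {g f : V → V} (h : Extends g f) (w : V) :
    indeg f w = indeg g w + ((fixs g \ fixs f).filter fun u => f u = w).card := by
  unfold indeg
  rw [← Finset.card_union_of_disjoint]
  · congr 1
    ext y
    simp only [Finset.mem_filter, Finset.mem_union, Finset.mem_sdiff, mem_fixs, Finset.mem_univ,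
      true_and]
    by_cases hgy : g y = y
    · constructor
      · rintro ⟨h1, h2⟩
        exact Or.inr ⟨⟨hgy, fun h => h1 (h.symm.trans h2)⟩, h2⟩
      · rintro (⟨h1, h2⟩ | ⟨⟨_, h1⟩, h2⟩)
        · exact absurd (hgy.symm.trans h2) h1
        · exact ⟨fun h => h1 (h2.trans h.symm), h2⟩
    · rw [h y hgy]
      tauto
  · rw [Finset.disjoint_left]
    intro y hy hy'
    simp only [Finset.mem_filter, Finset.mem_sdiff, mem_fixs, Finset.mem_univ, true_and] at hy hy'
    exact hy.1 (hy'.1.1.symm.trans hy.2)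

variable [Nonempty V]

theorem card_parity_le {g : V → V} (hg : Forest g) {J : Finset ℕ} {p q : ℕ → V}
    (hpq : ∀ i ∈ J, p i ≠ q i)
    (hdis : ∀ i ∈ J, ∀ j ∈ J, j ≠ i → p i ≠ p j ∧ p i ≠ q j ∧ q i ≠ p j ∧ q i ≠ q j)
    (hJ : 4 * J.card ≤ Fintype.card V) (hfix : Fintype.card V ≤ 2 * ((fixs g).card - 1)) :
    (((Ext g).filter fun f => ∀ i ∈ J, indeg f (p i) = indeg f (q i)).card : ℝ) ≤
      ((1 + Real.exp (-2)) / 2) ^ J.card * (Fintype.card V : ℝ) ^ ((fixs g).card - 1) := by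
  set z : ℕ → V → ℝ := fun i v => if v = p i ∨ v = q i then -1 else 1 with hz
  set sg : ℕ → ℝ := fun i => (-1) ^ (indeg g (p i) + indeg g (q i)) with hsg
  have hparity : ∀ f ∈ Ext g, ∀ i ∈ J, sg i * ∏ u ∈ fixs g \ fixs f, z i (f u) =
      (-1) ^ (indeg f (p i) + indeg f (q i)) := by
    intro f hf i hi
    have hfg := (mem_Ext.1 hf).2.2
    rw [indeg_eq_add hfg, indeg_eq_add hfg, hz]
    simp only
    rw [Finset.prod_ite, Finset.prod_const_one, mul_one, Finset.prod_const, Finset.filter_or,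
      Finset.card_union_of_disjoint, hsg, ← pow_add]
    · congr 1; ring
    · rw [Finset.disjoint_left]
      intro u hu hu'
      exact hpq i hi ((Finset.mem_filter.1 hu).2.symm.trans (Finset.mem_filter.1 hu').2)
  have hind : ∀ f ∈ Ext g, (if ∀ i ∈ J, indeg f (p i) = indeg f (q i) then (1 : ℝ) else 0) ≤
      ∏ i ∈ J, (1 / 2 * (1 + sg i * ∏ u ∈ fixs g \ fixs f, z i (f u))) := by
    intro f hf
    rw [Finset.prod_congr rfl fun i hi => by rw [hparity f hf i hi]]
    split_ifs with h
    · refine le_of_eq (Finset.prod_eq_one fun i hi => ?_).symm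
      rw [h i hi, ← two_mul, pow_mul]
      norm_num
    · refine Finset.prod_nonneg fun i _ => ?_
      rcases neg_one_pow_eq_or ℝ (indeg f (p i) + indeg f (q i)) with h | h <;> rw [h] <;> norm_num
  have hN : (0 : ℝ) < Fintype.card V := by exact_mod_cast Fintype.card_pos
  have hbound : ∀ I ⊆ J, |∑ f ∈ Ext g, ∏ u ∈ fixs g \ fixs f, ∏ i ∈ I, z i (f u)| ≤
      Real.exp (-2) ^ I.card * (Fintype.card V : ℝ) ^ ((fixs g).card - 1) := by
    intro I hI
    rw [sum_Ext_prod (fun v => ∏ i ∈ I, z i v) hg]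
    have hsum : ∑ v : V, ∏ i ∈ I, z i v = Fintype.card V - 4 * I.card := by
      have hval : ∀ v : V, ∏ i ∈ I, z i v =
          1 - 2 * ∑ i ∈ I, ((if v = p i then 1 else 0) + if v = q i then 1 else 0) := by
        intro v
        by_cases hv : ∃ i ∈ I, v = p i ∨ v = q i
        · obtain ⟨i, hi, hvi⟩ := hv
          have hother : ∀ j ∈ I, j ≠ i → ¬ (v = p j ∨ v = q j) := by
            intro j hj hji
            have := hdis i (hI hi) j (hI hj) hji
            rcases hvi with rfl | rfl <;> tauto
          rw [Finset.prod_eq_single_of_mem i hi fun j hj hji => by simp [hz, hother j hj hji],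
            Finset.sum_eq_single_of_mem i hi fun j hj hji => by
              have := hother j hj hji
              rw [not_or] at this
              simp [this.1, this.2]]
          have := hpq i (hI hi)
          rcases hvi with rfl | rfl
          · simp [hz, this]; norm_num
          · simp [hz, this.symm]; norm_num
        · push Not at hv
          rw [Finset.prod_eq_one fun i hi => by simp [hz, hv i hi],
            Finset.sum_eq_zero fun i hi => by simp [hv i hi]]
          norm_num
      simp only [hval]
      rw [Finset.sum_sub_distrib, ← Finset.mul_sum, Finset.sum_comm]
      simp only [Finset.sum_add_distrib]
      simp
      ring
    rw [hsum, abs_pow]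
    have hIJ := Finset.card_le_card hI
    have h4 : (4 * I.card : ℝ) ≤ Fintype.card V := by exact_mod_cast (by omega)
    rw [abs_of_nonneg (by linarith)]
    have h1 : (Fintype.card V : ℝ) - 4 * I.card ≤
        Fintype.card V * Real.exp (-(4 * I.card / Fintype.card V)) := by
      have := Real.add_one_le_exp (-(4 * I.card / Fintype.card V : ℝ))
      calc (Fintype.card V : ℝ) - 4 * I.card
          = Fintype.card V * (-(4 * I.card / Fintype.card V) + 1) := by field_simp; ring
        _ ≤ _ := by gcongr
    refine (pow_le_pow_left₀ (by linarith) h1 _).trans ?_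
    rw [mul_pow, mul_comm]
    refine mul_le_mul_of_nonneg_right ?_ (by positivity)
    rw [← Real.exp_nat_mul, ← Real.exp_nat_mul]
    refine Real.exp_le_exp.2 ?_
    have hk : (Fintype.card V : ℝ) ≤ 2 * ((fixs g).card - 1 : ℕ) := by exact_mod_cast hfix
    have : (I.card : ℝ) * 2 ≤ ((fixs g).card - 1 : ℕ) * (4 * I.card / Fintype.card V) := by
      rw [mul_div_assoc', le_div_iff₀ hN]
      have : (0 : ℝ) ≤ I.card := by positivity
      nlinarith
    linarith
  calc (((Ext g).filter fun f => ∀ i ∈ J, indeg f (p i) = indeg f (q i)).card : ℝ)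
      = ∑ f ∈ Ext g, (if ∀ i ∈ J, indeg f (p i) = indeg f (q i) then (1 : ℝ) else 0) := by
        rw [Finset.sum_boole]
    _ ≤ ∑ f ∈ Ext g, ∏ i ∈ J, (1 / 2 * (1 + sg i * ∏ u ∈ fixs g \ fixs f, z i (f u))) :=
        Finset.sum_le_sum hind
    _ = (1 / 2) ^ J.card * ∑ I ∈ J.powerset, (∏ i ∈ I, sg i) *
          ∑ f ∈ Ext g, ∏ u ∈ fixs g \ fixs f, ∏ i ∈ I, z i (f u) := by
        simp only [Finset.prod_mul_distrib, Finset.prod_const,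
          Finset.prod_one_add, Finset.mul_sum]
        rw [Finset.sum_comm]
        refine Finset.sum_congr rfl fun I _ => Finset.sum_congr rfl fun f _ => ?_
        rw [Finset.prod_comm]
    _ ≤ (1 / 2) ^ J.card * ∑ I ∈ J.powerset,
          Real.exp (-2) ^ I.card * (Fintype.card V : ℝ) ^ ((fixs g).card - 1) := by
        refine mul_le_mul_of_nonneg_left (Finset.sum_le_sum fun I hI => ?_) (by positivity)
        refine (le_abs_self _).trans ?_
        rw [abs_mul]
        have : |∏ i ∈ I, sg i| = 1 := by
          rw [Finset.abs_prod]
          exact Finset.prod_eq_one fun i _ => by simp [hsg]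
        rw [this, one_mul]
        exact hbound I (Finset.mem_powerset.1 hI)
    _ = _ := by
        rw [← Finset.sum_mul, ← mul_assoc]
        congr 1
        have := Finset.prod_one_add (f := fun _ : ℕ => Real.exp (-2)) J
        simp only [Finset.prod_const] at this
        rw [← this, ← mul_pow]
        congr 1
        ring

end Chains

end FODef

namespace FODef

section Reveal

open scoped Classical

variable {V : Type}

theorem Forest.of_extends {g f : V → V} (h : Extends g f) (hf : Forest f) : Forest g := by
  intro v j hj hv
  by_contra hne
  have hall : ∀ i, g (g^[i] v) ≠ g^[i] v := by
    intro i hi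
    have h1 : g^[j * i] v = v := by
      rw [Function.iterate_mul]
      exact Function.iterate_fixed hv i
    have h2 := iterate_fixed hi (Nat.le_mul_of_pos_left i hj)
    rw [h1] at h2
    rw [← h2] at hi
    exact hne hi
  have h3 : f^[j] v = g^[j] v := iterate_eq_of_agree fun i _ => h _ (hall i)
  have h4 := hf v j hj (h3.trans hv)
  exact hne ((h v hne).symm.trans h4)

/-- The part of `f` seen by following the chains started from `a` and `b` for `m` steps. -/
noncomputable def reveal (m : ℕ) (a b : V) (f : V → V) : V → V := fun x =>
  if ∃ i < m, x = f^[i] a ∨ x = f^[i] b then f x else x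

theorem extends_reveal (m : ℕ) (a b : V) (f : V → V) : Extends (reveal m a b f) f := by
  intro v hv
  unfold reveal at hv ⊢
  split_ifs at hv ⊢ with h
  · rfl
  · exact absurd rfl hv

/-- The first `m` vertices of the chains started from `a` and from `b` are not the root. -/
def NonRoot (m : ℕ) (a b : V) (f : V → V) : Prop :=
  ∀ i < m, f (f^[i] a) ≠ f^[i] a ∧ f (f^[i] b) ≠ f^[i] b

theorem NonRoot.agree {m : ℕ} {a b : V} {f f' : V → V} (h : NonRoot m a b f)
    (hf' : Extends (reveal m a b f) f') :
    ∀ i < m, f' (f^[i] a) = f (f^[i] a) ∧ f' (f^[i] b) = f (f^[i] b) := by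
  intro i hi
  have h1 : ∃ i' < m, f^[i] a = f^[i'] a ∨ f^[i] a = f^[i'] b := ⟨i, hi, Or.inl rfl⟩
  have h2 : ∃ i' < m, f^[i] b = f^[i'] a ∨ f^[i] b = f^[i'] b := ⟨i, hi, Or.inr rfl⟩
  have ha := hf' (f^[i] a)
  have hb := hf' (f^[i] b)
  unfold reveal at ha hb
  rw [if_pos h1] at ha
  rw [if_pos h2] at hb
  exact ⟨ha (h i hi).1, hb (h i hi).2⟩

theorem NonRoot.iterate_eq {m : ℕ} {a b : V} {f f' : V → V} (h : NonRoot m a b f)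
    (hf' : Extends (reveal m a b f) f') :
    ∀ i ≤ m, f'^[i] a = f^[i] a ∧ f'^[i] b = f^[i] b := fun i hi =>
  ⟨iterate_eq_of_agree fun l hl => (h.agree hf' l (by omega)).1,
    iterate_eq_of_agree fun l hl => (h.agree hf' l (by omega)).2⟩

theorem NonRoot.reveal_eq {m : ℕ} {a b : V} {f f' : V → V} (h : NonRoot m a b f)
    (hf' : Extends (reveal m a b f) f') : reveal m a b f' = reveal m a b f := by
  have hiff : ∀ x, (∃ i < m, x = f'^[i] a ∨ x = f'^[i] b) ↔ ∃ i < m, x = f^[i] a ∨ x = f^[i] b := by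
    intro x
    refine exists_congr fun i => and_congr_right fun hi => ?_
    rw [(h.iterate_eq hf' i hi.le).1, (h.iterate_eq hf' i hi.le).2]
  funext x
  unfold reveal
  by_cases hx : ∃ i < m, x = f^[i] a ∨ x = f^[i] b
  · rw [if_pos hx, if_pos ((hiff x).2 hx)]
    obtain ⟨i, hi, rfl | rfl⟩ := hx
    · exact (h.agree hf' i hi).1
    · exact (h.agree hf' i hi).2
  · rw [if_neg hx, if_neg (fun h => hx ((hiff x).1 h))]

theorem iterate_injOn {f : V → V} (hf : Forest f) {m : ℕ} {a : V}
    (h : ∀ i < m, f (f^[i] a) ≠ f^[i] a) {i j : ℕ} (hi : i < m) (hj : j < m)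
    (hij : f^[i] a = f^[j] a) : i = j := by
  wlog hlt : i < j generalizing i j
  · by_contra hne
    exact hne (this hj hi hij.symm (by omega)).symm
  · refine absurd (hf (f^[i] a) (j - i) (by omega) ?_) (h i hi)
    rw [← Function.iterate_add_apply, Nat.sub_add_cancel hlt.le, hij]

variable [Fintype V]

/-- The chains from `a` and `b` avoid the root and have the same in-degrees at corresponding
pairwise distinct positions. -/
def ChainMatch (m : ℕ) (a b : V) (σ : ℕ → ℕ) (f : V → V) : Prop :=
  NonRoot m a b f ∧ ∀ i, 1 ≤ i → i < m →
    f^[i] a ≠ f^[σ i] b ∧ indeg f (f^[i] a) = indeg f (f^[σ i] b)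

theorem card_chainMatch_le [Nonempty V] (p : ℕ) (a b : V) {σ : ℕ → ℕ}
    (hσ : ∀ i, 1 ≤ i → i < 3 * p + 1 → σ i < 3 * p + 1)
    (hinj : ∀ i j, 1 ≤ i → i < 3 * p + 1 → 1 ≤ j → j < 3 * p + 1 → σ i = σ j → i = j)
    (hp : 12 * p + 6 ≤ Fintype.card V) :
    (((Ext (id : V → V)).filter fun f => ChainMatch (3 * p + 1) a b σ f).card : ℝ) ≤
      ((1 + Real.exp (-2)) / 2) ^ p * (Fintype.card V : ℝ) ^ (Fintype.card V - 1) := by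
  set m := 3 * p + 1 with hm
  set F := (Ext (id : V → V)).filter fun f => ChainMatch m a b σ f with hF
  set q := (1 + Real.exp (-2)) / 2 with hq
  have hq0 : 0 ≤ q := by positivity
  have hq1 : q ≤ 1 := by
    have : Real.exp (-2) ≤ 1 := Real.exp_le_one_iff.2 (by norm_num)
    rw [hq]; linarith
  have hfib : ∀ g ∈ F.image (reveal m a b),
      ((F.filter fun f => reveal m a b f = g).card : ℝ) ≤ q ^ p * (Ext g).card := by
    intro g hg
    obtain ⟨f₀, hf₀, rfl⟩ := Finset.mem_image.1 hg
    obtain ⟨hf₀E, hnr, hmatch⟩ := Finset.mem_filter.1 hf₀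
    have hf₀F := (mem_Ext.1 hf₀E).1
    have hgF : Forest (reveal m a b f₀) := hf₀F.of_extends (extends_reveal m a b f₀)
    have hinja : ∀ i j, i < m → j < m → f₀^[i] a = f₀^[j] a → i = j := fun i j hi hj =>
      iterate_injOn hf₀F (fun i hi => (hnr i hi).1) hi hj
    have hinjb : ∀ i j, i < m → j < m → f₀^[i] b = f₀^[j] b → i = j := fun i j hi hj =>
      iterate_injOn hf₀F (fun i hi => (hnr i hi).2) hi hj
    have hmem : ∀ i, i ∈ Finset.Ico 1 m ↔ 1 ≤ i ∧ i < m := fun i => Finset.mem_Ico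
    obtain ⟨J, hJI, hJc, hJr⟩ := exists_independent
      (r := fun i j => f₀^[i] a = f₀^[σ j] b ∨ f₀^[j] a = f₀^[σ i] b)
      (fun i j h => h.symm) (Finset.Ico 1 m) (by
        intro i hi
        rw [hmem] at hi
        have h1 : ∃ x, ∀ j ∈ Finset.Ico 1 m, f₀^[i] a = f₀^[σ j] b → j = x := by
          by_cases h : ∃ x ∈ Finset.Ico 1 m, f₀^[i] a = f₀^[σ x] b
          · obtain ⟨x, hx, hxe⟩ := h
            rw [hmem] at hx
            refine ⟨x, fun j hj hje => ?_⟩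
            rw [hmem] at hj
            exact hinj j x hj.1 hj.2 hx.1 hx.2
              (hinjb _ _ (hσ j hj.1 hj.2) (hσ x hx.1 hx.2) (hje.symm.trans hxe))
          · exact ⟨0, fun j hj hje => absurd ⟨j, hj, hje⟩ h⟩
        have h2 : ∃ y, ∀ j ∈ Finset.Ico 1 m, f₀^[j] a = f₀^[σ i] b → j = y := by
          by_cases h : ∃ x ∈ Finset.Ico 1 m, f₀^[x] a = f₀^[σ i] b
          · obtain ⟨x, hx, hxe⟩ := h
            rw [hmem] at hx
            refine ⟨x, fun j hj hje => ?_⟩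
            rw [hmem] at hj
            exact hinja j x hj.2 hx.2 (hje.trans hxe.symm)
          · exact ⟨0, fun j hj hje => absurd ⟨j, hj, hje⟩ h⟩
        obtain ⟨x, hx⟩ := h1
        obtain ⟨y, hy⟩ := h2
        exact ⟨x, y, fun j hj _ hr => hr.elim (fun h => Or.inl (hx j hj h))
          fun h => Or.inr (hy j hj h)⟩)
    rw [Nat.card_Ico] at hJc
    have hJm : J.card ≤ m - 1 := by
      have := Finset.card_le_card hJI
      rwa [Nat.card_Ico] at this
    have hJ' : ∀ i ∈ J, 1 ≤ i ∧ i < m := fun i hi => (hmem i).1 (hJI hi)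
    have hfixs : Fintype.card V ≤ (fixs (reveal m a b f₀)).card + 2 * m := by
      have hsub : (Finset.univ : Finset V) ⊆ fixs (reveal m a b f₀) ∪
          ((Finset.range m).image (fun i => f₀^[i] a) ∪
            (Finset.range m).image fun i => f₀^[i] b) := by
        intro x _
        simp only [Finset.mem_union, mem_fixs, Finset.mem_image, Finset.mem_range]
        by_cases hx : ∃ i < m, x = f₀^[i] a ∨ x = f₀^[i] b
        · obtain ⟨i, hi, h | h⟩ := hx
          · exact Or.inr (Or.inl ⟨i, hi, h.symm⟩)
          · exact Or.inr (Or.inr ⟨i, hi, h.symm⟩)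
        · exact Or.inl (by unfold reveal; rw [if_neg hx])
      have h1 := Finset.card_le_card hsub
      have h2 := Finset.card_union_le (fixs (reveal m a b f₀))
        ((Finset.range m).image (fun i => f₀^[i] a) ∪ (Finset.range m).image fun i => f₀^[i] b)
      have h3 := Finset.card_union_le ((Finset.range m).image (fun i => f₀^[i] a))
        ((Finset.range m).image fun i => f₀^[i] b)
      have h4 := Finset.card_image_le (s := Finset.range m) (f := fun i => f₀^[i] a)
      have h5 := Finset.card_image_le (s := Finset.range m) (f := fun i => f₀^[i] b)
      rw [Finset.card_range] at h4 h5
      rw [Finset.card_univ] at h1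
      omega
    have hpar := card_parity_le hgF (J := J) (p := fun i => f₀^[i] a) (q := fun i => f₀^[σ i] b)
      (fun i hi => (hmatch i (hJ' i hi).1 (hJ' i hi).2).1)
      (fun i hi j hj hji => by
        have := hJr i hi j hj hji
        rw [not_or] at this
        refine ⟨fun h => hji (hinja i j (hJ' i hi).2 (hJ' j hj).2 h).symm, this.1,
          fun h => this.2 h.symm, fun h => hji ?_⟩
        exact (hinj i j (hJ' i hi).1 (hJ' i hi).2 (hJ' j hj).1 (hJ' j hj).2
          (hinjb _ _ (hσ i (hJ' i hi).1 (hJ' i hi).2) (hσ j (hJ' j hj).1 (hJ' j hj).2) h)).symm)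
      (by omega) (by omega)
    rw [card_Ext hgF]
    push_cast
    refine le_trans ?_ (hpar.trans ?_)
    · refine Nat.cast_le.2 (Finset.card_le_card fun f hf => ?_)
      obtain ⟨hfF, hfg⟩ := Finset.mem_filter.1 hf
      obtain ⟨hfE, hfnr, hfm⟩ := Finset.mem_filter.1 hfF
      have hext : Extends (reveal m a b f₀) f := hfg ▸ extends_reveal m a b f
      rw [Finset.mem_filter, mem_Ext]
      refine ⟨⟨(mem_Ext.1 hfE).1, (mem_Ext.1 hfE).2.1, hext⟩, fun i hi => ?_⟩
      have := (hfm i (hJ' i hi).1 (hJ' i hi).2).2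
      rwa [(hnr.iterate_eq hext i (hJ' i hi).2.le).1,
        (hnr.iterate_eq hext _ (hσ i (hJ' i hi).1 (hJ' i hi).2).le).2] at this
    · exact mul_le_mul_of_nonneg_right (pow_le_pow_of_le_one hq0 hq1 (by omega)) (by positivity)
  rw [Finset.card_eq_sum_card_image (reveal m a b) F]
  push_cast
  refine (Finset.sum_le_sum hfib).trans ?_
  rw [← Finset.mul_sum]
  refine mul_le_mul_of_nonneg_left ?_ (by positivity)
  have hcard := card_Ext (forest_id (V := V))
  have hfix : (fixs (id : V → V)) = Finset.univ := by ext; simp [mem_fixs]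
  rw [hfix, Finset.card_univ] at hcard
  have hsum : ∑ g ∈ F.image (reveal m a b), (Ext g).card ≤ (Ext (id : V → V)).card := by
    rw [← Finset.card_biUnion]
    · refine Finset.card_le_card (Finset.biUnion_subset.2 fun g _ f hf => ?_)
      obtain ⟨h1, h2, _⟩ := mem_Ext.1 hf
      exact mem_Ext.2 ⟨h1, h2, fun v hv => absurd rfl hv⟩
    · intro g hg g' hg' hgg'
      rw [Function.onFun, Finset.disjoint_left]
      intro f hf hf'
      obtain ⟨f₁, hf₁, rfl⟩ := Finset.mem_image.1 hg
      obtain ⟨f₂, hf₂, rfl⟩ := Finset.mem_image.1 hg'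
      have h1 := ((Finset.mem_filter.1 hf₁).2.1).reveal_eq (mem_Ext.1 hf).2.2
      have h2 := ((Finset.mem_filter.1 hf₂).2.1).reveal_eq (mem_Ext.1 hf').2.2
      exact hgg' (h1.symm.trans h2)
  rw [hcard] at hsum
  exact_mod_cast hsum

end Reveal

end FODef

namespace FODef

section Stars

open scoped Classical

variable {V : Type}

theorem Forest.of_idempotent {g : V → V} (h : ∀ v, g (g v) = g v) : Forest g := by
  intro v j hj hv
  obtain ⟨j, rfl⟩ := Nat.exists_eq_add_of_le' hj
  rw [Function.iterate_succ_apply, Function.iterate_fixed (h v)] at hv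
  exact hv

/-- `S` is the set of children of `v`, and the vertices of `S` are childless. -/
def Star (f : V → V) (v : V) (S : Finset V) : Prop :=
  (∀ x, x ∈ S ↔ x ≠ v ∧ f x = v) ∧ ∀ y, f y ∉ S

variable [Fintype V]

theorem card_Ext_id [Nonempty V] :
    (Ext (id : V → V)).card = Fintype.card V ^ (Fintype.card V - 1) := by
  have hcard := card_Ext (forest_id (V := V))
  have hfix : (fixs (id : V → V)) = Finset.univ := by ext; simp [mem_fixs]
  rwa [hfix, Finset.card_univ] at hcard

theorem mem_Ext_id {f : V → V} : f ∈ Ext (id : V → V) ↔ Forest f ∧ (fixs f).card = 1 := by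
  rw [mem_Ext]
  exact ⟨fun h => ⟨h.1, h.2.1⟩, fun h => ⟨h.1, h.2, fun v hv => absurd rfl hv⟩⟩

theorem card_avoid [Nonempty V] {g : V → V} (hg : Forest g) (Z : Finset V) :
    ((Ext g).filter fun f => ∀ u ∈ fixs g \ fixs f, f u ∉ Z).card =
      (Fintype.card V - Z.card) ^ ((fixs g).card - 1) := by
  have h := sum_Ext_prod (fun v => if v ∈ Z then 0 else 1) hg
  have h1 : ∀ f : V → V, (∏ u ∈ fixs g \ fixs f, if f u ∈ Z then (0 : ℝ) else 1) =
      if ∀ u ∈ fixs g \ fixs f, f u ∉ Z then 1 else 0 := by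
    intro f
    split_ifs with h
    · exact Finset.prod_eq_one fun u hu => by rw [if_neg (h u hu)]
    · push Not at h
      obtain ⟨u, hu, huZ⟩ := h
      exact Finset.prod_eq_zero hu (by rw [if_pos huZ])
  have h2 : (∑ v : V, if v ∈ Z then (0 : ℝ) else 1) = (Fintype.card V - Z.card : ℕ) := by
    rw [← Finset.card_compl, Finset.compl_eq_univ_sdiff, Finset.sum_ite, Finset.sum_const_zero,
      zero_add, Finset.sum_const, nsmul_eq_mul, mul_one]
    congr 2
    ext; simp
  rw [h2] at h
  simp only [h1] at h
  rw [Finset.sum_boole] at h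
  exact_mod_cast h

theorem card_star [Nonempty V] {v : V} {S : Finset V} (hv : v ∉ S) :
    ((Ext (id : V → V)).filter fun f => Star f v S).card =
      (Fintype.card V - S.card - 1) ^ (Fintype.card V - S.card - 1) := by
  set g : V → V := fun x => if x ∈ S then v else x with hg
  have hgS : ∀ x ∈ S, g x = v := fun x hx => by simp [hg, hx]
  have hgS' : ∀ x, x ∉ S → g x = x := fun x hx => by simp [hg, hx]
  have hgF : Forest g := Forest.of_idempotent fun x => by
    by_cases hx : x ∈ S
    · rw [hgS x hx, hgS' v hv]
    · rw [hgS' x hx, hgS' x hx]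
  have hfix : fixs g = Sᶜ := by
    ext x
    rw [mem_fixs, Finset.mem_compl]
    refine ⟨fun h hx => ?_, hgS' x⟩
    rw [hgS x hx] at h
    exact hv (h ▸ hx)
  have := card_avoid hgF (insert v S)
  rw [hfix, Finset.card_compl, Finset.card_insert_of_notMem hv] at this
  rw [show Fintype.card V - S.card - 1 = Fintype.card V - (S.card + 1) from Nat.sub_sub _ _ _] at this ⊢
  rw [← this]
  congr 1
  ext f
  rw [Finset.mem_filter, Finset.mem_filter, mem_Ext_id, mem_Ext]
  constructor
  · rintro ⟨⟨h1, h2⟩, h3, h4⟩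
    refine ⟨⟨h1, h2, fun x hx => ?_⟩, fun u hu hfu => ?_⟩
    · have hxS : x ∈ S := by
        by_contra h; exact hx (hgS' x h)
      rw [hgS x hxS, ((h3 x).1 hxS).2]
    · rw [Finset.mem_sdiff, Finset.mem_compl, mem_fixs] at hu
      rcases Finset.mem_insert.1 hfu with h | h
      · exact hu.1 ((h3 u).2 ⟨fun h' => hu.2 (h.trans h'.symm), h⟩)
      · exact h4 u h
  · rintro ⟨⟨h1, h2, h3⟩, h4⟩
    have hfS : ∀ x ∈ S, f x = v := fun x hx => by
      rw [h3 x, hgS x hx]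
      rw [hgS x hx]
      rintro rfl
      exact hv hx
    refine ⟨⟨h1, h2⟩, fun x => ⟨fun hx => ⟨?_, hfS x hx⟩, ?_⟩, fun y hy => ?_⟩
    · rintro rfl; exact hv hx
    · rintro ⟨hxv, hfx⟩
      by_contra hx
      refine h4 x ?_ (by rw [hfx]; exact Finset.mem_insert_self _ _)
      rw [Finset.mem_sdiff, Finset.mem_compl, mem_fixs, hfx]
      exact ⟨hx, hxv.symm⟩
    · by_cases hyS : y ∈ S
      · rw [hfS y hyS] at hy; exact hv hy
      · refine h4 y ?_ (Finset.mem_insert_of_mem hy)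
        rw [Finset.mem_sdiff, Finset.mem_compl, mem_fixs]
        refine ⟨hyS, fun h => hyS (h ▸ hy)⟩

theorem card_two_stars_le [Nonempty V] {v w : V} (hvw : v ≠ w) {S S' : Finset V}
    (hS : S.Nonempty) (hS' : S'.Nonempty) :
    ((Ext (id : V → V)).filter fun f => Star f v S ∧ Star f w S').card ≤
      (Fintype.card V - (S.card + S'.card + 2)) ^ (Fintype.card V - (S.card + S'.card) - 1) := by
  by_cases hne : ((Ext (id : V → V)).filter fun f => Star f v S ∧ Star f w S').Nonempty
  swap
  · rw [Finset.not_nonempty_iff_eq_empty.1 hne]; simp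
  obtain ⟨f₀, hf₀⟩ := hne
  obtain ⟨_, h₀, h₀'⟩ := Finset.mem_filter.1 hf₀
  have hdis : Disjoint S S' := Finset.disjoint_left.2 fun x hx hx' =>
    hvw (((h₀.1 x).1 hx).2.symm.trans ((h₀'.1 x).1 hx').2)
  have hvS : v ∉ S := fun h => ((h₀.1 v).1 h).1 rfl
  have hwS' : w ∉ S' := fun h => ((h₀'.1 w).1 h).1 rfl
  have hvS' : v ∉ S' := fun h => by
    obtain ⟨x, hx⟩ := hS
    exact h₀'.2 x (by rw [((h₀.1 x).1 hx).2]; exact h)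
  have hwS : w ∉ S := fun h => by
    obtain ⟨x, hx⟩ := hS'
    exact h₀.2 x (by rw [((h₀'.1 x).1 hx).2]; exact h)
  set g : V → V := fun x => if x ∈ S then v else if x ∈ S' then w else x with hg
  have hgS : ∀ x ∈ S, g x = v := fun x hx => by simp [hg, hx]
  have hgS' : ∀ x ∈ S', g x = w := fun x hx => by
    simp [hg, hx, Finset.disjoint_right.1 hdis hx]
  have hgn : ∀ x, x ∉ S → x ∉ S' → g x = x := fun x hx hx' => by simp [hg, hx, hx']
  have hgF : Forest g := Forest.of_idempotent fun x => by
    by_cases hx : x ∈ S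
    · rw [hgS x hx, hgn v hvS hvS']
    · by_cases hx' : x ∈ S'
      · rw [hgS' x hx', hgn w hwS hwS']
      · rw [hgn x hx hx', hgn x hx hx']
  have hfix : fixs g = (S ∪ S')ᶜ := by
    ext x
    rw [mem_fixs, Finset.mem_compl, Finset.mem_union, not_or]
    refine ⟨fun h => ⟨fun hx => ?_, fun hx => ?_⟩, fun h => hgn x h.1 h.2⟩
    · rw [hgS x hx] at h
      exact hvS (h ▸ hx)
    · rw [hgS' x hx] at h
      exact hwS' (h ▸ hx)
  have hZ : (insert v (insert w (S ∪ S'))).card = S.card + S'.card + 2 := by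
    rw [Finset.card_insert_of_notMem, Finset.card_insert_of_notMem,
      Finset.card_union_of_disjoint hdis]
    · simp [hwS, hwS']
    · simp [hvw, hvS, hvS']
  have := card_avoid hgF (insert v (insert w (S ∪ S')))
  rw [hfix, Finset.card_compl, hZ, Finset.card_union_of_disjoint hdis] at this
  rw [← this]
  refine Finset.card_le_card fun f hf => ?_
  rw [Finset.mem_filter, mem_Ext_id] at hf
  obtain ⟨⟨h1, h2⟩, h3, h4⟩ := hf
  rw [Finset.mem_filter, mem_Ext]
  refine ⟨⟨h1, h2, fun x hx => ?_⟩, fun u hu hfu => ?_⟩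
  · by_cases hxS : x ∈ S
    · rw [hgS x hxS, ((h3.1 x).1 hxS).2]
    · by_cases hxS' : x ∈ S'
      · rw [hgS' x hxS', ((h4.1 x).1 hxS').2]
      · exact absurd (hgn x hxS hxS') hx
  · rw [Finset.mem_sdiff, Finset.mem_compl, mem_fixs, Finset.mem_union, not_or] at hu
    simp only [Finset.mem_insert, Finset.mem_union] at hfu
    rcases hfu with h | h | h | h
    · exact hu.1.1 ((h3.1 u).2 ⟨fun h' => hu.2 (h.trans h'.symm), h⟩)
    · exact hu.1.2 ((h4.1 u).2 ⟨fun h' => hu.2 (h.trans h'.symm), h⟩)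
    · exact h3.2 u h
    · exact h4.2 u h

end Stars

/-- Chebyshev's inequality for a counting variable. -/
theorem card_eq_zero_le {ι : Type} (s : Finset ι) (X : ι → ℝ) {N s₁ s₂ : ℝ}
    (hN : (s.card : ℝ) = N) (hs₁ : ∑ i ∈ s, X i = s₁) (hs₂ : ∑ i ∈ s, X i ^ 2 ≤ s₂)
    (hs₁0 : 0 < s₁) (hN0 : 0 < N) {t : Finset ι} (ht : t ⊆ s) (ht0 : ∀ i ∈ t, X i = 0) :
    (t.card : ℝ) / N ≤ s₂ * N / s₁ ^ 2 - 1 := by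
  set μ := s₁ / N with hμ
  have h1 : (t.card : ℝ) * μ ^ 2 ≤ ∑ i ∈ s, (X i - μ) ^ 2 := by
    calc (t.card : ℝ) * μ ^ 2 = ∑ i ∈ t, (X i - μ) ^ 2 := by
          rw [Finset.sum_congr rfl fun i hi => by rw [ht0 i hi], Finset.sum_const, nsmul_eq_mul]
          ring
      _ ≤ _ := Finset.sum_le_sum_of_subset_of_nonneg ht fun _ _ _ => sq_nonneg _
  have h2 : ∑ i ∈ s, (X i - μ) ^ 2 = ∑ i ∈ s, X i ^ 2 - s₁ ^ 2 / N := by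
    have : ∀ i, (X i - μ) ^ 2 = X i ^ 2 - 2 * μ * X i + μ ^ 2 := fun i => by ring
    simp only [this]
    rw [Finset.sum_add_distrib, Finset.sum_sub_distrib, ← Finset.mul_sum, hs₁, Finset.sum_const,
      nsmul_eq_mul, hN, hμ]
    field_simp
    ring
  have h3 : (t.card : ℝ) * μ ^ 2 ≤ s₂ - s₁ ^ 2 / N := by linarith
  have h4 : 0 < μ ^ 2 := by positivity
  have h5 : (t.card : ℝ) ≤ (s₂ - s₁ ^ 2 / N) / μ ^ 2 := by rwa [le_div_iff₀ h4]
  calc (t.card : ℝ) / N ≤ (s₂ - s₁ ^ 2 / N) / μ ^ 2 / N := by gcongr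
    _ = _ := by rw [hμ]; field_simp

end FODef

namespace FODef

open scoped Classical in
theorem card_no_star_le {V : Type} [Fintype V] [Nonempty V] {k m : ℕ} (hk : 1 ≤ k) (hm : k + 1 ≤ m)
    (hn : Fintype.card V = m + k + 1) :
    (((Ext (id : V → V)).filter fun f => ¬ ∃ v S, S.card = k ∧ Star f v S).card : ℝ) /
      (Fintype.card V : ℝ) ^ (Fintype.card V - 1) ≤
      Real.exp (2 * k * (k + 1) / m) - 1 + k ^ k * Real.exp (2 * (k + 1)) / Fintype.card V := by
  set P : Finset (Σ _ : V, Finset V) :=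
    Finset.univ.sigma fun v => Finset.powersetCard k (Finset.univ.erase v) with hP
  have hmemP : ∀ p : (Σ _ : V, Finset V), p ∈ P ↔ p.1 ∉ p.2 ∧ p.2.card = k := by
    intro p
    rw [hP, Finset.mem_sigma, Finset.mem_powersetCard]
    refine ⟨fun h => ⟨fun h' => by simpa using h.2.1 h', h.2.2⟩, fun h => ⟨Finset.mem_univ _,
      fun x hx => Finset.mem_erase.2 ⟨?_, Finset.mem_univ _⟩, h.2⟩⟩
    rintro rfl
    exact h.1 hx
  have hPc : P.card = (m + k + 1) * (m + k).choose k := by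
    rw [hP, Finset.card_sigma]
    simp [Finset.card_powersetCard, Finset.card_erase_of_mem, hn]
  set X : (V → V) → ℝ := fun f => ((P.filter fun p => Star f p.1 p.2).card : ℝ) with hX
  have hXsum : ∀ f, X f = ∑ p ∈ P, if Star f p.1 p.2 then (1 : ℝ) else 0 := by
    intro f; rw [Finset.sum_boole]
  have hm0 : (0 : ℝ) < m := by exact_mod_cast (by omega : 0 < m)
  have hone : ∀ p ∈ P, (((Ext (id : V → V)).filter fun f => Star f p.1 p.2).card : ℝ) =
      (m : ℝ) ^ m := by
    intro p hp
    obtain ⟨h1, h2⟩ := (hmemP p).1 hp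
    rw [card_star h1, h2, hn, show m + k + 1 - k - 1 = m by omega]
    push_cast; rfl
  have hs₁ : ∑ f ∈ Ext (id : V → V), X f = P.card * (m : ℝ) ^ m := by
    simp only [hXsum]
    rw [Finset.sum_comm]
    simp only [Finset.sum_boole]
    rw [Finset.sum_congr rfl hone, Finset.sum_const, nsmul_eq_mul]
  have hs₂ : ∑ f ∈ Ext (id : V → V), X f ^ 2 ≤
      P.card * (m : ℝ) ^ m + (P.card : ℝ) ^ 2 * ((m - (k + 1) : ℕ) : ℝ) ^ (m - k) := by
    have h1 : ∀ f, X f ^ 2 =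
        ∑ p ∈ P, ∑ p' ∈ P, if Star f p.1 p.2 ∧ Star f p'.1 p'.2 then (1 : ℝ) else 0 := by
      intro f
      rw [hXsum, sq, Finset.sum_mul_sum]
      refine Finset.sum_congr rfl fun p _ => Finset.sum_congr rfl fun p' _ => ?_
      by_cases h : Star f p.1 p.2 <;> by_cases h' : Star f p'.1 p'.2 <;> simp [h, h']
    simp only [h1]
    rw [Finset.sum_comm, Finset.sum_congr rfl fun p _ => Finset.sum_comm]
    simp only [Finset.sum_boole]
    have h2 : ∀ p ∈ P, ∀ p' ∈ P,
        (((Ext (id : V → V)).filter fun f => Star f p.1 p.2 ∧ Star f p'.1 p'.2).card : ℝ) ≤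
          (if p = p' then (m : ℝ) ^ m else 0) + ((m - (k + 1) : ℕ) : ℝ) ^ (m - k) := by
      intro p hp p' hp'
      split_ifs with hpp
      · subst hpp
        simp only [and_self]
        rw [hone p hp]
        have : (0 : ℝ) ≤ ((m - (k + 1) : ℕ) : ℝ) ^ (m - k) := by positivity
        linarith
      · rw [zero_add]
        by_cases hv : p.1 = p'.1
        · rw [Finset.filter_false_of_mem]
          · simp
          · rintro f _ ⟨h3, h4⟩
            refine hpp (Sigma.ext hv (heq_of_eq ?_))
            ext x
            rw [h3.1, h4.1, hv]
        · have h3 := card_two_stars_le hv (S := p.2) (S' := p'.2)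
            (Finset.card_pos.1 (by rw [((hmemP p).1 hp).2]; omega))
            (Finset.card_pos.1 (by rw [((hmemP p').1 hp').2]; omega))
          rw [((hmemP p).1 hp).2, ((hmemP p').1 hp').2, hn,
            show m + k + 1 - (k + k + 2) = m - (k + 1) by omega,
            show m + k + 1 - (k + k) - 1 = m - k by omega] at h3
          exact_mod_cast h3
    refine (Finset.sum_le_sum fun p hp => Finset.sum_le_sum fun p' hp' => h2 p hp p' hp').trans ?_
    simp only [Finset.sum_add_distrib, Finset.sum_ite_eq, Finset.sum_const, nsmul_eq_mul]
    rw [Finset.sum_congr rfl fun p hp => by rw [if_pos hp], Finset.sum_const, nsmul_eq_mul]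
    apply le_of_eq; ring
  have hPpos : (0 : ℝ) < P.card := by
    rw [hPc]
    exact_mod_cast Nat.mul_pos (by omega) (Nat.choose_pos (by omega))
  have hN0 : (0 : ℝ) < (Fintype.card V : ℝ) ^ (Fintype.card V - 1) := by
    have : (0 : ℝ) < Fintype.card V := by exact_mod_cast Fintype.card_pos
    positivity
  refine (card_eq_zero_le (Ext (id : V → V)) X (by rw [card_Ext_id]; push_cast; rfl) hs₁ hs₂
    (by positivity) hN0 (Finset.filter_subset _ _) ?_).trans ?_
  · intro f hf
    rw [Finset.mem_filter] at hf
    rw [hX]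
    simp only [Nat.cast_eq_zero, Finset.card_eq_zero]
    rw [Finset.filter_eq_empty_iff]
    intro p hp hstar
    exact hf.2 ⟨p.1, p.2, ((hmemP p).1 hp).2, hstar⟩
  rw [hn, Nat.add_sub_cancel]
  have hsplit : ((P.card : ℝ) * m ^ m + P.card ^ 2 * ((m - (k + 1) : ℕ) : ℝ) ^ (m - k)) *
      ((m + k + 1 : ℕ) : ℝ) ^ (m + k) / (P.card * m ^ m) ^ 2 =
      ((m - (k + 1) : ℕ) : ℝ) ^ (m - k) * ((m + k + 1 : ℕ) : ℝ) ^ (m + k) / (m ^ m) ^ 2 +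
        ((m + k + 1 : ℕ) : ℝ) ^ (m + k) / (P.card * m ^ m) := by
    field_simp
    ring
  rw [hsplit]
  have hratio : ((m + k + 1 : ℕ) : ℝ) / m ≤ Real.exp ((k + 1) / m) := by
    have := Real.add_one_le_exp ((k + 1 : ℝ) / m)
    refine le_trans (le_of_eq ?_) this
    push_cast
    field_simp
    ring
  have hA : ((m - (k + 1) : ℕ) : ℝ) ^ (m - k) * ((m + k + 1 : ℕ) : ℝ) ^ (m + k) / (m ^ m) ^ 2 ≤
      Real.exp (2 * k * (k + 1) / m) := by
    have h1 : ((m - (k + 1) : ℕ) : ℝ) ^ (m - k) * ((m + k + 1 : ℕ) : ℝ) ^ (m + k) ≤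
        ((m : ℝ) ^ 2) ^ (m - k) * ((m + k + 1 : ℕ) : ℝ) ^ (2 * k) := by
      rw [show m + k = (m - k) + 2 * k by omega, pow_add, ← mul_assoc, ← mul_pow]
      refine mul_le_mul_of_nonneg_right (pow_le_pow_left₀ (by positivity) ?_ _) (by positivity)
      rw [Nat.cast_sub hm]
      rw [show m - k + 2 * k = m + k by omega]
      push_cast
      nlinarith [sq_nonneg ((k : ℝ) + 1)]
    have h2 : ((m : ℝ) ^ m) ^ 2 = (m ^ 2) ^ (m - k) * m ^ (2 * k) := by
      rw [← pow_mul, ← pow_mul, ← pow_add]; congr 1; omega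
    rw [div_le_iff₀ (by positivity), h2]
    refine h1.trans ?_
    rw [mul_left_comm]
    refine mul_le_mul_of_nonneg_left ?_ (by positivity)
    rw [← div_le_iff₀ (by positivity), ← div_pow]
    refine (pow_le_pow_left₀ (by positivity) hratio _).trans ?_
    rw [← Real.exp_nat_mul]
    refine Real.exp_le_exp.2 (le_of_eq ?_)
    push_cast
    ring
  have hB : ((m + k + 1 : ℕ) : ℝ) ^ (m + k) / (P.card * m ^ m) ≤
      k ^ k * Real.exp (2 * (k + 1)) / ((m + k + 1 : ℕ) : ℝ) := by
    have h1 : (m : ℝ) ^ k ≤ k ^ k * (m + k).choose k := by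
      have h2 := Nat.pow_sub_le_descFactorial (m + k) k
      rw [Nat.descFactorial_eq_factorial_mul_choose] at h2
      have h3 : m ^ k ≤ k ^ k * (m + k).choose k :=
        (Nat.pow_le_pow_left (by omega) k).trans (h2.trans
          (Nat.mul_le_mul_right _ (Nat.factorial_le_pow k)))
      exact_mod_cast h3
    have hn0 : (0 : ℝ) < ((m + k + 1 : ℕ) : ℝ) := by positivity
    have h4 : ((m + k + 1 : ℕ) : ℝ) ^ (m + k) ≤ Real.exp (2 * (k + 1)) * m ^ (m + k) := by
      rw [← div_le_iff₀ (by positivity), ← div_pow]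
      refine (pow_le_pow_left₀ (by positivity) hratio _).trans ?_
      rw [← Real.exp_nat_mul]
      refine Real.exp_le_exp.2 ?_
      rw [mul_div_assoc', div_le_iff₀ hm0]
      have : ((m + k : ℕ) : ℝ) ≤ 2 * m := by exact_mod_cast (by omega)
      have hk0 : (0 : ℝ) ≤ (k : ℝ) + 1 := by positivity
      nlinarith
    rw [div_le_div_iff₀ (by positivity) hn0, hPc]
    push_cast at h4 ⊢
    have h5 : (m : ℝ) ^ (m + k) ≤ k ^ k * (m + k).choose k * m ^ m := by
      rw [pow_add, mul_comm]
      exact mul_le_mul_of_nonneg_right h1 (by positivity)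
    calc ((m : ℝ) + k + 1) ^ (m + k) * (m + k + 1)
        ≤ Real.exp (2 * (k + 1)) * m ^ (m + k) * (m + k + 1) := by gcongr
      _ ≤ Real.exp (2 * (k + 1)) * (k ^ k * (m + k).choose k * m ^ m) * (m + k + 1) := by gcongr
      _ = _ := by ring
  linarith

end FODef

namespace FODef

section Transfer

open scoped Classical

variable {V : Type}

/-- The graph joining every vertex to its image under `f`. -/
def treeOf (f : V → V) : SimpleGraph V where
  Adj u v := u ≠ v ∧ (f u = v ∨ f v = u)
  symm := ⟨fun _ _ h => ⟨h.1.symm, h.2.symm⟩⟩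
  loopless := ⟨fun _ h => h.1 rfl⟩

theorem treeOf_adj {f : V → V} {u v : V} : (treeOf f).Adj u v ↔ u ≠ v ∧ (f u = v ∨ f v = u) :=
  Iff.rfl

/-- `f` is the parent map of a tree rooted at `r`. -/
def Rooted (f : V → V) (r : V) : Prop := Forest f ∧ ∀ v, f v = v ↔ v = r

theorem Rooted.exists_iterate [Finite V] {f : V → V} {r : V} (hf : Rooted f r) (v : V) :
    ∃ i, f^[i] v = r := by
  obtain ⟨i, hi⟩ := hf.1.exists_fixed v
  exact ⟨i, (hf.2 _).1 hi⟩

theorem Rooted.adj {f : V → V} {r v : V} (hf : Rooted f r) (hv : v ≠ r) :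
    (treeOf f).Adj v (f v) :=
  ⟨fun h => hv ((hf.2 v).1 h.symm), Or.inl rfl⟩

theorem Rooted.reachable {f : V → V} {r : V} (hf : Rooted f r) (v : V) (i : ℕ) :
    (treeOf f).Reachable v (f^[i] v) := by
  induction i with
  | zero => exact SimpleGraph.Reachable.refl _
  | succ i ih =>
    rw [Function.iterate_succ_apply']
    by_cases h : f^[i] v = r
    · rwa [(hf.2 _).2 h]
    · exact ih.trans (hf.adj h).reachable

theorem Rooted.connected [Finite V] {f : V → V} {r : V} (hf : Rooted f r) :
    (treeOf f).Connected := by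
  have key : ∀ v, (treeOf f).Reachable v r := fun v => by
    obtain ⟨i, hi⟩ := hf.exists_iterate v
    exact hi ▸ hf.reachable v i
  have : Nonempty V := ⟨r⟩
  exact ⟨fun u v => (key u).trans (key v).symm⟩

theorem Rooted.isTree [Fintype V] {f : V → V} {r : V} (hf : Rooted f r) : (treeOf f).IsTree := by
  rw [SimpleGraph.isTree_iff_connected_and_card]
  refine ⟨hf.connected, le_antisymm ?_ hf.connected.card_vert_le_card_edgeSet_add_one⟩
  have hsub : (treeOf f).edgeSet ⊆ ((Finset.univ.erase r).image fun v => s(v, f v) : Finset _) := by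
    intro e
    induction e using Sym2.ind with
    | _ u v =>
      intro h
      obtain ⟨hne, h | h⟩ := (SimpleGraph.mem_edgeSet _).1 h
      · rw [Finset.mem_coe, Finset.mem_image]
        refine ⟨u, ?_, by rw [h]⟩
        simp only [Finset.mem_erase, Finset.mem_univ, and_true]
        rintro rfl
        exact hne (((hf.2 u).2 rfl).symm.trans h)
      · rw [Finset.mem_coe, Finset.mem_image]
        refine ⟨v, ?_, by rw [h, Sym2.eq_swap]⟩
        simp only [Finset.mem_erase, Finset.mem_univ, and_true]
        rintro rfl
        exact hne (h.symm.trans ((hf.2 v).2 rfl))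
  have h1 : Nat.card (treeOf f).edgeSet ≤ (Finset.univ.erase r).card := by
    rw [Nat.card_coe_set_eq]
    refine (Set.ncard_le_ncard hsub (Finset.finite_toSet _)).trans ?_
    rw [Set.ncard_coe_finset]
    exact Finset.card_image_le
  rw [Finset.card_erase_of_mem (Finset.mem_univ _), Finset.card_univ] at h1
  rw [Nat.card_eq_fintype_card (α := V)]
  have : 0 < Fintype.card V := Fintype.card_pos_iff.2 ⟨r⟩
  omega

theorem Rooted.dist_iterate [Fintype V] {f : V → V} {r v : V} {N : ℕ} (hf : Rooted f r)
    (h : ∀ i < N, f^[i] v ≠ r) : (treeOf f).dist (f^[N] v) v = N := by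
  refine dist_of_nonbacktracking hf.isTree (x := fun i => f^[i] v) (n := N) ?_ ?_ N le_rfl
  · intro i hi
    simp only [Function.iterate_succ_apply']
    exact hf.adj (h i hi)
  · intro i hi h2
    simp only [Nat.add_comm i 2, Function.iterate_add_apply] at h2
    exact h i (by omega) ((hf.2 _).1 (hf.1 _ 2 (by omega) h2))

theorem Rooted.dist_root [Fintype V] {f : V → V} {r v : V} (hf : Rooted f r) (hv : v ≠ r) :
    (treeOf f).dist v r = (treeOf f).dist (f v) r + 1 := by
  have hex := hf.exists_iterate v
  obtain ⟨N, hN⟩ : ∃ N, Nat.find hex = N + 1 := by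
    refine Nat.exists_eq_succ_of_ne_zero fun h => hv ?_
    have := Nat.find_spec hex
    rwa [h] at this
  have hs := Nat.find_spec hex
  have h1 := hf.dist_iterate (v := v) (N := N + 1) fun i hi => Nat.find_min hex (by omega)
  have h2 := hf.dist_iterate (v := f v) (N := N) fun i hi => by
    rw [← Function.iterate_succ_apply]
    exact Nat.find_min hex (by omega)
  rw [hN] at hs
  rw [← Function.iterate_succ_apply, hs] at h2
  rw [hs] at h1
  rw [SimpleGraph.dist_comm, h1, SimpleGraph.dist_comm, h2]

theorem Rooted.eq_of_treeOf_eq [Fintype V] {f g : V → V} {r : V} (hf : Rooted f r)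
    (hg : Rooted g r) (h : treeOf f = treeOf g) : f = g := by
  funext v
  by_cases hv : v = r
  · rw [(hf.2 v).2 hv, (hg.2 v).2 hv]
  · have h1 := hf.dist_root hv
    have h2 := hg.dist_root hv
    have h3 := hg.adj hv
    rw [← h] at h2 h3
    exact closer_unique hf.isTree (hf.adj hv) h3 (z := r) (by omega) (by omega)

theorem exists_rooted_of_isTree {T : SimpleGraph V} (hT : T.IsTree) (r : V) :
    ∃ f : V → V, Rooted f r ∧ treeOf f = T := by
  have hex : ∀ v, ∃ z, (v = r → z = r) ∧ (v ≠ r → T.Adj v z ∧ T.dist v r = T.dist z r + 1) := by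
    intro v
    by_cases hv : v = r
    · exact ⟨r, fun _ => rfl, fun h => (h hv).elim⟩
    · obtain ⟨d, hd⟩ := Nat.exists_eq_succ_of_ne_zero
        ((hT.1.pos_dist_of_ne hv).ne')
      obtain ⟨z, hz, hzd⟩ := exists_closer hT.1 hd
      exact ⟨z, fun h => (hv h).elim, fun _ => ⟨hz, by rw [hd, hzd]⟩⟩
  choose f hf0 hf1 using hex
  have hle : ∀ v, T.dist (f v) r ≤ T.dist v r := fun v => by
    by_cases hv : v = r
    · rw [hf0 v hv, hv]
    · have := (hf1 v hv).2
      omega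
  have hiter : ∀ j v, T.dist (f^[j] v) r ≤ T.dist v r := by
    intro j v
    induction j with
    | zero => exact le_rfl
    | succ j ih =>
      rw [Function.iterate_succ_apply']
      exact (hle _).trans ih
  refine ⟨f, ⟨?_, fun v => ⟨fun h => ?_, fun h => by rw [hf0 v h, h]⟩⟩, ?_⟩
  · intro v j hj h
    by_cases hv : v = r
    · rw [hf0 v hv, hv]
    · obtain ⟨i, rfl⟩ := Nat.exists_eq_add_of_le' hj
      rw [Function.iterate_succ_apply] at h
      have h1 := hiter i (f v)
      rw [h] at h1
      have := (hf1 v hv).2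
      omega
  · by_contra hv
    have := (hf1 v hv).1
    rw [h] at this
    exact this.ne rfl
  · ext u v
    rw [treeOf_adj]
    constructor
    · rintro ⟨hne, h | h⟩
      · have hu : u ≠ r := fun hu => hne (by rw [← h, hf0 u hu, hu])
        exact h ▸ (hf1 u hu).1
      · have hv : v ≠ r := fun hv => hne (by rw [← h, hf0 v hv, hv])
        exact h ▸ (hf1 v hv).1.symm
    · intro h
      refine ⟨h.ne, ?_⟩
      rcases dist_adj_cases hT h r with hd | hd
      · have hu : u ≠ r := by
          rintro rfl
          rw [SimpleGraph.dist_self] at hd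
          omega
        left
        exact closer_unique hT (hf1 u hu).1 h (z := r) (by have := (hf1 u hu).2; omega) (by omega)
      · have hv : v ≠ r := by
          rintro rfl
          rw [SimpleGraph.dist_self] at hd
          omega
        right
        exact closer_unique hT (hf1 v hv).1 h.symm (z := r) (by have := (hf1 v hv).2; omega) (by omega)

theorem mem_Ext_id_iff_rooted [Fintype V] {f : V → V} : f ∈ Ext id ↔ ∃ r, Rooted f r := by
  rw [mem_Ext_id, Finset.card_eq_one]
  constructor
  · rintro ⟨hf, r, hr⟩
    refine ⟨r, hf, fun v => ?_⟩
    rw [← mem_fixs, hr, Finset.mem_singleton]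
  · rintro ⟨r, hf, hr⟩
    refine ⟨hf, r, ?_⟩
    ext v
    rw [mem_fixs, hr, Finset.mem_singleton]

theorem card_mul_trees_le [Fintype V] (P : SimpleGraph V → Prop) :
    Fintype.card V * ((Finset.univ.filter fun T : SimpleGraph V => T.IsTree ∧ P T).card) ≤
      ((Ext (id : V → V)).filter fun f => P (treeOf f)).card := by
  have hex : ∀ q : V × SimpleGraph V, ∃ f : V → V, q.2.IsTree → Rooted f q.1 ∧ treeOf f = q.2 := by
    intro q
    by_cases hq : q.2.IsTree
    · obtain ⟨f, hf⟩ := exists_rooted_of_isTree hq q.1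
      exact ⟨f, fun _ => hf⟩
    · exact ⟨id, fun h => (hq h).elim⟩
  choose F hF using hex
  rw [← Finset.card_univ (α := V), ← Finset.card_product]
  refine Finset.card_le_card_of_injOn F ?_ ?_
  · intro q hq
    simp only [Finset.coe_product, Finset.coe_univ, Finset.coe_filter, Finset.mem_univ, true_and,
      Set.mem_prod, Set.mem_univ, Set.mem_ofPred_eq] at hq
    obtain ⟨h1, h2⟩ := hF q hq.1
    rw [Finset.mem_coe, Finset.mem_filter, h2]
    exact ⟨mem_Ext_id_iff_rooted.2 ⟨_, h1⟩, hq.2⟩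
  · intro q hq q' hq' h
    simp only [Finset.coe_product, Finset.coe_univ, Finset.coe_filter, Finset.mem_univ, true_and,
      Set.mem_prod, Set.mem_univ, Set.mem_ofPred_eq] at hq hq'
    obtain ⟨h1, h2⟩ := hF q hq.1
    obtain ⟨h1', h2'⟩ := hF q' hq'.1
    refine Prod.ext ?_ ?_
    · rw [← h1'.2, ← h]
      exact (h1.2 _).2 rfl
    · rw [← h2, ← h2', h]

theorem card_Ext_id_le [Fintype V] : (Ext (id : V → V)).card ≤
    Fintype.card V * (Finset.univ.filter fun T : SimpleGraph V => T.IsTree).card := by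
  have hex : ∀ f : V → V, ∃ q : Option V, f ∈ Ext (id : V → V) → ∃ r, q = some r ∧ Rooted f r := by
    intro f
    by_cases hf : f ∈ Ext (id : V → V)
    · obtain ⟨r, hr⟩ := mem_Ext_id_iff_rooted.1 hf
      exact ⟨some r, fun _ => ⟨r, rfl, hr⟩⟩
    · exact ⟨none, fun h => (hf h).elim⟩
  choose F hF using hex
  rw [← Finset.card_univ (α := V), ← Finset.card_product,
    ← Finset.card_map ⟨fun q : V × SimpleGraph V => (some q.1, q.2), fun q q' h => by
      simpa [Prod.ext_iff] using h⟩]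
  refine Finset.card_le_card_of_injOn (fun f => (F f, treeOf f)) ?_ ?_
  · intro f hf
    obtain ⟨r, hr, hfr⟩ := hF f hf
    simp only [Finset.coe_map, Set.mem_image]
    refine ⟨(r, treeOf f), ?_, by rw [hr]; rfl⟩
    simp [hfr.isTree]
  · intro f hf g hg h
    obtain ⟨r, hr, hfr⟩ := hF f hf
    obtain ⟨r', hr', hfr'⟩ := hF g hg
    simp only [Prod.mk.injEq, hr, hr', Option.some.injEq] at h
    obtain ⟨rfl, h⟩ := h
    exact hfr.eq_of_treeOf_eq hfr' h

theorem one_sub_treeProb_le {n : ℕ} (hn : 0 < n) (E : Set (SimpleGraph (Fin n))) :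
    1 - treeProb n E ≤
      (((Ext (id : Fin n → Fin n)).filter fun f => treeOf f ∉ E).card : ℝ) / (n : ℝ) ^ (n - 1) := by
  set t := (Finset.univ.filter fun T : SimpleGraph (Fin n) => T.IsTree).card with ht
  set g := (Finset.univ.filter fun T : SimpleGraph (Fin n) => T.IsTree ∧ T ∈ E).card with hg
  set b := (Finset.univ.filter fun T : SimpleGraph (Fin n) => T.IsTree ∧ T ∉ E).card with hb
  have hp : treeProb n E = (g : ℝ) / t := by
    unfold treeProb
    rw [hg, ht]
    congr 2
    · congr 1
      ext T
      simp [SimpleGraph.isTree_iff, and_assoc]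
    · congr 1
      ext T
      simp [SimpleGraph.isTree_iff]
  have hsum : g + b = t := by
    rw [hg, hb, ht, ← Finset.filter_filter, ← Finset.filter_filter]
    exact Finset.card_filter_add_card_filter_not _
  have : Nonempty (Fin n) := ⟨⟨0, hn⟩⟩
  have h1 : n * b ≤ ((Ext (id : Fin n → Fin n)).filter fun f => treeOf f ∉ E).card := by
    have := card_mul_trees_le (V := Fin n) fun T => T ∉ E
    rw [Fintype.card_fin] at this
    convert this
  have h2 : n ^ (n - 1) ≤ n * t := by
    have := card_Ext_id_le (V := Fin n)
    rw [card_Ext_id, Fintype.card_fin] at this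
    convert this
  have hn1 : 0 < n ^ (n - 1) := Nat.pow_pos hn
  have htpos : 0 < t := Nat.pos_of_ne_zero fun h => by
    rw [h] at h2
    omega
  have htr : (0 : ℝ) < t := by exact_mod_cast htpos
  rw [hp, ← hsum]
  rw [← hsum] at htr
  push_cast at htr ⊢
  rw [one_sub_div htr.ne', add_sub_cancel_left, div_le_div_iff₀ htr (by positivity)]
  have h3 : ((n : ℝ) ^ (n - 1)) ≤ n * (g + b) := by
    rw [← hsum] at h2
    exact_mod_cast h2
  have h4 : (n : ℝ) * b ≤ (((Ext (id : Fin n → Fin n)).filter fun f => treeOf f ∉ E).card : ℝ) := by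
    exact_mod_cast h1
  calc (b : ℝ) * (n : ℝ) ^ (n - 1) ≤ b * (n * (g + b)) := by gcongr
    _ = (n * b) * (g + b) := by ring
    _ ≤ _ := by gcongr

theorem treeProb_le_one {n : ℕ} (E : Set (SimpleGraph (Fin n))) : treeProb n E ≤ 1 := by
  unfold treeProb
  refine div_le_one_of_le₀ ?_ (by positivity)
  exact_mod_cast Finset.card_le_card fun T hT => by
    simp only [Finset.mem_filter, Finset.mem_univ, true_and] at hT ⊢
    exact ⟨hT.1, hT.2.1⟩

end Transfer

end FODef

namespace FODef

section TreeOf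

open scoped Classical

variable {V : Type} [Fintype V] {f : V → V} {r : V}

theorem Rooted.exists_meet (hf : Rooted f r) (d : ℕ) (v u : V) (h : (treeOf f).dist v u ≤ d) :
    ∃ i j, i + j ≤ d ∧ f^[i] v = f^[j] u := by
  induction d generalizing v with
  | zero =>
    have : v = u := (hf.connected.dist_eq_zero_iff).1 (by omega)
    exact ⟨0, 0, le_rfl, this⟩
  | succ d ih =>
    obtain h | h := Nat.lt_or_eq_of_le h
    · obtain ⟨i, j, hij, h'⟩ := ih v (by omega)
      exact ⟨i, j, by omega, h'⟩
    · obtain ⟨z, ⟨_, hz⟩, hzd⟩ := exists_closer hf.connected h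
      obtain ⟨i, j, hij, h'⟩ := ih z hzd.le
      rcases hz with hz | hz
      · exact ⟨i + 1, j, by omega, by rw [Function.iterate_succ_apply, hz, h']⟩
      · obtain _ | i := i
        · refine ⟨0, j + 1, by omega, ?_⟩
          rw [Function.iterate_succ_apply', ← h']
          exact hz.symm
        · refine ⟨i, j, by omega, ?_⟩
          rw [← h', Function.iterate_succ_apply, hz]

theorem Rooted.mem_rch_of_dist_le (hf : Rooted f r) {R : ℕ} {v u : V}
    (h : (treeOf f).dist v u ≤ R) : u ∈ rch (2 * R) f (f^[R] v) := by
  obtain ⟨i, j, hij, h'⟩ := hf.exists_meet R v u h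
  refine mem_rch.2 ⟨R - i + j, by omega, ?_⟩
  rw [Function.iterate_add_apply, ← h', ← Function.iterate_add_apply, Nat.sub_add_cancel (by omega)]

theorem deg_eq_card (G : SimpleGraph V) (v : V) :
    deg G v = (Finset.univ.filter fun w => G.Adj v w).card := by
  rw [deg, Nat.card_eq_fintype_card, Fintype.card_subtype]

theorem Rooted.deg_eq (hf : Rooted f r) {w : V} (hw : w ≠ r) :
    deg (treeOf f) w = indeg f w + 1 := by
  have hnm : f w ∉ Finset.univ.filter fun x => x ≠ w ∧ f x = w := by
    simp only [Finset.mem_filter, Finset.mem_univ, true_and, not_and]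
    intro h1 h2
    exact h1 (hf.1 w 2 (by omega) h2)
  rw [deg_eq_card, indeg, ← Finset.card_insert_of_notMem hnm]
  congr 1
  ext u
  simp only [Finset.mem_filter, Finset.mem_univ, true_and, Finset.mem_insert, treeOf_adj]
  constructor
  · rintro ⟨h1, h2 | h2⟩
    · exact Or.inl h2.symm
    · exact Or.inr ⟨h1.symm, h2⟩
  · rintro (rfl | ⟨h1, h2⟩)
    · exact ⟨fun h => hw ((hf.2 w).1 h.symm), Or.inl rfl⟩
    · exact ⟨h1.symm, Or.inr h2⟩

theorem Rooted.deg_le (hf : Rooted f r) (w : V) : deg (treeOf f) w ≤ indeg f w + 1 := by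
  by_cases hw : w = r
  · rw [deg_eq_card, indeg]
    refine (Finset.card_le_card fun u hu => ?_).trans (Nat.le_succ _)
    simp only [Finset.mem_filter, Finset.mem_univ, true_and, treeOf_adj] at hu ⊢
    obtain ⟨h1, h2 | h2⟩ := hu
    · exact (h1 (((hf.2 w).2 hw).symm.trans h2)).elim
    · exact ⟨h1.symm, h2⟩
  · exact (hf.deg_eq hw).le

omit [Fintype V] in
theorem exists_turn {R : ℕ} {x : ℕ → V}
    (hx : IsGeod (treeOf f) R x) : ∃ c ≤ R, (∀ i < c, f (x i) = x (i + 1)) ∧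
      ∀ i, c ≤ i → i < R → f (x (i + 1)) = x i := by
  have hadj : ∀ i < R, (treeOf f).Adj (x i) (x (i + 1)) := fun i hi => by
    rw [← SimpleGraph.dist_eq_one_iff_adj, hx i (i + 1) (by omega) (by omega)]
    omega
  have hex : ∃ i, R ≤ i ∨ f (x (i + 1)) = x i := ⟨R, Or.inl le_rfl⟩
  refine ⟨Nat.find hex, Nat.find_le (Or.inl le_rfl), fun i hi => ?_, fun i hi hiR => ?_⟩
  · have := Nat.find_min hex hi
    push Not at this
    exact (hadj i this.1).2.resolve_right this.2
  · induction i, hi using Nat.le_induction with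
    | base => exact (Nat.find_spec hex).resolve_left (by omega)
    | succ i hi ih =>
      refine (hadj (i + 1) hiR).2.resolve_left fun h => ?_
      rw [ih (by omega)] at h
      have h2 := hx i (i + 2) (by omega) (by omega)
      rw [h, SimpleGraph.dist_self] at h2
      omega

/-- `z 0, …, z m` climbs towards the root. -/
def Climbs (f : V → V) (m : ℕ) (z : ℕ → V) : Prop :=
  ∀ i ≤ m, f^[i] (z 0) = z i ∧ (i < m → f (z i) ≠ z i)

omit [Fintype V] in
theorem climbs_of_step {m : ℕ} {z : ℕ → V}
    (h : ∀ i < m, f (z i) = z (i + 1)) (hne : ∀ i < m, z i ≠ z (i + 1)) : Climbs f m z := by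
  intro i hi
  have : f^[i] (z 0) = z i := by
    clear hne
    induction i with
    | zero => rfl
    | succ i ih => rw [Function.iterate_succ_apply', ih (by omega), h i (by omega)]
  exact ⟨this, fun hi' => by rw [h i hi']; exact (hne i hi').symm⟩

omit [Fintype V] in
theorem climbs_window {R : ℕ} {x : ℕ → V}
    (hx : IsGeod (treeOf f) R x) : ∃ c ≤ R, ∀ l m, l + m ≤ R →
      (l + m ≤ c → Climbs f m fun i => x (l + i)) ∧
      (c ≤ l → Climbs f m fun i => x (l + (m - i))) := by
  obtain ⟨c, hc, h1, h2⟩ := exists_turn hx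
  have hne : ∀ i < R, x i ≠ x (i + 1) := fun i hi h => by
    have h3 := hx i (i + 1) (by omega) (by omega)
    rw [h, SimpleGraph.dist_self] at h3
    omega
  refine ⟨c, hc, fun l m hlm => ⟨fun h => climbs_of_step (fun i hi => ?_) fun i hi => ?_,
    fun h => climbs_of_step (fun i hi => ?_) fun i hi => ?_⟩⟩
  · exact h1 (l + i) (by omega)
  · exact hne (l + i) (by omega)
  · have := h2 (l + (m - (i + 1))) (by omega) (by omega)
    rwa [show l + (m - (i + 1)) + 1 = l + (m - i) by omega] at this
  · have := hne (l + (m - (i + 1))) (by omega)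
    rw [show l + (m - (i + 1)) + 1 = l + (m - i) by omega] at this
    exact this.symm

theorem Rooted.chainMatch (hf : Rooted f r) {m : ℕ} {z z' : ℕ → V} {σ : ℕ → ℕ}
    (hz : Climbs f m z) (hz' : Climbs f m z') (hσ : ∀ i, 1 ≤ i → i < m → σ i < m)
    (h : ∀ i, 1 ≤ i → i < m →
      z i ≠ z' (σ i) ∧ deg (treeOf f) (z i) = deg (treeOf f) (z' (σ i))) :
    ChainMatch m (z 0) (z' 0) σ f := by
  refine ⟨fun i hi => ?_, fun i hi him => ?_⟩
  · rw [(hz i hi.le).1, (hz' i hi.le).1]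
    exact ⟨(hz i hi.le).2 hi, (hz' i hi.le).2 hi⟩
  · have hs := hσ i hi him
    rw [(hz i him.le).1, (hz' _ hs.le).1]
    obtain ⟨h1, h2⟩ := h i hi him
    refine ⟨h1, ?_⟩
    rw [hf.deg_eq fun h => (hz i him.le).2 him ((hf.2 _).2 h),
      hf.deg_eq fun h => (hz' _ hs.le).2 hs ((hf.2 _).2 h)] at h2
    omega

theorem Rooted.geodRigid (hf : Rooted f r) {m : ℕ} (h₁ : ∀ a b, ¬ ChainMatch m a b id f)
    (h₂ : ∀ a b, ¬ ChainMatch m a b (fun i => m - i) f) : GeodRigid (treeOf f) (3 * m) := by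
  intro x y hx hy
  by_contra! hcon
  obtain ⟨c, hc, hxc⟩ := climbs_window hx
  obtain ⟨c', hc', hyc⟩ := climbs_window hy
  obtain ⟨l, hl, hlc, hlc'⟩ : ∃ l, l + m ≤ 3 * m ∧ (l + m ≤ c ∨ c ≤ l) ∧ (l + m ≤ c' ∨ c' ≤ l) := by
    by_cases h0 : (m ≤ c ∨ c ≤ 0) ∧ (m ≤ c' ∨ c' ≤ 0)
    · exact ⟨0, by omega, by omega, by omega⟩
    by_cases h1 : (m + m ≤ c ∨ c ≤ m) ∧ (m + m ≤ c' ∨ c' ≤ m)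
    · exact ⟨m, by omega, by omega, by omega⟩
    exact ⟨2 * m, by omega, by omega, by omega⟩
  rcases hlc with hlc | hlc <;> rcases hlc' with hlc' | hlc'
  · exact h₁ _ _ (hf.chainMatch ((hxc l m hl).1 hlc) ((hyc l m hl).1 hlc') (fun i _ h => h)
      fun i _ hi => hcon (l + i) (by omega))
  · refine h₂ _ _ (hf.chainMatch ((hxc l m hl).1 hlc) ((hyc l m hl).2 hlc')
      (fun i _ h => by omega) fun i _ hi => ?_)
    have := hcon (l + i) (by omega)
    simpa only [show m - (m - i) = i by omega] using this
  · refine h₂ _ _ (hf.chainMatch ((hyc l m hl).1 hlc') ((hxc l m hl).2 hlc)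
      (fun i _ h => by omega) fun i _ hi => ?_)
    have := hcon (l + i) (by omega)
    simp only [show m - (m - i) = i by omega]
    exact ⟨this.1.symm, this.2.symm⟩
  · exact h₁ _ _ (hf.chainMatch ((hxc l m hl).2 hlc) ((hyc l m hl).2 hlc') (fun i _ h => h)
      fun i _ hi => hcon (l + (m - i)) (by omega))

end TreeOf

end FODef

namespace FODef

section Main

open scoped Classical

variable {V : Type} [Fintype V] {f : V → V} {r : V}

theorem rch_mono {R R' : ℕ} (h : R ≤ R') (f : V → V) (v : V) : rch R f v ⊆ rch R' f v := by
  intro u hu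
  obtain ⟨i, hi, hiv⟩ := mem_rch.1 hu
  exact mem_rch.2 ⟨i, hi.trans h, hiv⟩

theorem Rooted.exists_dist_eq (hf : Rooted f r) {R : ℕ}
    (h : ∀ v, (rch (2 * R) f v).card < Fintype.card V) : ∃ y z, (treeOf f).dist y z = R := by
  by_contra! hcon
  have hle : ∀ u, (treeOf f).dist r u ≤ R := fun u => by
    by_contra! hu
    obtain ⟨q, hq⟩ := Nat.exists_eq_add_of_lt hu
    obtain ⟨z, hz, -⟩ := exists_between hf.connected (p := R) (q := q + 1) (x := r) (y := u)
      (by omega)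
    exact hcon r z hz
  have : rch (2 * R) f (f^[R] r) = Finset.univ :=
    Finset.eq_univ_iff_forall.2 fun u => hf.mem_rch_of_dist_le (hle u)
  have h2 := h (f^[R] r)
  rw [this, Finset.card_univ] at h2
  exact lt_irrefl _ h2

theorem Rooted.deg_le_of_indeg (hf : Rooted f r) {R s d : ℕ} (hs : 1 ≤ s)
    (h : ∀ v, ¬ ∃ Y ⊆ rch R f v, Y.card ≤ s ∧ d ≤ ∑ w ∈ Y, indeg f w) (v : V) :
    deg (treeOf f) v ≤ d := by
  by_contra! hv
  refine h v ⟨{v}, ?_, by simpa using hs, ?_⟩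
  · rw [Finset.singleton_subset_iff]
    exact mem_rch.2 ⟨0, by omega, rfl⟩
  · rw [Finset.sum_singleton]
    have := hf.deg_le v
    omega

theorem Rooted.iso_of_BF {W : Type} {H : SimpleGraph W} (hf : Rooted f r) {m j s d k : ℕ}
    (hm : 1 ≤ m) (hmj : 3 * m ≤ 2 ^ j)
    (h₁ : ∀ v, (rch (4 * (3 * m)) f v).card < 2 ^ s)
    (h₂ : ∀ v, (rch (4 * (3 * m)) f v).card < Fintype.card V)
    (h₃ : ∀ v, ¬ ∃ Y ⊆ rch (4 * (3 * m)) f v, Y.card ≤ s ∧ d ≤ ∑ w ∈ Y, indeg f w)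
    (h₄ : ∀ a b, ¬ ChainMatch m a b id f)
    (h₅ : ∀ a b, ¬ ChainMatch m a b (fun i => m - i) f)
    (hk : d + 5 * s + 2 * j + 12 ≤ k) (h : BF (treeOf f) H k ∅) : Nonempty (treeOf f ≃g H) := by
  have hsub : ∀ v u, (treeOf f).dist v u ≤ 3 * m → u ∈ rch (4 * (3 * m)) f (f^[3 * m] v) :=
    fun v u hu => rch_mono (by omega) f _ (hf.mem_rch_of_dist_le hu)
  refine FODef.iso_of_BF hf.isTree (R := 3 * m) (j := j) (s := s) (B := d + s) (by omega) hmj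
    (fun v => ?_) (fun v Z hZ hZs => ?_) (hf.geodRigid h₄ h₅) ?_ (by omega) h
  · refine lt_of_le_of_lt ?_ (h₁ (f^[3 * m] v))
    rw [← Set.ncard_coe_finset]
    exact Set.ncard_le_ncard (fun u hu => hsub v u hu) (Finset.finite_toSet _)
  · have hlt : ∑ w ∈ Z, indeg f w < d := by
      by_contra! hge
      exact h₃ _ ⟨Z, fun z hz => hsub v z (hZ z hz), hZs, hge⟩
    have hle : ∑ z ∈ Z, deg (treeOf f) z ≤ ∑ z ∈ Z, (indeg f z + 1) :=
      Finset.sum_le_sum fun z _ => hf.deg_le z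
    rw [Finset.sum_add_distrib, Finset.sum_const, smul_eq_mul, mul_one] at hle
    omega
  · refine hf.exists_dist_eq fun v => ?_
    rw [show 2 * (2 * (3 * m)) = 4 * (3 * m) by ring]
    exact h₂ v

theorem deg_le_maxDeg (G : SimpleGraph V) (v : V) : deg G v ≤ maxDeg G :=
  Finset.le_sup (f := fun v => deg G v) (Finset.mem_univ v)

omit [Fintype V] in
theorem Star.adj_iff {v : V} {S : Finset V} (h : Star f v S) {u : V} (hu : u ∈ S) (w : V) :
    (treeOf f).Adj u w ↔ w = v := by
  obtain ⟨hne, huv⟩ := (h.1 u).1 hu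
  rw [treeOf_adj]
  constructor
  · rintro ⟨-, h1 | h1⟩
    · exact h1.symm.trans huv
    · exact (h.2 w (h1 ▸ hu)).elim
  · rintro rfl
    exact ⟨hne, Or.inl huv⟩

theorem Star.card_le_maxDeg {v : V} {S : Finset V} (h : Star f v S) :
    S.card ≤ maxDeg (treeOf f) := by
  refine le_trans ?_ (deg_le_maxDeg _ v)
  rw [deg_eq_card]
  refine Finset.card_le_card fun u hu => ?_
  simp only [Finset.mem_filter, Finset.mem_univ, true_and]
  exact ((h.adj_iff hu v).2 rfl).symm

theorem Star.card_le_D {v : V} {S : Finset V} (h : Star f v S)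
    (hφ : ∃ φ, Defines (treeOf f) φ) : S.card ≤ D (treeOf f) :=
  le_D_of_leaves _ v S (fun _ hu w => h.adj_iff hu w) (fun hv => ((h.1 v).1 hv).1 rfl) hφ

/-- The trees whose definition depth and maximum degree lie in the given ranges. -/
def goodTrees (V : Type) [Fintype V] (k d K : ℕ) : Set (SimpleGraph V) :=
  {T | k ≤ D T ∧ D T ≤ K ∧ k ≤ maxDeg T ∧ maxDeg T ≤ d}

theorem treeOf_mem_goodTrees (hf : Rooted f r)
    {m j s d k : ℕ} (hm : 1 ≤ m) (hmj : 3 * m ≤ 2 ^ j) (hs : 1 ≤ s)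
    (h₁ : ∀ v, (rch (4 * (3 * m)) f v).card < 2 ^ s)
    (h₂ : ∀ v, (rch (4 * (3 * m)) f v).card < Fintype.card V)
    (h₃ : ∀ v, ¬ ∃ Y ⊆ rch (4 * (3 * m)) f v, Y.card ≤ s ∧ d ≤ ∑ w ∈ Y, indeg f w)
    (h₄ : ∀ a b, ¬ ChainMatch m a b id f)
    (h₅ : ∀ a b, ¬ ChainMatch m a b (fun i => m - i) f)
    (h₆ : ∃ v S, S.card = k ∧ Star f v S) :
    treeOf f ∈ goodTrees V k d (d + 5 * s + 2 * j + 12) := by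
  obtain ⟨v, S, rfl, hS⟩ := h₆
  have : Nonempty V := ⟨r⟩
  have hiso : ∀ (M : ℕ) (H : SimpleGraph (Fin M)), BF (treeOf f) H (d + 5 * s + 2 * j + 12) ∅ →
      Nonempty (treeOf f ≃g H) := fun M H h =>
    hf.iso_of_BF hm hmj h₁ h₂ h₃ h₄ h₅ le_rfl h
  obtain ⟨φ, -, hφ⟩ := exists_defines (treeOf f) (by omega) hiso
  exact ⟨hS.card_le_D ⟨φ, hφ⟩, D_le_of_BF (treeOf f) (by omega) hiso, hS.card_le_maxDeg,
    Finset.sup_le fun w _ => hf.deg_le_of_indeg hs h₃ w⟩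

set_option maxHeartbeats 2000000 in
theorem card_not_goodTrees_le {n k l p S s j d : ℕ} {x : ℝ} (hx : 1 ≤ x) (hs : 1 ≤ s)
    (hV : Fintype.card V = n) (hn : n = l + k + 1) (hk : 1 ≤ k) (hl : k + 1 ≤ l) (hp : 12 * p + 6 ≤ n)
    (hj : 3 * (3 * p + 1) ≤ 2 ^ j)
    (hMs : 4 * ((4 * (3 * (3 * p + 1)) + 1) * (1 + S * (4 * (3 * (3 * p + 1))))) ≤ 2 ^ s)
    (hMn : 4 * ((4 * (3 * (3 * p + 1)) + 1) * (1 + S * (4 * (3 * (3 * p + 1))))) ≤ n) :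
    (((Ext (id : V → V)).filter fun f =>
      treeOf f ∉ goodTrees V k d (d + 5 * s + 2 * j + 12)).card : ℝ) / (n : ℝ) ^ (n - 1) ≤
      (n : ℝ) * (1 / 4 ^ S) +
      n * ((((4 * (3 * (3 * p + 1)) : ℕ) + 1 : ℝ) * (1 + s * (4 * (3 * (3 * p + 1)) : ℕ))) ^ s *
        (x ^ (s * s) * Real.exp (s * x)) / x ^ d) +
      n * (n * (2 * ((1 + Real.exp (-2)) / 2) ^ p)) +
      (Real.exp (2 * k * (k + 1) / l) - 1 + k ^ k * Real.exp (2 * (k + 1)) / n) := by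
  set m := 3 * p + 1 with hm
  have hn0 : 0 < n := by omega
  have : Nonempty V := Fintype.card_pos_iff.1 (by omega)
  have hn0' : (0 : ℝ) < (n : ℝ) ^ (n - 1) := by positivity
  have hA := fun v : V => card_large_rch_le (4 * (3 * m)) S v
  have hB := fun v : V => card_large_indeg_le hx (4 * (3 * m)) s d v
  have hC := fun a b : V => card_chainMatch_le p a b (σ := id) (fun _ _ h => h)
    (fun _ _ _ _ _ _ h => h) (by omega)
  have hC' := fun a b : V => card_chainMatch_le p a b (σ := fun i => m - i)
    (fun i h1 h2 => by omega) (fun i i' _ _ _ _ h => by omega) (by omega)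
  have hN := card_no_star_le (V := V) hk hl (by omega)
  simp only [hV] at hA hB hC hC' hN
  rw [← hm] at hC hC'
  rw [div_le_iff₀ hn0'] at hN
  rw [div_le_iff₀ hn0']
  set A := fun v : V => (Ext (id : V → V)).filter fun f =>
    4 * ((4 * (3 * m) + 1) * (1 + S * (4 * (3 * m)))) ≤ (rch (4 * (3 * m)) f v).card with hAd
  set B := fun v : V => (Ext (id : V → V)).filter fun f =>
    ∃ Y ⊆ rch (4 * (3 * m)) f v, Y.card ≤ s ∧ d ≤ ∑ w ∈ Y, indeg f w with hBd
  set C := fun a b : V => (Ext (id : V → V)).filter fun f => ChainMatch m a b id f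
    with hCd
  set C' := fun a b : V => (Ext (id : V → V)).filter fun f =>
    ChainMatch m a b (fun i => m - i) f with hCd'
  set N := (Ext (id : V → V)).filter fun f => ¬ ∃ v S, S.card = k ∧ Star f v S with hNd
  have hsub : ((Ext (id : V → V)).filter fun f =>
      treeOf f ∉ goodTrees V k d (d + 5 * s + 2 * j + 12)) ⊆
      Finset.univ.biUnion A ∪ Finset.univ.biUnion B ∪
        (Finset.univ.biUnion fun a => Finset.univ.biUnion fun b => C a b ∪ C' a b) ∪ N := by
    intro f hf
    obtain ⟨hfE, hbad⟩ := Finset.mem_filter.1 hf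
    by_contra hcon
    simp only [Finset.mem_union, Finset.mem_biUnion, Finset.mem_univ, true_and, hAd, hBd, hCd,
      hCd', hNd, Finset.mem_filter, hfE, not_or, not_exists, not_le] at hcon
    obtain ⟨⟨⟨h1, h2⟩, h3⟩, h4⟩ := hcon
    obtain ⟨r, hr⟩ := mem_Ext_id_iff_rooted.1 hfE
    refine hbad (treeOf_mem_goodTrees hr (m := m) (by omega) hj hs (fun v => (h1 v).trans_le hMs)
      (fun v => (h1 v).trans_le (hMn.trans hV.ge)) (fun v h => ?_) (fun a b => (h3 a b).1)
      (fun a b => (h3 a b).2) ?_)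
    · obtain ⟨Y, hY⟩ := h
      exact h2 v Y hY
    · by_contra h
      exact h4 fun v S hS => h ⟨v, S, hS⟩
  clear_value m
  have hA1 : ∀ v, ((A v).card : ℝ) ≤ (n : ℝ) ^ (n - 1) / 4 ^ S := hA
  have hB1 : ∀ v, ((B v).card : ℝ) ≤
      (((4 * (3 * m) : ℕ) + 1 : ℝ) * (1 + s * (4 * (3 * m) : ℕ))) ^ s *
        (x ^ (s * s) * Real.exp (s * x)) / x ^ d * (n : ℝ) ^ (n - 1) := by
    intro v
    convert hB v
  have hC1 : ∀ a b, ((C a b).card : ℝ) ≤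
      ((1 + Real.exp (-2)) / 2) ^ p * (n : ℝ) ^ (n - 1) := hC
  have hC2 : ∀ a b, ((C' a b).card : ℝ) ≤
      ((1 + Real.exp (-2)) / 2) ^ p * (n : ℝ) ^ (n - 1) := hC'
  clear_value A B C C' N
  have hcard : (((Ext (id : V → V)).filter fun f =>
      treeOf f ∉ goodTrees V k d (d + 5 * s + 2 * j + 12)).card : ℝ) ≤
      ∑ v, ((A v).card : ℝ) + ∑ v, ((B v).card : ℝ) +
        ∑ a, ∑ b, (((C a b).card : ℝ) + ((C' a b).card : ℝ)) + (N.card : ℝ) := by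
    have h := Finset.card_le_card hsub
    have h1 := (Finset.card_union_le _ N).trans' h
    have h2 : (Finset.univ.biUnion A ∪ Finset.univ.biUnion B ∪
        (Finset.univ.biUnion fun a => Finset.univ.biUnion fun b => C a b ∪ C' a b)).card ≤
        ∑ v, (A v).card + ∑ v, (B v).card + ∑ a, ∑ b, ((C a b).card + (C' a b).card) := by
      refine (Finset.card_union_le _ _).trans (add_le_add ((Finset.card_union_le _ _).trans
        (add_le_add Finset.card_biUnion_le Finset.card_biUnion_le)) ?_)
      refine Finset.card_biUnion_le.trans (Finset.sum_le_sum fun a _ => ?_)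
      exact Finset.card_biUnion_le.trans (Finset.sum_le_sum fun b _ => Finset.card_union_le _ _)
    exact_mod_cast h1.trans (add_le_add_left h2 _)
  refine hcard.trans ?_
  rw [add_mul, add_mul, add_mul]
  refine add_le_add (add_le_add (add_le_add ?_ ?_) ?_) hN
  · refine (Finset.sum_le_card_nsmul _ _ _ fun v _ => hA1 v).trans (le_of_eq ?_)
    rw [Finset.card_univ, hV, nsmul_eq_mul]
    ring
  · refine (Finset.sum_le_card_nsmul _ _ _ fun v _ => hB1 v).trans (le_of_eq ?_)
    rw [Finset.card_univ, hV, nsmul_eq_mul, mul_assoc]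
  · refine (Finset.sum_le_card_nsmul _ _ _ fun a _ => Finset.sum_le_card_nsmul _ _ _ fun b _ =>
      add_le_add (hC1 a b) (hC2 a b)).trans (le_of_eq ?_)
    simp only [Finset.card_univ, hV, nsmul_eq_mul]
    ring

theorem one_sub_treeProb_goodTrees_le {n k l p S s j d : ℕ} {x : ℝ} (hx : 1 ≤ x) (hs : 1 ≤ s)
    (hn : n = l + k + 1) (hk : 1 ≤ k) (hl : k + 1 ≤ l) (hp : 12 * p + 6 ≤ n)
    (hj : 3 * (3 * p + 1) ≤ 2 ^ j)
    (hMs : 4 * ((4 * (3 * (3 * p + 1)) + 1) * (1 + S * (4 * (3 * (3 * p + 1))))) ≤ 2 ^ s)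
    (hMn : 4 * ((4 * (3 * (3 * p + 1)) + 1) * (1 + S * (4 * (3 * (3 * p + 1))))) ≤ n) :
    1 - treeProb n (goodTrees (Fin n) k d (d + 5 * s + 2 * j + 12)) ≤
      (n : ℝ) * (1 / 4 ^ S) +
      n * ((((4 * (3 * (3 * p + 1)) : ℕ) + 1 : ℝ) * (1 + s * (4 * (3 * (3 * p + 1)) : ℕ))) ^ s *
        (x ^ (s * s) * Real.exp (s * x)) / x ^ d) +
      n * (n * (2 * ((1 + Real.exp (-2)) / 2) ^ p)) +
      (Real.exp (2 * k * (k + 1) / l) - 1 + k ^ k * Real.exp (2 * (k + 1)) / n) := by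
  have h := card_not_goodTrees_le (V := Fin n) (d := d) hx hs (Fintype.card_fin n) hn hk hl hp hj
    hMs hMn
  refine le_trans ?_ h
  convert one_sub_treeProb_le (show 0 < n by omega) _

end Main

end FODef

namespace FODef

section Asymptotics

open Real

theorem parameter_bounds {n S r M s : ℕ} {X : ℝ} (hn : (n : ℝ) = exp X) (hX : 10000 ≤ X)
    (hy : 2 ≤ log X) (hS : S = Nat.log 2 n + 1) (hr : r = 4 * (3 * (3 * (10 * S) + 1)))
    (hM : M = 4 * ((r + 1) * (1 + S * r))) (hs : s = Nat.log 2 M + 1) :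
    n < 2 ^ S ∧ M ≤ 2 ^ s ∧ M ≤ n ∧ (s : ℝ) ≤ 10 * log X ∧
      ((r : ℝ) + 1) * (1 + s * r) ≤ X ^ 6 ∧ X ^ 6 ≤ n := by
  have hX0 : 0 < X := by linarith
  have hn0 : n ≠ 0 := by
    rintro rfl
    have := exp_pos X
    rw [← hn] at this
    simp at this
  have hl2 : (2 : ℝ) / 3 ≤ log 2 := by
    have := Real.log_two_gt_d9
    linarith
  have hS2 : (S : ℝ) ≤ 3 * X := by
    have h1 : (2 : ℝ) ^ (Nat.log 2 n) ≤ exp X := by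
      rw [← hn]
      exact_mod_cast Nat.pow_log_le_self 2 hn0
    have h2 : (Nat.log 2 n : ℝ) * log 2 ≤ X := by
      have := Real.log_le_log (by positivity) h1
      rwa [Real.log_exp, Real.log_pow] at this
    have h3 : (0 : ℝ) ≤ Nat.log 2 n := by positivity
    rw [hS]
    push_cast
    nlinarith
  have hS0 : (0 : ℝ) ≤ S := by positivity
  have hrS : (r : ℝ) = 360 * S + 12 := by
    rw [hr]
    push_cast
    ring
  have hr1 : (r : ℝ) ≤ 1092 * X := by linarith
  have hr0 : (0 : ℝ) ≤ r := by positivity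
  have hr2 : (r : ℝ) + 1 ≤ X ^ 2 := by nlinarith
  have hXn : X ^ 6 ≤ n := by
    rw [hn]
    have h1 := Real.pow_div_factorial_le_exp X hX0.le 7
    refine le_trans ?_ h1
    rw [le_div_iff₀ (by positivity)]
    norm_num [Nat.factorial]
    have : 0 ≤ X ^ 6 := by positivity
    nlinarith
  have hMX : (M : ℝ) ≤ X ^ 6 := by
    have h1 : (1 : ℝ) + S * r ≤ 2 * X ^ 3 := by
      have : (S : ℝ) * r ≤ 3 * X * (1092 * X) := by gcongr
      nlinarith [sq_nonneg X]
    have h2 : ((r : ℝ) + 1) * (1 + S * r) ≤ X ^ 2 * (2 * X ^ 3) := by gcongr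
    rw [hM]
    push_cast
    have : 0 ≤ X ^ 5 := by positivity
    nlinarith
  have hM0 : M ≠ 0 := by
    rw [hM]
    positivity
  have hs2 : (s : ℝ) ≤ 10 * log X := by
    have h1 : (2 : ℝ) ^ (Nat.log 2 M) ≤ X ^ 6 := by
      refine le_trans ?_ hMX
      exact_mod_cast Nat.pow_log_le_self 2 hM0
    have h2 : (Nat.log 2 M : ℝ) * log 2 ≤ 6 * log X := by
      have := Real.log_le_log (by positivity) h1
      rwa [Real.log_pow, Real.log_pow] at this
    have h3 : (0 : ℝ) ≤ Nat.log 2 M := by positivity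
    rw [hs]
    push_cast
    nlinarith
  refine ⟨hS ▸ Nat.lt_pow_succ_log_self one_lt_two n,
    hs ▸ (Nat.lt_pow_succ_log_self one_lt_two M).le, ?_, hs2, ?_, hXn⟩
  · exact_mod_cast hMX.trans hXn
  · have hlX : log X ≤ X := (Real.log_le_sub_one_of_pos hX0).trans (by linarith)
    have h1 : (1 : ℝ) + s * r ≤ X ^ 4 := by
      have h2 : (s : ℝ) * r ≤ 10 * X * (1092 * X) := by
        gcongr
        linarith
      have h3 : (1 : ℝ) + s * r ≤ 10921 * X ^ 2 := by nlinarith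
      have h4 : 10921 ≤ X ^ 2 := by nlinarith
      have h5 : 0 ≤ X ^ 2 := by positivity
      nlinarith
    calc ((r : ℝ) + 1) * (1 + s * r) ≤ X ^ 2 * X ^ 4 := by gcongr
      _ = X ^ 6 := by ring

theorem chain_prob_le {n S : ℕ} (hn : 0 < n) (hS : n < 2 ^ S) :
    (n : ℝ) * (n * (2 * ((1 + exp (-2)) / 2) ^ (10 * S))) ≤ 2 / n := by
  have he : exp (-2) ≤ 1 / 3 := by
    rw [Real.exp_neg, inv_eq_one_div]
    refine one_div_le_one_div_of_le (by norm_num) ?_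
    have := Real.add_one_le_exp (2 : ℝ)
    linarith
  have h0 : 0 ≤ exp (-2) := (exp_pos _).le
  have h1 : ((1 + exp (-2)) / 2) ^ 10 ≤ (1 / 2) ^ 3 := by
    calc ((1 + exp (-2)) / 2) ^ 10 ≤ (2 / 3 : ℝ) ^ 10 :=
          pow_le_pow_left₀ (by positivity) (by linarith) 10
      _ ≤ _ := by norm_num
  have h2 : ((1 + exp (-2)) / 2) ^ (10 * S) ≤ 1 / (n : ℝ) ^ 3 := by
    calc ((1 + exp (-2)) / 2) ^ (10 * S) = (((1 + exp (-2)) / 2) ^ 10) ^ S := by rw [pow_mul]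
      _ ≤ ((1 / 2) ^ 3) ^ S := by gcongr
      _ = 1 / ((2 : ℝ) ^ S) ^ 3 := by
        rw [← pow_mul, mul_comm 3 S, pow_mul, one_div_pow, one_div_pow]
      _ ≤ 1 / (n : ℝ) ^ 3 := by
        have : (n : ℝ) ≤ 2 ^ S := by exact_mod_cast hS.le
        gcongr
  have hn' : (0 : ℝ) < n := by exact_mod_cast hn
  calc (n : ℝ) * (n * (2 * ((1 + exp (-2)) / 2) ^ (10 * S))) ≤ n * (n * (2 * (1 / (n : ℝ) ^ 3))) := by
        gcongr
    _ = 2 / n := by field_simp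

theorem rch_prob_le {n S : ℕ} (hn : 0 < n) (hS : n < 2 ^ S) :
    (n : ℝ) * (1 / 4 ^ S) ≤ 1 / n := by
  have hn' : (0 : ℝ) < n := by exact_mod_cast hn
  have h : (n : ℝ) ^ 2 ≤ 4 ^ S := by
    calc (n : ℝ) ^ 2 ≤ (2 ^ S) ^ 2 := by
          gcongr
          exact_mod_cast hS.le
      _ = 4 ^ S := by
        rw [← pow_mul, mul_comm, pow_mul]
        norm_num
  calc (n : ℝ) * (1 / 4 ^ S) ≤ n * (1 / (n : ℝ) ^ 2) := by gcongr
    _ = 1 / n := by field_simp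

theorem indeg_prob_le {e X y W x : ℝ} {n s d : ℕ} (he : 0 < e) (he1 : e ≤ 1 / 2)
    (hn : (n : ℝ) = exp X) (hX : 0 < X) (hXy : X = exp y) (hy : 2 ≤ y) (hs : (s : ℝ) ≤ 10 * y)
    (hW0 : 0 ≤ W) (hW : W ≤ X ^ 6) (hx : x = exp ((1 - e / 4) * y))
    (hd : (1 + e / 2) * (X / y) ≤ d) :
    n * (W ^ s * (x ^ (s * s) * exp (s * x)) / x ^ d) ≤
      exp (-(e / 8) * exp y + 60 * y ^ 2 + 100 * y ^ 3 + 10 * y * exp ((1 - e / 4) * y)) := by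
  have hs0 : (0 : ℝ) ≤ s := by positivity
  have hc : 0 ≤ 1 - e / 4 := by linarith
  have hc1 : 1 - e / 4 ≤ 1 := by linarith
  have hx0 : 0 < x := by rw [hx]; positivity
  have h1 : W ^ s ≤ exp (60 * y ^ 2) := by
    calc W ^ s ≤ (X ^ 6) ^ s := by gcongr
      _ = exp (s * (6 * y)) := by
        rw [hXy, ← Real.exp_nat_mul, ← Real.exp_nat_mul]
        norm_num
      _ ≤ exp (60 * y ^ 2) := by
        rw [Real.exp_le_exp]
        nlinarith
  have h2 : x ^ (s * s) ≤ exp (100 * y ^ 3) := by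
    rw [hx, ← Real.exp_nat_mul, Real.exp_le_exp]
    push_cast
    have hss : (s : ℝ) * s ≤ 10 * y * (10 * y) := by gcongr
    have hcy : (1 - e / 4) * y ≤ y := by nlinarith
    calc (s : ℝ) * s * ((1 - e / 4) * y) ≤ 10 * y * (10 * y) * y := by gcongr
      _ = 100 * y ^ 3 := by ring
  have h3 : exp (s * x) ≤ exp (10 * y * x) := by
    rw [Real.exp_le_exp]
    gcongr
  have h4 : exp ((1 + e / 8) * X) ≤ x ^ d := by
    rw [hx, ← Real.exp_nat_mul, Real.exp_le_exp]
    have : (1 + e / 2) * (X / y) * ((1 - e / 4) * y) ≤ d * ((1 - e / 4) * y) := by gcongr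
    refine le_trans ?_ this
    have hy0 : y ≠ 0 := by linarith
    have : (1 + e / 2) * (X / y) * ((1 - e / 4) * y) = (1 + e / 2) * (1 - e / 4) * X := by
      field_simp
    rw [this]
    refine mul_le_mul_of_nonneg_right ?_ hX.le
    nlinarith
  calc n * (W ^ s * (x ^ (s * s) * exp (s * x)) / x ^ d)
      ≤ exp X * (exp (60 * y ^ 2) * (exp (100 * y ^ 3) * exp (10 * y * x)) /
          exp ((1 + e / 8) * X)) := by
        rw [hn]
        gcongr
    _ = exp (-(e / 8) * exp y + 60 * y ^ 2 + 100 * y ^ 3 + 10 * y * exp ((1 - e / 4) * y)) := by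
      rw [← Real.exp_add, ← Real.exp_add, ← Real.exp_sub, ← Real.exp_add, ← hx, ← hXy]
      congr 1
      ring

theorem star_prob_le {e X y : ℝ} {n k l : ℕ} (he : 0 < e)
    (hn : (n : ℝ) = exp X) (hX : 0 < X) (hXy : X = exp y) (hy : 2 ≤ y)
    (hl : (n : ℝ) ≤ 2 * l) (hk : (k : ℝ) ≤ (1 - e) * (X / y) + 1) (hkX : (k : ℝ) ≤ X) :
    exp (2 * k * (k + 1) / l) - 1 + k ^ k * exp (2 * (k + 1)) / n ≤
      exp (4 * X * (X + 1) * exp (-X)) - 1 +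
        exp (-e * exp y + y + 2 * (exp y / y) + 4) := by
  have hn0 : (0 : ℝ) < n := hn ▸ exp_pos X
  have hk0 : (0 : ℝ) ≤ k := by positivity
  have h1 : 2 * (k : ℝ) * (k + 1) / l ≤ 4 * X * (X + 1) * exp (-X) := by
    calc 2 * (k : ℝ) * (k + 1) / l ≤ 2 * X * (X + 1) / (n / 2) := by
          gcongr
          linarith
      _ = 4 * X * (X + 1) * exp (-X) := by
        rw [hn, Real.exp_neg]
        field_simp
        ring
  have h2 : (k : ℝ) ^ k * exp (2 * (k + 1)) / n ≤
      exp (-e * exp y + y + 2 * (exp y / y) + 4) := by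
    have hXy0 : 0 ≤ X / y := by positivity
    calc (k : ℝ) ^ k * exp (2 * (k + 1)) / n ≤ X ^ k * exp (2 * (k + 1)) / n := by gcongr
      _ = exp (k * y + 2 * (k + 1) - X) := by
        nth_rewrite 1 [hXy]
        rw [← Real.exp_nat_mul, hn, ← Real.exp_add, ← Real.exp_sub]
      _ ≤ _ := by
        rw [Real.exp_le_exp, ← hXy]
        have h3 : (k : ℝ) * y ≤ ((1 - e) * (X / y) + 1) * y := by gcongr
        have h4 : ((1 - e) * (X / y) + 1) * y = (1 - e) * X + y := by
          have : y ≠ 0 := by linarith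
          field_simp
        have h5 : (k : ℝ) ≤ X / y + 1 := by nlinarith
        linarith
  have h3 := Real.exp_le_exp.2 h1
  linarith

theorem exists_goodTrees_bound {e X y : ℝ} {n : ℕ} (he : 0 < e) (he1 : e ≤ 1 / 2)
    (hn : (n : ℝ) = exp X) (hXy : X = exp y) (hX : 10000 ≤ X) (hy : 2 ≤ y) :
    ∃ k d K : ℕ, (1 - e) * (X / y) ≤ k ∧ (d : ℝ) ≤ (1 + e / 2) * (X / y) + 1 ∧
      (K : ℝ) ≤ (1 + e / 2) * (X / y) + 13 + 70 * y ∧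
      1 - treeProb n (goodTrees (Fin n) k d K) ≤ 3 * exp (-X) +
        exp (-(e / 8) * exp y + 60 * y ^ 2 + 100 * y ^ 3 + 10 * y * exp ((1 - e / 4) * y)) +
        (exp (4 * X * (X + 1) * exp (-X)) - 1 +
          exp (-e * exp y + y + 2 * (exp y / y) + 4)) := by
  have hX0 : 0 < X := by linarith
  have hlog : log X = y := by rw [hXy, Real.log_exp]
  obtain ⟨S, hS⟩ : ∃ S, S = Nat.log 2 n + 1 := ⟨_, rfl⟩
  obtain ⟨r, hr⟩ : ∃ r, r = 4 * (3 * (3 * (10 * S) + 1)) := ⟨_, rfl⟩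
  obtain ⟨M, hM⟩ : ∃ M, M = 4 * ((r + 1) * (1 + S * r)) := ⟨_, rfl⟩
  obtain ⟨s, hs⟩ : ∃ s, s = Nat.log 2 M + 1 := ⟨_, rfl⟩
  obtain ⟨hS2, hMs, hMn, hsy, hW, hXn⟩ := parameter_bounds hn hX (by linarith) hS hr hM hs
  rw [hlog] at hsy
  have hL : 0 < X / y := by positivity
  have hL2 : X / y ≤ X / 2 := by gcongr
  set k := ⌈(1 - e) * (X / y)⌉₊ with hk
  set d := ⌈(1 + e / 2) * (X / y)⌉₊ with hd
  have hk1 : (1 - e) * (X / y) ≤ k := Nat.le_ceil _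
  have hd1 : (1 + e / 2) * (X / y) ≤ d := Nat.le_ceil _
  have hk2 : (k : ℝ) ≤ (1 - e) * (X / y) + 1 := (Nat.ceil_lt_add_one (by nlinarith)).le
  have hd2 : (d : ℝ) ≤ (1 + e / 2) * (X / y) + 1 := (Nat.ceil_lt_add_one (by positivity)).le
  have hkpos : 1 ≤ k := Nat.ceil_pos.2 (by nlinarith)
  have hkX : (k : ℝ) ≤ X := by nlinarith
  have hX6 : 4 * X + 4 ≤ X ^ 6 := by
    have h1 : 1 ≤ X ^ 4 := one_le_pow₀ (by linarith)
    have h2 : 4 * X + 4 ≤ X ^ 2 := by nlinarith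
    nlinarith [sq_nonneg X]
  have hkn : 4 * k + 4 ≤ n := by
    have : (4 * k + 4 : ℝ) ≤ n := by linarith
    exact_mod_cast this
  obtain ⟨l, hl⟩ : ∃ l, n = l + k + 1 := ⟨n - k - 1, by omega⟩
  have hn0 : 0 < n := by omega
  have hSr : 120 * S + 6 ≤ r := by omega
  have hrM : r ≤ M := by
    rw [hM]
    nlinarith [Nat.zero_le (S * r), Nat.zero_le r, Nat.zero_le (r * (S * r))]
  have hxx : 1 ≤ exp ((1 - e / 4) * y) := Real.one_le_exp (by nlinarith)
  refine ⟨k, d, d + 5 * s + 2 * s + 12, hk1, hd2, ?_, ?_⟩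
  · push_cast
    linarith
  · refine (one_sub_treeProb_goodTrees_le (p := 10 * S) (S := S) (s := s) (j := s) hxx (by omega) hl
      hkpos (by omega) (by omega) (by omega) (by rw [← hr, ← hM]; exact hMs)
      (by rw [← hr, ← hM]; exact hMn)).trans ?_
    rw [← hr]
    have h1 := rch_prob_le hn0 hS2
    have h2 := chain_prob_le hn0 hS2
    have h3 := indeg_prob_le he he1 hn hX0 hXy hy hsy (by positivity) hW rfl hd1
    have h4 := star_prob_le he hn hX0 hXy hy (l := l) (by
      have : n ≤ 2 * l := by omega
      exact_mod_cast this) hk2 hkX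
    have h5 : (1 : ℝ) / n + 2 / n = 3 * exp (-X) := by
      rw [hn, Real.exp_neg]
      field_simp
      norm_num
    linarith

end Asymptotics

end FODef

namespace FODef

section Limits

open Real Filter Topology

theorem tendsto_indeg_exponent {e : ℝ} (he : 0 < e) :
    Tendsto (fun y : ℝ => -(e / 8) * exp y + 60 * y ^ 2 + 100 * y ^ 3 +
      10 * y * exp ((1 - e / 4) * y)) atTop atBot := by
  have h2 := Real.tendsto_pow_mul_exp_neg_atTop_nhds_zero 2
  have h3 := Real.tendsto_pow_mul_exp_neg_atTop_nhds_zero 3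
  have h1 := tendsto_rpow_mul_exp_neg_mul_atTop_nhds_zero 1 (e / 4) (by positivity)
  have h : Tendsto (fun y : ℝ => -(e / 8) + (60 * (y ^ 2 * exp (-y)) + 100 * (y ^ 3 * exp (-y)) +
      10 * (y ^ (1 : ℝ) * exp (-(e / 4) * y)))) atTop
      (𝓝 (-(e / 8) + (60 * 0 + 100 * 0 + 10 * 0))) :=
    tendsto_const_nhds.add (((h2.const_mul 60).add (h3.const_mul 100)).add (h1.const_mul 10))
  refine (Real.tendsto_exp_atTop.atTop_mul_neg (by linarith) h).congr fun y => ?_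
  have h4 : exp y * exp (-y) = 1 := by rw [← Real.exp_add, add_neg_cancel, Real.exp_zero]
  have h5 : exp ((1 - e / 4) * y) = exp y * exp (-(e / 4) * y) := by
    rw [← Real.exp_add]
    congr 1
    ring
  rw [Real.rpow_one, h5]
  linear_combination (60 * y ^ 2 + 100 * y ^ 3) * h4

theorem tendsto_star_exponent {e : ℝ} (he : 0 < e) :
    Tendsto (fun y : ℝ => -e * exp y + y + 2 * (exp y / y) + 4) atTop atBot := by
  have h0 := Real.tendsto_pow_mul_exp_neg_atTop_nhds_zero 0
  have h1 := Real.tendsto_pow_mul_exp_neg_atTop_nhds_zero 1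
  have h : Tendsto (fun y : ℝ => -e + (y ^ 1 * exp (-y) + 2 * y⁻¹ + 4 * (y ^ 0 * exp (-y)))) atTop
      (𝓝 (-e + (0 + 2 * 0 + 4 * 0))) :=
    tendsto_const_nhds.add ((h1.add (tendsto_inv_atTop_zero.const_mul 2)).add (h0.const_mul 4))
  refine (Real.tendsto_exp_atTop.atTop_mul_neg (by linarith) h).congr fun y => ?_
  have h4 : exp y * exp (-y) = 1 := by rw [← Real.exp_add, add_neg_cancel, Real.exp_zero]
  rw [div_eq_mul_inv]
  linear_combination (y + 4) * h4

theorem eventually_depth_slack {e : ℝ} (he : 0 < e) :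
    ∀ᶠ y : ℝ in atTop, 13 + 70 * y ≤ e / 2 * (exp y / y) := by
  have h1 := Real.tendsto_pow_mul_exp_neg_atTop_nhds_zero 1
  have h2 := Real.tendsto_pow_mul_exp_neg_atTop_nhds_zero 2
  have h : Tendsto (fun y : ℝ => 13 * (y ^ 1 * exp (-y)) + 70 * (y ^ 2 * exp (-y))) atTop
      (𝓝 (13 * 0 + 70 * 0)) := (h1.const_mul 13).add (h2.const_mul 70)
  filter_upwards [h.eventually_le_const (show 13 * 0 + 70 * 0 < e / 2 by linarith),
    eventually_gt_atTop 0] with y hy hy0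
  have h4 : exp y * exp (-y) = 1 := by rw [← Real.exp_add, add_neg_cancel, Real.exp_zero]
  rw [← mul_div_assoc, le_div_iff₀ hy0]
  calc (13 + 70 * y) * y = (13 * (y ^ 1 * exp (-y)) + 70 * (y ^ 2 * exp (-y))) * exp y := by
        linear_combination -(13 * y + 70 * y ^ 2) * h4
    _ ≤ e / 2 * exp y := by gcongr

theorem tendsto_star_correction :
    Tendsto (fun X : ℝ => 4 * X * (X + 1) * exp (-X)) atTop (𝓝 0) := by
  have h1 := Real.tendsto_pow_mul_exp_neg_atTop_nhds_zero 1
  have h2 := Real.tendsto_pow_mul_exp_neg_atTop_nhds_zero 2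
  have h := (h2.const_mul 4).add (h1.const_mul 4)
  rw [mul_zero, add_zero] at h
  exact h.congr fun X => by ring

end Limits

end FODef

open Filter FODef

theorem statement3 (ε : ℝ) (hε : 0 < ε) :
    Tendsto (fun n : ℕ => treeProb n
        {T | |(D T : ℝ) * Real.log (Real.log n) / Real.log n - 1| ≤ ε ∧
          |(maxDeg T : ℝ) * Real.log (Real.log n) / Real.log n - 1| ≤ ε})
      atTop (nhds 1) := by
  obtain ⟨e, he, he1, heε⟩ : ∃ e : ℝ, 0 < e ∧ e ≤ 1 / 2 ∧ e ≤ ε :=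
    ⟨min (1 / 2) ε, by positivity, min_le_left _ _, min_le_right _ _⟩
  have hX : Tendsto (fun n : ℕ => Real.log n) atTop atTop :=
    Real.tendsto_log_atTop.comp tendsto_natCast_atTop_atTop
  have hy : Tendsto (fun n : ℕ => Real.log (Real.log n)) atTop atTop :=
    Real.tendsto_log_atTop.comp hX
  have hlim : Tendsto (fun n : ℕ => 1 - (3 * Real.exp (-Real.log n) +
      Real.exp (-(e / 8) * Real.exp (Real.log (Real.log n)) + 60 * Real.log (Real.log n) ^ 2 +
        100 * Real.log (Real.log n) ^ 3 +
        10 * Real.log (Real.log n) * Real.exp ((1 - e / 4) * Real.log (Real.log n))) +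
      (Real.exp (4 * Real.log n * (Real.log n + 1) * Real.exp (-Real.log n)) - 1 +
        Real.exp (-e * Real.exp (Real.log (Real.log n)) + Real.log (Real.log n) +
          2 * (Real.exp (Real.log (Real.log n)) / Real.log (Real.log n)) + 4)))) atTop
      (nhds (1 - (3 * 0 + 0 + (Real.exp 0 - 1 + 0)))) := by
    refine tendsto_const_nhds.sub (((Tendsto.const_mul 3 ?_).add ?_).add ((Tendsto.sub_const ?_ 1).add
      ?_))
    · exact Real.tendsto_exp_neg_atTop_nhds_zero.comp hX
    · exact Real.tendsto_exp_atBot.comp ((tendsto_indeg_exponent he).comp hy)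
    · exact (Real.continuous_exp.tendsto 0).comp (tendsto_star_correction.comp hX)
    · exact Real.tendsto_exp_atBot.comp ((tendsto_star_exponent he).comp hy)
  have h1 : (1 : ℝ) - (3 * 0 + 0 + (Real.exp 0 - 1 + 0)) = 1 := by
    rw [Real.exp_zero]
    norm_num
  rw [h1] at hlim
  refine tendsto_of_tendsto_of_tendsto_of_le_of_le' hlim tendsto_const_nhds ?_
    (Eventually.of_forall fun n => treeProb_le_one _)
  filter_upwards [hX.eventually_ge_atTop 10000, hy.eventually_ge_atTop 2,
    hy.eventually (eventually_depth_slack he), eventually_gt_atTop 0] with n hX0 hy2 hslack hn0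
  obtain ⟨X, hXe⟩ : ∃ X, X = Real.log n := ⟨_, rfl⟩
  obtain ⟨y, hye⟩ : ∃ y, y = Real.log X := ⟨_, rfl⟩
  rw [← hXe] at hX0 hy2 hslack ⊢
  rw [← hye] at hy2 hslack ⊢
  have hn : (n : ℝ) = Real.exp X := by rw [hXe, Real.exp_log (by exact_mod_cast hn0)]
  have hXy : X = Real.exp y := by rw [hye, Real.exp_log (by linarith)]
  obtain ⟨k, d, K, hk, hd, hK, hb⟩ := exists_goodTrees_bound he he1 hn hXy hX0 hy2
  rw [← hXy] at hslack hb ⊢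
  have hy0 : 0 < y := by linarith
  have hXpos : 0 < X := by linarith
  have hclose : ∀ a : ℝ, (1 - e) * (X / y) ≤ a → a ≤ (1 + e) * (X / y) → |a * y / X - 1| ≤ ε := by
    intro a ha1 ha2
    rw [← mul_div_assoc, div_le_iff₀ hy0] at ha1
    rw [← mul_div_assoc, le_div_iff₀ hy0] at ha2
    rw [abs_le]
    have h2 : 1 - e ≤ a * y / X := (le_div_iff₀ hXpos).2 ha1
    have h3 : a * y / X ≤ 1 + e := (div_le_iff₀ hXpos).2 ha2
    constructor <;> linarith
  have hmono : treeProb n (goodTrees (Fin n) k d K) ≤ treeProb n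
      {T | |(D T : ℝ) * y / X - 1| ≤ ε ∧ |(maxDeg T : ℝ) * y / X - 1| ≤ ε} := by
    refine div_le_div_of_nonneg_right ?_ (Nat.cast_nonneg _)
    refine Nat.cast_le.2 (Finset.card_le_card fun T hT => ?_)
    simp only [Finset.mem_filter, Finset.mem_univ, true_and] at hT ⊢
    obtain ⟨hT1, hT2, hD1, hD2, hm1, hm2⟩ := hT
    have hD1' : (k : ℝ) ≤ D T := by exact_mod_cast hD1
    have hD2' : (D T : ℝ) ≤ K := by exact_mod_cast hD2
    have hm1' : (k : ℝ) ≤ maxDeg T := by exact_mod_cast hm1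
    have hm2' : (maxDeg T : ℝ) ≤ d := by exact_mod_cast hm2
    exact ⟨hT1, hT2, hclose _ (hk.trans hD1') (by linarith), hclose _ (hk.trans hm1') (by linarith)⟩
  linarith
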